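/- arXiv:2501.15710 — 4 statements merged into one kernel-verified Lean document; each statement's English description precedes it below -/
import Mathlib

section
/- Let F be a singular holomorphic foliation of codimension one and degree d on the complex projective plane CP^2, all of whose singular points are nondegenerate (i.e., at each singular point p a local defining holomorphic vector field V has nondegenerate linear part DV(p)). Then the sum over all singular points p of F of the Baum–Bott indices BB(F,p) equals (d+2)^2. -/
/- STATEMENT 0 (Baum–Bott index formula): Let F be a singular holomorphic foliation of
codimension one and degree d on ℂℙ², all of whose singular points are nondegenerate.
Then the sum over the singular points p of F of the Baum–Bott indices
BB(F,p) = (trace DV(p))²/det DV(p) equals (d+2)².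

The foliation is described in homogeneous coordinates by an integrable 1-form
`ω = a₀dz₀ + a₁dz₁ + a₂dz₂` with homogeneous coefficients of degree d+1 satisfying the
Euler condition.  In the affine chart `{zᵢ = 1}` of ℂℙ² with coordinates `w`, the
foliation is defined by the restricted form `b₀ dw₀ + b₁ dw₁`, i.e. by the local
holomorphic vector field `V = (b₁, −b₀)`; its Jacobian `DV(p)` at a singular point `p`
computes the Baum–Bott index.  The singular points of F are given by a finite set S of
homogeneous representatives, one for each singular point; nondegeneracy and the value of
the Baum–Bott index are required in every affine chart containing the given point (these
data are chart-independent). -/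

open MvPolynomial

/-- A (singular) holomorphic foliation of codimension one and degree `d` on `ℂℙⁿ`,
described in homogeneous coordinates by the integrable 1-form `ω = ∑ aᵢ dzᵢ` on
`ℂ^{n+1}`, whose coefficients are homogeneous polynomials of degree `d+1` satisfying the
Euler condition, with singular set of codimension at least 2. -/
structure ProjFoliation (n d : ℕ) where
  /-- coefficients of the defining 1-form `∑ aᵢ dzᵢ` -/
  a : Fin (n + 1) → MvPolynomial (Fin (n + 1)) ℂ
  /-- the coefficients are homogeneous of degree `d+1` -/
  homog : ∀ i, (a i).IsHomogeneous (d + 1)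
  /-- the form is not identically zero -/
  nonzero : ∃ i, a i ≠ 0
  /-- integrability `ω ∧ dω = 0`, componentwise -/
  integrable : ∀ i j k,
    a i * (pderiv j (a k) - pderiv k (a j)) +
    a j * (pderiv k (a i) - pderiv i (a k)) +
    a k * (pderiv i (a j) - pderiv j (a i)) = 0
  /-- Euler condition `∑ zᵢ aᵢ = 0` -/
  euler : ∑ i, X i * a i = 0
  /-- the zero set has codimension at least 2: the coefficients have no common
  nonconstant factor -/
  codim2 : ¬ ∃ q : MvPolynomial (Fin (n + 1)) ℂ, q.totalDegree ≠ 0 ∧ ∀ i, q ∣ a i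

/-- The singular locus of the foliation, as a cone in `ℂ^{n+1} ∖ {0}`. -/
def ProjFoliation.singCone {n d : ℕ} (F : ProjFoliation n d) : Set (Fin (n + 1) → ℂ) :=
  {z | z ≠ 0 ∧ ∀ i, eval z (F.a i) = 0}

/-- The holomorphic vector field `V = (b₁, −b₀)` defining `F` in the affine chart
`{zᵢ = 1}` of `ℂℙ²`, where `b_k(w) = a_{σᵢ(k)}(w with 1 inserted at slot i)`. -/
noncomputable def chartVF {d : ℕ} (F : ProjFoliation 2 d) (i : Fin 3) (w : Fin 2 → ℂ) :
    Fin 2 → ℂ :=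
  fun k => if k = 0 then eval (i.insertNth 1 w) (F.a (i.succAbove 1))
           else - eval (i.insertNth 1 w) (F.a (i.succAbove 0))

/-- Entry `(k,l)` of the Jacobian matrix `DV(w₀)` of the chart vector field. -/
noncomputable def chartVFJac {d : ℕ} (F : ProjFoliation 2 d) (i : Fin 3)
    (w₀ : Fin 2 → ℂ) (k l : Fin 2) : ℂ :=
  fderiv ℂ (fun w => chartVF F i w k) w₀ (Pi.single l 1)

/-- Trace of the Jacobian of the chart vector field. -/
noncomputable def chartVFtrace {d : ℕ} (F : ProjFoliation 2 d) (i : Fin 3)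
    (w₀ : Fin 2 → ℂ) : ℂ :=
  chartVFJac F i w₀ 0 0 + chartVFJac F i w₀ 1 1

/-- Determinant of the Jacobian of the chart vector field. -/
noncomputable def chartVFdet {d : ℕ} (F : ProjFoliation 2 d) (i : Fin 3)
    (w₀ : Fin 2 → ℂ) : ℂ :=
  chartVFJac F i w₀ 0 0 * chartVFJac F i w₀ 1 1 -
  chartVFJac F i w₀ 0 1 * chartVFJac F i w₀ 1 0

/-- Affine coordinates in the chart `{zᵢ = 1}` of the point with homogeneous
coordinates `v`. -/
noncomputable def affineCoords (i : Fin 3) (v : Fin 3 → ℂ) : Fin 2 → ℂ :=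
  fun k => v (i.succAbove k) / v i

namespace MvPolynomial

lemma homogeneousComponent_mul_of_isHomogeneous {σ R : Type*} [CommSemiring R]
    {p q : MvPolynomial σ R} {d : ℕ} (hq : q.IsHomogeneous d) (n : ℕ) :
    homogeneousComponent (n + d) (p * q) = homogeneousComponent n p * q := by
  have key : ∀ k, homogeneousComponent (n + d) (homogeneousComponent k p * q) =
      if k = n then homogeneousComponent k p * q else 0 := by
    intro k
    rw [homogeneousComponent_of_mem
      ((mem_homogeneousSubmodule _ _).2 ((homogeneousComponent_isHomogeneous k p).mul hq))]
    simp [eq_comm]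
  conv_lhs => rw [← sum_homogeneousComponent p, Finset.sum_mul, map_sum]
  simp_rw [key]
  rw [Finset.sum_ite_eq']
  split_ifs with h
  · rfl
  · rw [homogeneousComponent_eq_zero _ _ (by simpa using h), zero_mul]

lemma exists_pow_X_eq_sum {σ K : Type*} [Fintype σ] [Field K] [IsAlgClosed K]
    {d : ℕ} {T : σ → MvPolynomial σ K} (hT : ∀ j, (T j).IsHomogeneous d)
    (hzero : ∀ z : σ → K, (∀ j, eval z (T j) = 0) → z = 0) (i : σ) :
    ∃ n, ∀ m ≥ n, ∃ c : σ → MvPolynomial σ K, X i ^ (m + d) = ∑ j, c j * T j ∧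
      ∀ j, (c j).totalDegree ≤ m := by
  have hmem : (X i : MvPolynomial σ K) ∈ (Ideal.span (Set.range T)).radical := by
    rw [← vanishingIdeal_zeroLocus_eq_radical (K := K), mem_vanishingIdeal_iff]
    intro z hz
    rw [hzero z fun j => ?_]
    · simp
    · simpa using hz (T j) (Ideal.subset_span ⟨j, rfl⟩)
  obtain ⟨n, hn⟩ := hmem
  refine ⟨n, fun m hm => ?_⟩
  have h := Ideal.mul_mem_left (Ideal.span (Set.range T)) (X i ^ (m + d - n)) hn
  rw [← pow_add, Nat.sub_add_cancel (by lia)] at h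
  obtain ⟨c, hc⟩ := Ideal.mem_span_range_iff_exists_fun.1 h
  refine ⟨fun j => homogeneousComponent m (c j), ?_,
    fun j => (homogeneousComponent_isHomogeneous m (c j)).totalDegree_le⟩
  simp_rw [← homogeneousComponent_mul_of_isHomogeneous (hT _)]
  rw [← map_sum, hc, homogeneousComponent_eq_self (isHomogeneous_X_pow i _)]

/-- Lowering the degree of a polynomial modulo a family without zeros at infinity. -/
lemma exists_degree_lowering {σ K : Type*} [Fintype σ] [Field K] [IsAlgClosed K]
    {d : ℕ} {F T : σ → MvPolynomial σ K} (hT : ∀ j, (T j).IsHomogeneous d)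
    (hFT : ∀ j, (F j - T j).totalDegree < d)
    (hzero : ∀ z : σ → K, (∀ j, eval z (T j) = 0) → z = 0) :
    ∃ M ≥ d, ∀ m ≥ M, ∀ q : MvPolynomial σ K, q.totalDegree ≤ m + 1 →
      ∃ (c : σ → MvPolynomial σ K) (r : MvPolynomial σ K), q = ∑ j, c j * F j + r ∧
        r.totalDegree ≤ m ∧ ∀ j, (c j).totalDegree ≤ m + 1 - d := by
  choose n hn using exists_pow_X_eq_sum hT hzero
  let N := ∑ i, n i + d
  refine ⟨Fintype.card σ * N + d, by lia, fun m hm q hq => ?_⟩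
  let P : MvPolynomial σ K → Prop := fun q =>
    ∃ (c : σ → MvPolynomial σ K) (r : MvPolynomial σ K), q = ∑ j, c j * F j + r ∧
        r.totalDegree ≤ m ∧ ∀ j, (c j).totalDegree ≤ m + 1 - d
  change P q
  rw [q.as_sum]
  refine Finset.sum_induction _ P ?_ ?_ ?_
  · rintro _ _ ⟨c, r, rfl, hr, hc⟩ ⟨c', r', rfl, hr', hc'⟩
    refine ⟨c + c', r + r', ?_, (totalDegree_add _ _).trans (max_le hr hr'),
      fun j => (totalDegree_add _ _).trans (max_le (hc j) (hc' j))⟩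
    simp only [Pi.add_apply, add_mul, Finset.sum_add_distrib]
    ring
  · exact ⟨0, 0, by simp, by simp, by simp⟩
  intro s hs
  have hsd : s.degree ≤ m + 1 := by
    have := le_totalDegree hs
    rw [Finsupp.degree_eq_sum]
    rw [Finsupp.sum_fintype _ _ (by simp)] at this
    exact this.trans hq
  rcases Nat.lt_or_ge m s.degree with hlt | hle
  swap
  · refine ⟨0, _, by simp; rfl, (totalDegree_monomial_le _ _).trans hle, by simp⟩
  have hsdeg : s.degree = m + 1 := by lia
  obtain ⟨i, hi⟩ : ∃ i, N ≤ s i := by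
    by_contra! h
    have h1 : s.degree ≤ ∑ _i : σ, N := by
      rw [Finsupp.degree_eq_sum]
      exact Finset.sum_le_sum fun i _ => (h i).le
    simp at h1
    lia
  obtain ⟨c, hc, hcd⟩ := hn i (N - d) (by
    have := Finset.single_le_sum (f := n) (fun _ _ => Nat.zero_le _) (Finset.mem_univ i)
    lia)
  rw [Nat.sub_add_cancel (by lia)] at hc
  have hsingle : Finsupp.single i N ≤ s := by simpa using hi
  set a := coeff s q
  set t := s - Finsupp.single i N
  have htdeg : t.degree + N = m + 1 := by
    rw [← hsdeg, ← tsub_add_cancel_of_le hsingle, map_add, Finsupp.degree_single]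
  have hmon : monomial s a = monomial t a * X i ^ N := by
    rw [X_pow_eq_monomial, monomial_mul, mul_one, tsub_add_cancel_of_le hsingle]
  have hmc : ∀ j, (monomial t a * c j).totalDegree ≤ m + 1 - d := fun j => by
    have h1 := totalDegree_mul (monomial t a) (c j)
    have h2 := totalDegree_monomial_le t a
    have h3 := hcd j
    change _ ≤ t.degree at h2
    lia
  refine ⟨fun j => monomial t a * c j, -∑ j, monomial t a * c j * (F j - T j), ?_, ?_, hmc⟩
  · rw [hmon, hc, Finset.mul_sum, ← sub_eq_add_neg, ← Finset.sum_sub_distrib]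
    exact Finset.sum_congr rfl fun j _ => by ring
  · rw [totalDegree_neg]
    refine totalDegree_finsetSum_le fun j _ => ?_
    have h1 := totalDegree_mul (monomial t a * c j) (F j - T j)
    have h2 := hmc j
    have h3 := hFT j
    lia

/-- Division with remainder of bounded degree by a family without zeros at infinity. -/
lemma exists_bounded_remainder {σ K : Type*} [Fintype σ] [Field K] [IsAlgClosed K]
    {d : ℕ} {F T : σ → MvPolynomial σ K} (hT : ∀ j, (T j).IsHomogeneous d)
    (hFT : ∀ j, (F j - T j).totalDegree < d)
    (hzero : ∀ z : σ → K, (∀ j, eval z (T j) = 0) → z = 0) :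
    ∃ M ≥ d, ∀ m ≥ M, ∀ q : MvPolynomial σ K, q.totalDegree ≤ m →
      ∃ (c : σ → MvPolynomial σ K) (r : MvPolynomial σ K), q = ∑ j, c j * F j + r ∧
        r.totalDegree ≤ M ∧ ∀ j, (c j).totalDegree ≤ m - d := by
  obtain ⟨M, hMd, hM⟩ := exists_degree_lowering hT hFT hzero
  refine ⟨M, hMd, fun m hm => ?_⟩
  induction m, hm using Nat.le_induction with
  | base => exact fun q hq => ⟨0, q, by simp, hq, by simp⟩
  | succ m hm ih =>
    intro q hq
    obtain ⟨c, q', rfl, hq', hc⟩ := hM m hm q hq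
    obtain ⟨c', r, rfl, hr, hc'⟩ := ih q' hq'
    refine ⟨c + c', r, ?_, hr, fun j => (totalDegree_add _ _).trans
      (max_le (hc j) ((hc' j).trans (by lia)))⟩
    simp only [Pi.add_apply, add_mul, Finset.sum_add_distrib]
    ring

lemma exists_eq_sum_mul_X_sub_C {σ K : Type*} [Fintype σ] [CommRing K]
    (f : MvPolynomial σ K) (p : σ → K) :
    ∃ b : σ → MvPolynomial σ K, f = C (eval p f) + ∑ k, b k * (X k - C (p k)) := by
  classical
  induction f using MvPolynomial.induction_on with
  | C a => exact ⟨0, by simp⟩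
  | add f g hf hg =>
    obtain ⟨b, hb⟩ := hf
    obtain ⟨c, hc⟩ := hg
    refine ⟨b + c, ?_⟩
    conv_lhs => rw [hb, hc]
    simp only [map_add, Pi.add_apply, add_mul, Finset.sum_add_distrib]
    ring
  | mul_X f i hf =>
    obtain ⟨b, hb⟩ := hf
    refine ⟨fun k => b k * X i + if k = i then C (eval p f) else 0, ?_⟩
    conv_lhs => rw [hb]
    simp only [map_mul, eval_X, add_mul, Finset.sum_add_distrib, ite_mul, zero_mul,
      Finset.sum_ite_eq', Finset.mem_univ, if_true, Finset.sum_mul]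
    have : ∑ x, b x * X i * (X x - C (p x)) = ∑ x, b x * (X x - C (p x)) * X i :=
      Finset.sum_congr rfl fun _ _ => by ring
    rw [this]
    ring

/-- A polynomial vanishing at the zeros of a square system lies in the ideal of the system if all
the zeros are nondegenerate. -/
lemma mem_span_of_forall_eval_eq_zero {σ K : Type*} [Fintype σ] [DecidableEq σ] [Field K]
    [IsAlgClosed K] {F : σ → MvPolynomial σ K}
    (hJ : ∀ p : σ → K, (∀ j, eval p (F j) = 0) →
      (Matrix.of fun j k => eval p (pderiv k (F j))).det ≠ 0)
    {f : MvPolynomial σ K} (hf : ∀ p : σ → K, (∀ j, eval p (F j) = 0) → eval p f = 0) :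
    f ∈ Ideal.span (Set.range F) := by
  set I := Ideal.span (Set.range F) with hI
  by_contra hfI
  let A : Ideal (MvPolynomial σ K) := I.colon {f}
  have hmemA : ∀ h, h ∈ A ↔ h * f ∈ I := fun h => by
    simp [A, Submodule.mem_colon_singleton]
  have hA : A ≠ ⊤ := fun h => hfI (by
    have := (hmemA 1).1 (h ▸ Submodule.mem_top)
    simpa using this)
  obtain ⟨m, hm, hAm⟩ := Ideal.exists_le_maximal A hA
  obtain ⟨p, rfl⟩ := isMaximal_iff_eq_vanishingIdeal_singleton.1 hm
  have hp : ∀ h ∈ A, eval p h = 0 := fun h hh => by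
    simpa using (mem_vanishingIdeal_singleton_iff p h).1 (hAm hh)
  have hFp : ∀ j, eval p (F j) = 0 := fun j =>
    hp _ ((hmemA _).2 (Ideal.mul_mem_right _ _ (Ideal.subset_span ⟨j, rfl⟩)))
  choose B hB using fun j => exists_eq_sum_mul_X_sub_C (F j) p
  obtain ⟨b, hb⟩ := exists_eq_sum_mul_X_sub_C f p
  let BM : Matrix σ σ (MvPolynomial σ K) := Matrix.of B
  have hBM : BM.mulVec (fun k => X k - C (p k)) = F := by
    ext1 j
    rw [hB j, hFp j]
    simp [BM, Matrix.mulVec, dotProduct]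
  have hdet : ∀ k, BM.det * (X k - C (p k)) ∈ I := fun k => by
    have h : (BM.adjugate.mulVec F) k = BM.det * (X k - C (p k)) := by
      rw [← hBM, Matrix.mulVec_mulVec, Matrix.adjugate_mul, Matrix.smul_mulVec, Matrix.one_mulVec]
      rfl
    rw [← h]
    exact Ideal.sum_mem _ fun j _ => Ideal.mul_mem_left _ _ (Ideal.subset_span ⟨j, rfl⟩)
  have hdetA : BM.det ∈ A := by
    rw [hmemA, hb, hf p hFp, map_zero, zero_add, Finset.mul_sum]
    refine Ideal.sum_mem _ fun k _ => ?_
    rw [mul_left_comm]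
    exact Ideal.mul_mem_left _ _ (hdet k)
  refine hJ p hFp ?_
  rw [← hp _ hdetA, RingHom.map_det]
  congr 1
  ext j k
  have h := congrArg (fun q => eval p (pderiv k q)) (hB j)
  simp only [map_add, map_sum, pderiv_C, Derivation.leibniz, map_sub, pderiv_X, smul_eq_mul,
    map_mul, eval_X, eval_C, sub_self, zero_mul, add_zero, zero_add, sub_zero] at h
  simp only [Matrix.of_apply, h, RingHom.mapMatrix_apply, Matrix.map_apply, BM]
  simp [Pi.single_apply, apply_ite]

lemma totalDegree_prod_X_sub_C_le {σ K : Type*} [Field K] (i : σ) (U : Finset K) :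
    (∏ v ∈ U, (X i - C v : MvPolynomial σ K)).totalDegree ≤ U.card := by
  refine (totalDegree_finsetProd _ _).trans ?_
  rw [Finset.card_eq_sum_ones]
  exact Finset.sum_le_sum fun v _ => (totalDegree_sub_C_le _ _).trans (totalDegree_X i).le

/-- A univariate polynomial with simple roots which is a combination of the polynomials of a square
system without zeros at infinity, with coefficients of the expected degree. -/
lemma exists_prod_X_sub_C_eq_sum {σ K : Type*} [Fintype σ] [DecidableEq σ] [Field K]
    [DecidableEq K] [IsAlgClosed K] {d : ℕ} {F T : σ → MvPolynomial σ K}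
    (hT : ∀ j, (T j).IsHomogeneous d) (hFT : ∀ j, (F j - T j).totalDegree < d)
    (hzero : ∀ z : σ → K, (∀ j, eval z (T j) = 0) → z = 0)
    {Z : Finset (σ → K)} (hZ : ∀ p, p ∈ Z ↔ ∀ j, eval p (F j) = 0)
    (hJ : ∀ p ∈ Z, (Matrix.of fun j k => eval p (pderiv k (F j))).det ≠ 0) (i : σ) :
    ∃ U : Finset K, (∀ p ∈ Z, p i ∈ U) ∧ d ≤ U.card ∧ ∃ c : σ → MvPolynomial σ K,
      ∏ v ∈ U, (X i - C v) = ∑ j, c j * F j ∧ ∀ j, (c j).totalDegree ≤ U.card - d := by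
  obtain ⟨M, hMd, hM⟩ := exists_bounded_remainder hT hFT hzero
  set V := Z.image (· i) with hV
  have hg : ∏ v ∈ V, (X i - C v : MvPolynomial σ K) ∈ Ideal.span (Set.range F) := by
    refine mem_span_of_forall_eval_eq_zero (fun p hp => hJ p ((hZ p).2 hp)) fun p hp => ?_
    rw [map_prod]
    exact Finset.prod_eq_zero (Finset.mem_image_of_mem _ ((hZ p).2 hp)) (by simp)
  obtain ⟨c₀, hc₀⟩ := Ideal.mem_span_range_iff_exists_fun.1 hg
  set B := ∑ j, (c₀ j).totalDegree
  obtain ⟨U, hVU, hU⟩ := Infinite.exists_superset_card_eq V (V.card + (M + B + d)) (by lia)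
  have hq : (∏ v ∈ U \ V, (X i - C v : MvPolynomial σ K)).totalDegree ≤ M + B + d := by
    refine (totalDegree_prod_X_sub_C_le i _).trans ?_
    rw [Finset.card_sdiff_of_subset hVU]
    lia
  obtain ⟨c, r, hcr, hr, hc⟩ := hM _ (by lia) _ hq
  refine ⟨U, fun p hp => hVU (Finset.mem_image_of_mem _ hp), by lia,
    fun j => (∏ v ∈ V, (X i - C v)) * c j + r * c₀ j, ?_, fun j => ?_⟩
  · rw [← Finset.prod_sdiff hVU, hcr, add_mul]
    nth_rw 2 [← hc₀]
    simp only [add_mul, Finset.sum_add_distrib, Finset.sum_mul, Finset.mul_sum]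
    congr 1
    · exact Finset.sum_congr rfl fun _ _ => by ring
    · exact Finset.sum_congr rfl fun _ _ => by ring
  · have h1 := totalDegree_mul (∏ v ∈ V, (X i - C v)) (c j)
    have h2 := totalDegree_prod_X_sub_C_le i V
    have h3 := totalDegree_mul r (c₀ j)
    have h4 : (c₀ j).totalDegree ≤ B :=
      Finset.single_le_sum (f := fun j => (c₀ j).totalDegree) (fun _ _ => Nat.zero_le _)
        (Finset.mem_univ j)
    have h5 := hc j
    refine (totalDegree_add _ _).trans (max_le ?_ ?_) <;> lia

lemma sum_pow_div_prod_erase_eq_zero {K : Type*} [Field K] [DecidableEq K] (U : Finset K) {k : ℕ}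
    (hk : k + 1 < U.card) : ∑ x ∈ U, x ^ k / ∏ v ∈ U.erase x, (x - v) = 0 := by
  have h := Lagrange.coeff_eq_sum (s := U) (v := id) (P := (Polynomial.X ^ k : Polynomial K))
    Function.injective_id.injOn (by rw [Polynomial.degree_X_pow]; exact_mod_cast (by lia))
  rw [Polynomial.coeff_X_pow, if_neg (by lia)] at h
  simpa using h.symm

/-- The Euler-Jacobi vanishing theorem for a grid. -/
lemma sum_piFinset_eval_div_eq_zero {σ K : Type*} [Fintype σ] [DecidableEq σ] [Field K]
    [DecidableEq K] (U : σ → Finset K) (h : MvPolynomial σ K)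
    (hh : h.totalDegree + Fintype.card σ < ∑ i, (U i).card) :
    ∑ x ∈ Fintype.piFinset U, eval x h / ∏ i, ∏ v ∈ (U i).erase (x i), (x i - v) = 0 := by
  simp_rw [eval_eq', Finset.sum_div]
  rw [Finset.sum_comm]
  refine Finset.sum_eq_zero fun s hs => ?_
  simp_rw [mul_div_assoc, ← Finset.mul_sum, ← Finset.prod_div_distrib]
  rw [← Finset.prod_univ_sum U fun i t => t ^ s i / ∏ v ∈ (U i).erase t, (t - v)]
  obtain ⟨i, hi⟩ : ∃ i, s i + 1 < (U i).card := by
    by_contra! hc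
    have h1 := Finset.sum_le_sum fun i (_ : i ∈ Finset.univ) => hc i
    have h2 := le_totalDegree hs
    rw [Finsupp.sum_fintype _ _ (by simp)] at h2
    simp only [Finset.sum_add_distrib, Finset.sum_const, Finset.card_univ, smul_eq_mul] at h1
    lia
  rw [Finset.prod_eq_zero (Finset.mem_univ i) (sum_pow_div_prod_erase_eq_zero _ hi), mul_zero]

lemma eval_pderiv_prod_X_sub_C {σ K : Type*} [DecidableEq σ] [Field K] [DecidableEq K]
    {U : Finset K} {p : σ → K} {i : σ} (hp : p i ∈ U) (k : σ) :
    eval p (pderiv k (∏ v ∈ U, (X i - C v))) =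
      if i = k then ∏ v ∈ U.erase (p i), (p i - v) else 0 := by
  rw [← Finset.mul_prod_erase _ _ hp, Derivation.leibniz]
  simp only [map_sub, pderiv_X, pderiv_C, smul_eq_mul, map_add, map_mul, eval_X, eval_C, sub_self,
    zero_mul, zero_add, sub_zero, map_prod]
  split_ifs with h
  · subst h; simp
  · simp [Ne.symm h]

lemma totalDegree_det_le {σ R : Type*} [Fintype σ] [DecidableEq σ] [CommRing R]
    (A : Matrix σ σ (MvPolynomial σ R)) (n : σ → ℕ) (h : ∀ i j, (A i j).totalDegree ≤ n i) :
    A.det.totalDegree ≤ ∑ i, n i := by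
  rw [← Matrix.det_transpose, Matrix.det_apply']
  refine totalDegree_finsetSum_le fun τ _ => ?_
  rw [← map_intCast (C : R →+* MvPolynomial σ R)]
  refine (totalDegree_mul _ _).trans ?_
  rw [totalDegree_C, zero_add]
  exact (totalDegree_finsetProd _ _).trans (Finset.sum_le_sum fun i _ => h _ _)

/-- The **Euler-Jacobi vanishing theorem**: for a square system of equations of degree `d` without
zeros at infinity and with nondegenerate zeros, the sum of the values of `h / J` at the zeros,
where `J` is the Jacobian determinant of the system, vanishes if the degree of `h` is small. -/
theorem sum_eval_div_jacobian_eq_zero {σ K : Type*} [Fintype σ] [DecidableEq σ] [Field K]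
    [IsAlgClosed K] {d : ℕ} {F T : σ → MvPolynomial σ K}
    (hT : ∀ j, (T j).IsHomogeneous d) (hFT : ∀ j, (F j - T j).totalDegree < d)
    (hzero : ∀ z : σ → K, (∀ j, eval z (T j) = 0) → z = 0)
    {Z : Finset (σ → K)} (hZ : ∀ p, p ∈ Z ↔ ∀ j, eval p (F j) = 0)
    (hJ : ∀ p ∈ Z, (Matrix.of fun j k => eval p (pderiv k (F j))).det ≠ 0)
    (h : MvPolynomial σ K) (hh : h.totalDegree + Fintype.card σ < Fintype.card σ * d) :
    ∑ p ∈ Z, eval p h / (Matrix.of fun j k => eval p (pderiv k (F j))).det = 0 := by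
  classical
  choose U hZU hdU A hA hAdeg using exists_prod_X_sub_C_eq_sum hT hFT hzero hZ hJ
  let AM : Matrix σ σ (MvPolynomial σ K) := Matrix.of A
  have hdeg : (h * AM.det).totalDegree + Fintype.card σ < ∑ i, (U i).card := by
    have h1 := totalDegree_mul h AM.det
    have h2 := totalDegree_det_le AM (fun i => (U i).card - d) hAdeg
    have h3 : ∑ i, (U i).card = ∑ i, ((U i).card - d) + Fintype.card σ * d := by
      rw [← Finset.card_univ, ← smul_eq_mul, ← Finset.sum_const, ← Finset.sum_add_distrib]
      exact Finset.sum_congr rfl fun i _ => (Nat.sub_add_cancel (hdU i)).symm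
    lia
  have hmap : ∀ x, eval x AM.det = (Matrix.of fun i j => eval x (A i j)).det := fun x => by
    rw [RingHom.map_det]
    rfl
  rw [← sum_piFinset_eval_div_eq_zero U _ hdeg]
  have hsub : Z ⊆ Fintype.piFinset U := fun p hp =>
    Fintype.mem_piFinset.2 fun i => hZU i p hp
  rw [← Finset.sum_subset hsub fun x hx hxZ => ?_]
  · refine Finset.sum_congr rfl fun p hp => ?_
    have hmul : (Matrix.of fun i j => eval p (A i j)) *
        (Matrix.of fun j k => eval p (pderiv k (F j))) =
        Matrix.diagonal fun i => ∏ v ∈ (U i).erase (p i), (p i - v) := by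
      ext i k
      rw [Matrix.diagonal_apply, ← eval_pderiv_prod_X_sub_C (hZU i p hp), hA]
      simp only [map_sum, Derivation.leibniz, smul_eq_mul, map_add, map_mul, (hZ p).1 hp,
        zero_mul, add_zero]
      rfl
    have hdet := congrArg Matrix.det hmul
    rw [Matrix.det_mul, Matrix.det_diagonal] at hdet
    have hne : ∏ i, ∏ v ∈ (U i).erase (p i), (p i - v) ≠ 0 :=
      Finset.prod_ne_zero_iff.2 fun i _ => Finset.prod_ne_zero_iff.2 fun v hv =>
        sub_ne_zero.2 (Finset.ne_of_mem_erase hv).symm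
    rw [div_eq_div_iff (hJ p hp) hne, map_mul, hmap, mul_assoc, hdet]
  · have hF : (fun j => eval x (F j)) ≠ 0 := fun h0 => hxZ ((hZ x).2 fun j => congrFun h0 j)
    have : (Matrix.of fun i j => eval x (A i j)).det = 0 := by
      refine Matrix.exists_mulVec_eq_zero_iff.1 ⟨_, hF, ?_⟩
      ext i
      have h1 := congrArg (eval x) (hA i)
      rw [map_prod, Finset.prod_eq_zero (Fintype.mem_piFinset.1 hx i) (by simp)] at h1
      simpa [Matrix.mulVec, dotProduct] using h1.symm
    rw [map_mul, hmap, this, mul_zero, zero_div]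

end MvPolynomial

open scoped Matrix

lemma MvPolynomial.IsHomogeneous.eval_smul_eq {σ R : Type*} [Fintype σ] [CommRing R]
    {P : MvPolynomial σ R} {n : ℕ} (hP : P.IsHomogeneous n) (c : R) (z : σ → R) :
    eval (c • z) P = c ^ n * eval z P := by
  rw [eval_eq', eval_eq', Finset.mul_sum]
  refine Finset.sum_congr rfl fun s hs => ?_
  rw [hP.degree_eq_sum_deg_support hs, ← Finsupp.degree_apply, Finsupp.degree_eq_sum,
    ← Finset.prod_pow_eq_pow_sum]
  simp only [Pi.smul_apply, smul_eq_mul, mul_pow, Finset.prod_mul_distrib]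
  ring

lemma MvPolynomial.IsHomogeneous.eval_zero_eq {σ R : Type*} [Fintype σ] [CommRing R]
    {P : MvPolynomial σ R} {n : ℕ} (hP : P.IsHomogeneous n) (hn : n ≠ 0) :
    eval (0 : σ → R) P = 0 := by
  have := hP.eval_smul_eq 0 0
  simpa [hn] using this

/-- A homogeneous polynomial 1-form satisfying the Euler condition is the cross product of a
multiple of its curl with the radial field. -/
lemma exists_eq_cross_X {d : ℕ} {a : Fin 3 → MvPolynomial (Fin 3) ℂ}
    (ha : ∀ i, (a i).IsHomogeneous (d + 1)) (heuler : ∑ i, X i * a i = 0) :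
    ∃ W : Fin 3 → MvPolynomial (Fin 3) ℂ, (∀ i, (W i).IsHomogeneous d) ∧ a = W ⨯₃ X ∧
      ((d : MvPolynomial (Fin 3) ℂ) + 2) * W 0 = pderiv 1 (a 2) - pderiv 2 (a 1) ∧
      ((d : MvPolynomial (Fin 3) ℂ) + 2) * W 1 = pderiv 2 (a 0) - pderiv 0 (a 2) ∧
      ((d : MvPolynomial (Fin 3) ℂ) + 2) * W 2 = pderiv 0 (a 1) - pderiv 1 (a 0) := by
  have hd : ((d : ℂ) + 2) ≠ 0 := by exact_mod_cast (by lia : d + 2 ≠ 0)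
  have hC : ((d : MvPolynomial (Fin 3) ℂ) + 2) = C ((d : ℂ) + 2) := by
    simp [map_ofNat C 2]
  have hinv : C ((d : ℂ) + 2) * C ((d : ℂ) + 2)⁻¹ = (1 : MvPolynomial (Fin 3) ℂ) := by
    rw [← C_mul, mul_inv_cancel₀ hd, C_1]
  have hp : ∀ i j, (pderiv j (a i)).IsHomogeneous d := fun i j => (ha i).pderiv
  refine ⟨fun i => C ((d : ℂ) + 2)⁻¹ * (![pderiv 1 (a 2) - pderiv 2 (a 1),
    pderiv 2 (a 0) - pderiv 0 (a 2), pderiv 0 (a 1) - pderiv 1 (a 0)] i), ?_, ?_, ?_, ?_, ?_⟩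
  · intro i
    refine IsHomogeneous.C_mul ?_ _
    fin_cases i <;> exact (hp _ _).sub (hp _ _)
  · have hE : ∀ j, X 0 * pderiv 0 (a j) + X 1 * pderiv 1 (a j) + X 2 * pderiv 2 (a j) =
        ((d : MvPolynomial (Fin 3) ℂ) + 1) * a j := fun j => by
      have := (ha j).sum_X_mul_pderiv
      simpa [Fin.sum_univ_three] using this
    have hD : ∀ j, pderiv j (X 0 * a 0 + X 1 * a 1 + X 2 * a 2) = 0 := fun j => by
      rw [Fin.sum_univ_three] at heuler
      rw [heuler, map_zero]
    have h0 := hD 0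
    have h1 := hD 1
    have h2 := hD 2
    simp only [map_add, Derivation.leibniz, smul_eq_mul, pderiv_X, Pi.single_apply,
      Fin.isValue, Fin.reduceEq, if_true, if_false, mul_one, mul_zero] at h0 h1 h2
    have e0 := hE 0
    have e1 := hE 1
    have e2 := hE 2
    rw [← hC] at hinv
    ext1 j
    fin_cases j
    · simp [cross_apply]
      linear_combination (-a 0) * hinv - C ((d : ℂ) + 2)⁻¹ * e0 + C ((d : ℂ) + 2)⁻¹ * h0
    · simp [cross_apply]
      linear_combination (-a 1) * hinv - C ((d : ℂ) + 2)⁻¹ * e1 + C ((d : ℂ) + 2)⁻¹ * h1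
    · simp [cross_apply]
      linear_combination (-a 2) * hinv - C ((d : ℂ) + 2)⁻¹ * e2 + C ((d : ℂ) + 2)⁻¹ * h2
  all_goals
    rw [hC, ← mul_assoc, hinv, one_mul]
    rfl

lemma hasFDerivAt_eval_insertNth (i : Fin 3) (P : MvPolynomial (Fin 3) ℂ) (w : Fin 2 → ℂ) :
    HasFDerivAt (fun w : Fin 2 → ℂ => eval (i.insertNth 1 w) P)
      (∑ l, eval (i.insertNth 1 w) (pderiv (i.succAbove l) P) •
        (ContinuousLinearMap.proj l : (Fin 2 → ℂ) →L[ℂ] ℂ)) w := by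
  induction P using MvPolynomial.induction_on with
  | C a =>
    simp only [eval_C]
    refine (hasFDerivAt_const (𝕜 := ℂ) a w).congr_fderiv ?_
    ext m
    simp
  | add p q hp hq =>
    simp only [map_add]
    refine (hp.add hq).congr_fderiv ?_
    ext m
    simp
    ring
  | mul_X p j hp =>
    have hX : HasFDerivAt (fun w : Fin 2 → ℂ => (i.insertNth 1 w : Fin 3 → ℂ) j)
        (∑ l, eval (i.insertNth 1 w) (pderiv (i.succAbove l) (X j : MvPolynomial (Fin 3) ℂ)) •
          (ContinuousLinearMap.proj l : (Fin 2 → ℂ) →L[ℂ] ℂ)) w := by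
      induction j using Fin.succAboveCases i with
      | x =>
        simp only [Fin.insertNth_apply_same]
        refine (hasFDerivAt_const (1 : ℂ) w).congr_fderiv ?_
        ext k
        simp
      | p k =>
        simp only [Fin.insertNth_apply_succAbove]
        refine (hasFDerivAt_apply (𝕜 := ℂ) k w).congr_fderiv ?_
        ext m
        fin_cases k <;> simp [pderiv_X, Pi.single_apply]
    simp only [map_mul, eval_X]
    refine (hp.mul hX).congr_fderiv ?_
    ext m
    simp
    ring

lemma chartVFJac_eq {d : ℕ} (F : ProjFoliation 2 d) (i : Fin 3) (w : Fin 2 → ℂ) (l : Fin 2) :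
    chartVFJac F i w 0 l = eval (i.insertNth 1 w) (pderiv (i.succAbove l) (F.a (i.succAbove 1))) ∧
    chartVFJac F i w 1 l = -eval (i.insertNth 1 w) (pderiv (i.succAbove l) (F.a (i.succAbove 0))) := by
  have h0 := (hasFDerivAt_eval_insertNth i (F.a (i.succAbove 1)) w).fderiv
  have h1 := (hasFDerivAt_eval_insertNth i (F.a (i.succAbove 0)) w).neg.fderiv
  constructor
  · simp only [chartVFJac, chartVF, if_true]
    rw [h0]
    fin_cases l <;> simp
  · simp only [chartVFJac, chartVF, one_ne_zero, if_false]
    refine (congrArg (fun L => L (Pi.single l 1)) h1).trans ?_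
    fin_cases l <;> simp

/-- The linear part at `u` of the field `W` on `ℂ³`, shifted by `-μ`. -/
noncomputable def shiftedJac (W : Fin 3 → MvPolynomial (Fin 3) ℂ) (u : Fin 3 → ℂ) (μ : ℂ) :
    Matrix (Fin 3) (Fin 3) ℂ :=
  Matrix.of (fun k l => eval u (pderiv l (W k))) - μ • 1

lemma insertNth_succAbove_eq {i : Fin 3} {u : Fin 3 → ℂ} (hu : u i = 1) :
    (i.insertNth 1 (fun k => u (i.succAbove k)) : Fin 3 → ℂ) = u := by
  rw [← hu]
  exact Fin.insertNth_self_removeNth i u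

lemma chartVFdet_eq {d : ℕ} (F : ProjFoliation 2 d) {W : Fin 3 → MvPolynomial (Fin 3) ℂ}
    (ha : F.a = W ⨯₃ X) {u : Fin 3 → ℂ} {μ : ℂ} (hW : ∀ k, eval u (W k) = μ * u k)
    {i : Fin 3} (hu : u i = 1) :
    chartVFdet F i (fun k => u (i.succAbove k)) = ((shiftedJac W u μ).adjugate *ᵥ u) i := by
  simp only [chartVFdet, chartVFJac_eq, insertNth_succAbove_eq hu, ha, cross_apply,
    Matrix.adjugate_fin_three]
  fin_cases i <;> simp at hu <;>
  simp [hW, hu, shiftedJac, Matrix.mulVec, dotProduct, Fin.sum_univ_three, Fin.succAbove,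
    pderiv_X] <;> ring

lemma chartVFtrace_sq_eq {d : ℕ} (F : ProjFoliation 2 d) {W : Fin 3 → MvPolynomial (Fin 3) ℂ}
    (h0 : ((d : MvPolynomial (Fin 3) ℂ) + 2) * W 0 = pderiv 1 (F.a 2) - pderiv 2 (F.a 1))
    (h1 : ((d : MvPolynomial (Fin 3) ℂ) + 2) * W 1 = pderiv 2 (F.a 0) - pderiv 0 (F.a 2))
    (h2 : ((d : MvPolynomial (Fin 3) ℂ) + 2) * W 2 = pderiv 0 (F.a 1) - pderiv 1 (F.a 0))
    {u : Fin 3 → ℂ} {μ : ℂ} (hW : ∀ k, eval u (W k) = μ * u k) {i : Fin 3} (hu : u i = 1) :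
    chartVFtrace F i (fun k => u (i.succAbove k)) ^ 2 = ((d : ℂ) + 2) ^ 2 * μ ^ 2 := by
  have e0 := congrArg (eval u) h0
  have e1 := congrArg (eval u) h1
  have e2 := congrArg (eval u) h2
  simp only [map_mul, map_add, map_natCast, map_ofNat, map_sub, hW] at e0 e1 e2
  simp only [chartVFtrace, chartVFJac_eq, insertNth_succAbove_eq hu]
  rw [← mul_pow, sq_eq_sq_iff_eq_or_eq_neg]
  fin_cases i
  · left
    simp at hu
    simp [hu, Fin.succAbove] at e0 ⊢
    linear_combination -e0
  · right
    simp at hu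
    simp [hu, Fin.succAbove] at e1 ⊢
    linear_combination e1
  · left
    simp at hu
    simp [hu, Fin.succAbove] at e2 ⊢
    linear_combination -e2

lemma exists_eq_mul_of_cross_eq_zero {w v : Fin 3 → ℂ} (hv : v ≠ 0) (h : w ⨯₃ v = 0) :
    ∃ μ : ℂ, ∀ k, w k = μ * v k := by
  obtain ⟨i, hi⟩ := Function.ne_iff.1 hv
  refine ⟨w i / v i, fun k => ?_⟩
  have h0 := congrFun h 0
  have h1 := congrFun h 1
  have h2 := congrFun h 2
  simp [cross_apply] at h0 h1 h2 hi
  rw [div_mul_eq_mul_div, eq_div_iff hi]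
  fin_cases i <;> fin_cases k <;> simp <;> grind

lemma eval_cross_X (W : Fin 3 → MvPolynomial (Fin 3) ℂ) (z : Fin 3 → ℂ) :
    (fun i => eval z ((W ⨯₃ X) i)) = (fun k => eval z (W k)) ⨯₃ z := by
  ext i
  fin_cases i <;> simp [cross_apply]

lemma affineCoords_eq {v : Fin 3 → ℂ} (i : Fin 3) :
    affineCoords i v = fun k => ((v i)⁻¹ • v) (i.succAbove k) := by
  ext k
  simp [affineCoords, div_eq_inv_mul]

lemma shiftedJac_smul {d : ℕ} {V : Fin 3 → MvPolynomial (Fin 3) ℂ}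
    (hV : ∀ k, (V k).IsHomogeneous d) {s : ℂ} (hs : s ≠ 0) (z : Fin 3 → ℂ) (ν : ℂ) :
    shiftedJac V (s • z) (s ^ d * s⁻¹ * ν) = (s ^ d * s⁻¹) • shiftedJac V z ν := by
  ext k l
  have h : eval (s • z) (pderiv l (V k)) = s ^ d * s⁻¹ * eval z (pderiv l (V k)) := by
    rcases d with _ | e
    · rw [totalDegree_eq_zero_iff_eq_C.1 ((totalDegree_zero_iff_isHomogeneous _).2 (hV k))]
      simp
    · rw [((hV k).pderiv (i := l)).eval_smul_eq, Nat.add_sub_cancel, pow_succ,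
        mul_inv_cancel_right₀ hs]
  simp only [shiftedJac, Matrix.sub_apply, Matrix.of_apply, Matrix.smul_apply, smul_eq_mul, h]
  ring

/-- The Baum-Bott index at a singular point `z` in terms of the Jacobian of homogeneous fields on
`ℂ³` inducing the foliation. -/
lemma chartVFtrace_sq_div_chartVFdet {d : ℕ} (F : ProjFoliation 2 d)
    {W V : Fin 3 → MvPolynomial (Fin 3) ℂ} (hW : ∀ k, (W k).IsHomogeneous d)
    (hV : ∀ k, (V k).IsHomogeneous d) (ha : F.a = V ⨯₃ X)
    (h0 : ((d : MvPolynomial (Fin 3) ℂ) + 2) * W 0 = pderiv 1 (F.a 2) - pderiv 2 (F.a 1))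
    (h1 : ((d : MvPolynomial (Fin 3) ℂ) + 2) * W 1 = pderiv 2 (F.a 0) - pderiv 0 (F.a 2))
    (h2 : ((d : MvPolynomial (Fin 3) ℂ) + 2) * W 2 = pderiv 0 (F.a 1) - pderiv 1 (F.a 0))
    {z : Fin 3 → ℂ} {μ ν η : ℂ} (hμ : ∀ k, eval z (W k) = μ * z k)
    (hν : ∀ k, eval z (V k) = ν * z k)
    (hη : (shiftedJac V z ν).adjugate *ᵥ z = η • z) {i : Fin 3} (hi : z i ≠ 0)
    (hdet : chartVFdet F i (affineCoords i z) ≠ 0) :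
    η ≠ 0 ∧ chartVFtrace F i (affineCoords i z) ^ 2 / chartVFdet F i (affineCoords i z) =
      ((d : ℂ) + 2) ^ 2 * μ ^ 2 / η := by
  set s := (z i)⁻¹ with hs
  have hs0 : s ≠ 0 := inv_ne_zero hi
  set κ := s ^ d * s⁻¹ with hκ
  have hκ0 : κ ≠ 0 := mul_ne_zero (pow_ne_zero _ hs0) (inv_ne_zero hs0)
  have hu : (s • z) i = 1 := by simp [hs, hi]
  have hscale : ∀ {Y : Fin 3 → MvPolynomial (Fin 3) ℂ} {ρ : ℂ}, (∀ k, (Y k).IsHomogeneous d) →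
      (∀ k, eval z (Y k) = ρ * z k) → ∀ k, eval (s • z) (Y k) = κ * ρ * (s • z) k := by
    intro Y ρ hY hρ k
    rw [(hY k).eval_smul_eq, hρ, Pi.smul_apply, smul_eq_mul, hκ]
    field_simp
  have htr := chartVFtrace_sq_eq F h0 h1 h2 (hscale hW hμ) hu
  have hd := chartVFdet_eq F ha (hscale hV hν) hu
  rw [← affineCoords_eq] at htr hd
  rw [hκ, shiftedJac_smul hV hs0, ← hκ, Matrix.adjugate_smul, Matrix.smul_mulVec,
    Matrix.mulVec_smul, hη, Pi.smul_apply, smul_eq_mul] at hd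
  have hd' : chartVFdet F i (affineCoords i z) = κ ^ 2 * η := by
    rw [hd, Pi.smul_apply, smul_eq_mul, hs]
    simp [mul_left_comm _ η, hi]
  rw [hd'] at hdet ⊢
  have hη0 := right_ne_zero_of_mul hdet
  refine ⟨hη0, ?_⟩
  rw [htr]
  field_simp

/-- The set of eigendirections of a homogeneous field on `ℂ³`, with the Baum-Bott indices expressed
through the Jacobians of the fields inducing the same foliation. -/
structure BaumBottData (d : ℕ) (W : Fin 3 → MvPolynomial (Fin 3) ℂ) (S : Finset (Fin 3 → ℂ))
    (BB : (Fin 3 → ℂ) → ℂ) : Prop where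
  homog : ∀ k, (W k).IsHomogeneous d
  ne_zero : ∀ v ∈ S, v ≠ 0
  exists_eigenvalue : ∀ v ∈ S, ∃ μ : ℂ, ∀ k, eval v (W k) = μ * v k
  exists_rep : ∀ z : Fin 3 → ℂ, z ≠ 0 → ∀ μ : ℂ, (∀ k, eval z (W k) = μ * z k) →
    ∃ v ∈ S, ∃ c : ℂ, c ≠ 0 ∧ z = c • v
  eq_of_smul : ∀ v ∈ S, ∀ w ∈ S, (∃ c : ℂ, c ≠ 0 ∧ w = c • v) → v = w
  index_eq : ∀ v ∈ S, ∀ c : ℂ, c ≠ 0 → ∀ V : Fin 3 → MvPolynomial (Fin 3) ℂ,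
    (∀ k, (V k).IsHomogeneous d) → V ⨯₃ X = W ⨯₃ X → ∀ μ ν η : ℂ,
    (∀ k, eval (c • v) (W k) = μ * (c • v) k) → (∀ k, eval (c • v) (V k) = ν * (c • v) k) →
    (shiftedJac V (c • v) ν).adjugate *ᵥ (c • v) = η • (c • v) →
    η ≠ 0 ∧ BB v = ((d : ℂ) + 2) ^ 2 * μ ^ 2 / η

lemma exists_baumBottData (d : ℕ) (F : ProjFoliation 2 d) (S : Finset (Fin 3 → ℂ))
    (hS0 : ∀ v ∈ S, v ≠ 0)
    (hrep : F.singCone = ⋃ v ∈ S, {z | ∃ c : ℂ, c ≠ 0 ∧ z = c • v})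
    (hdist : ∀ v ∈ S, ∀ w ∈ S, (∃ c : ℂ, c ≠ 0 ∧ w = c • v) → v = w)
    (BB : (Fin 3 → ℂ) → ℂ)
    (hBB : ∀ v ∈ S, ∀ i : Fin 3, v i ≠ 0 →
      chartVFdet F i (affineCoords i v) ≠ 0 ∧
      BB v = (chartVFtrace F i (affineCoords i v)) ^ 2 / chartVFdet F i (affineCoords i v)) :
    ∃ W, BaumBottData d W S BB := by
  obtain ⟨W, hW, ha, h0, h1, h2⟩ := exists_eq_cross_X F.homog F.euler
  refine ⟨W, hW, hS0, fun v hv => ?_, fun z hz μ hμ => ?_, hdist,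
    fun v hv c hc V hV hVW μ ν η hμ hν hη => ?_⟩
  · have hmem : v ∈ F.singCone := by
      rw [hrep]
      exact Set.mem_biUnion hv ⟨1, one_ne_zero, (one_smul _ _).symm⟩
    refine exists_eq_mul_of_cross_eq_zero (hS0 v hv) ?_
    rw [← eval_cross_X, ← ha]
    exact funext hmem.2
  · have hmem : z ∈ F.singCone := by
      refine ⟨hz, fun i => ?_⟩
      rw [ha]
      refine (congrFun (eval_cross_X W z) i).trans ?_
      have : (fun k => eval z (W k)) = μ • z := funext hμ
      rw [this]
      simp [cross_self]
    rw [hrep] at hmem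
    simpa using hmem
  · obtain ⟨i, hi⟩ := Function.ne_iff.1 (hS0 v hv)
    have hcoord : affineCoords i (c • v) = affineCoords i v := by
      ext k
      simp [affineCoords, mul_div_mul_left _ _ hc]
    obtain ⟨hdet, hB⟩ := hBB v hv i hi
    rw [← hcoord] at hdet hB
    rw [hB]
    exact chartVFtrace_sq_div_chartVFdet F hW hV (ha.trans hVW.symm) h0 h1 h2 hμ hν hη
      (by simpa [hc] using hi) hdet

lemma BaumBottData.sum_eq_of_degree_zero {W : Fin 3 → MvPolynomial (Fin 3) ℂ}
    {S : Finset (Fin 3 → ℂ)} {BB : (Fin 3 → ℂ) → ℂ} (h : BaumBottData 0 W S BB) :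
    ∑ v ∈ S, BB v = 4 := by
  obtain ⟨w, hw⟩ : ∃ w : Fin 3 → ℂ, ∀ k, W k = C (w k) :=
    ⟨_, fun k => totalDegree_eq_zero_iff_eq_C.1 ((totalDegree_zero_iff_isHomogeneous _).2 (h.homog k))⟩
  have hBB : ∀ v ∈ S, ∀ μ : ℂ, (∀ k, w k = μ * v k) → μ ≠ 0 ∧ BB v = 4 := by
    intro v hv μ hμ
    have hJ : shiftedJac W v μ = (-μ) • 1 := by
      ext k l
      simp [shiftedJac, hw]
    have := h.index_eq v hv 1 one_ne_zero W h.homog rfl μ μ (μ ^ 2) (by simpa [hw] using hμ)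
      (by simpa [hw] using hμ) (by
        rw [one_smul, hJ, Matrix.adjugate_smul, Matrix.adjugate_one, Matrix.smul_mulVec,
          Matrix.one_mulVec]
        simp)
    obtain ⟨h1, h2⟩ := this
    refine ⟨fun h0 => h1 (by simp [h0]), ?_⟩
    rw [h2, mul_div_assoc, div_self h1]
    norm_num
  have heig : ∀ v ∈ S, ∃ μ : ℂ, ∀ k, w k = μ * v k := fun v hv => by
    simpa [hw] using h.exists_eigenvalue v hv
  obtain ⟨v₀, hv₀⟩ : S.Nonempty := by
    by_cases hw0 : w = 0
    · obtain ⟨v, hv, -⟩ := h.exists_rep 1 one_ne_zero 0 (by simp [hw, hw0])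
      exact ⟨v, hv⟩
    · obtain ⟨v, hv, -⟩ := h.exists_rep w hw0 1 (by simp [hw])
      exact ⟨v, hv⟩
  obtain ⟨μ₀, hμ₀⟩ := heig v₀ hv₀
  have hS : S = {v₀} := by
    refine Finset.eq_singleton_iff_unique_mem.2 ⟨hv₀, fun v hv => ?_⟩
    obtain ⟨μ, hμ⟩ := heig v hv
    have hne := (hBB v hv μ hμ).1
    have hne₀ := (hBB v₀ hv₀ μ₀ hμ₀).1
    refine h.eq_of_smul v hv v₀ hv₀ ⟨μ / μ₀, div_ne_zero hne hne₀, ?_⟩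
    ext k
    rw [Pi.smul_apply, smul_eq_mul, div_mul_eq_mul_div, ← hμ k, hμ₀ k]
    field_simp
  rw [hS, Finset.sum_singleton, (hBB v₀ hv₀ μ₀ hμ₀).2]

lemma Matrix.adjugate_mulVec_of_mulVec_eq_zero {R : Type*} [CommRing R]
    {B : Matrix (Fin 3) (Fin 3) R} {v : Fin 3 → R} (hv : B *ᵥ v = 0) :
    B.adjugate *ᵥ v = B.adjugate.trace • v := by
  have h0 := congrFun hv 0
  have h1 := congrFun hv 1
  have h2 := congrFun hv 2
  simp only [Matrix.mulVec, dotProduct, Fin.sum_univ_three, Pi.zero_apply] at h0 h1 h2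
  ext i
  fin_cases i <;>
    simp [Matrix.adjugate_fin_three, Matrix.mulVec, dotProduct, Fin.sum_univ_three,
      Matrix.trace_fin_three]
  · linear_combination (-B 1 1 - B 2 2) * h0 + B 0 1 * h1 + B 0 2 * h2
  · linear_combination B 1 0 * h0 + (-B 0 0 - B 2 2) * h1 + B 1 2 * h2
  · linear_combination B 2 0 * h0 + B 2 1 * h1 + (-B 0 0 - B 1 1) * h2

lemma Matrix.trace_adjugate_smul_cross_eq_zero {R : Type*} [CommRing R]
    {B : Matrix (Fin 3) (Fin 3) R} {v w : Fin 3 → R} (hv : B *ᵥ v = 0) (hw : B *ᵥ w = 0) :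
    B.adjugate.trace • (v ⨯₃ w) = 0 := by
  have key : B.adjugate.trace • (v ⨯₃ w) =
      (B *ᵥ v) ⨯₃ (B *ᵥ w) + Bᵀ *ᵥ ((B *ᵥ v) ⨯₃ w + v ⨯₃ (B *ᵥ w)) := by
    ext i
    fin_cases i <;>
      simp [Matrix.adjugate_fin_three, Matrix.mulVec, dotProduct, Fin.sum_univ_three,
        Matrix.trace_fin_three, cross_apply] <;> ring
  rw [key, hv, hw]
  simp

lemma Matrix.eval_derivative_charpoly_fin_three {R : Type*} [CommRing R]
    (M : Matrix (Fin 3) (Fin 3) R) (x : R) :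
    (Polynomial.derivative M.charpoly).eval x = (M - x • 1).adjugate.trace := by
  simp [Matrix.charpoly, Matrix.det_fin_three, Matrix.adjugate_fin_three,
    Matrix.trace_fin_three]
  ring

open Polynomial in
lemma Polynomial.Monic.sum_roots_pow_div_derivative {K : Type*} [Field K] [DecidableEq K]
    {p : K[X]} (hp : p.Monic) (hs : p.Splits) (hd : p.natDegree ≠ 0)
    (hsimple : ∀ x ∈ p.roots, p.derivative.eval x ≠ 0) :
    ∑ x ∈ p.roots.toFinset, x ^ (p.natDegree - 1) / p.derivative.eval x = 1 := by
  have hnd : p.roots.Nodup := by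
    rw [Multiset.nodup_iff_count_le_one]
    intro x
    by_contra! h
    rw [count_roots] at h
    have h1 := (one_lt_rootMultiplicity_iff_isRoot hp.ne_zero).1 h
    exact hsimple x ((mem_roots hp.ne_zero).2 h1.1) h1.2
  have hval : p.roots.toFinset.val = p.roots := by rw [Multiset.toFinset_val, hnd.dedup]
  have hcard : p.roots.toFinset.card = p.natDegree := by
    rw [Multiset.toFinset_card_of_nodup hnd, hs.natDegree_eq_card_roots]
  have hlag := Lagrange.coeff_eq_sum (s := p.roots.toFinset) (v := id) (Set.injOn_id _)
    (P := (X : K[X]) ^ (p.natDegree - 1)) (by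
      rw [degree_X_pow, hcard]
      exact_mod_cast Nat.sub_lt (Nat.pos_of_ne_zero hd) one_pos)
  rw [hcard, coeff_X_pow_self] at hlag
  rw [hlag]
  refine Finset.sum_congr rfl fun x hx => ?_
  rw [hs.eval_root_derivative hp (Multiset.mem_toFinset.1 hx), eval_pow, eval_X, id_eq,
    Finset.prod_eq_multiset_prod, Finset.erase_val, hval]
  rfl

lemma BaumBottData.sum_eq_of_degree_one {W : Fin 3 → MvPolynomial (Fin 3) ℂ}
    {S : Finset (Fin 3 → ℂ)} {BB : (Fin 3 → ℂ) → ℂ} (h : BaumBottData 1 W S BB) :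
    ∑ v ∈ S, BB v = 9 := by
  set M : Matrix (Fin 3) (Fin 3) ℂ := Matrix.of fun k l => eval 0 (pderiv l (W k)) with hM
  have hconst : ∀ z k l, eval z (pderiv l (W k)) = M k l := by
    intro z k l
    rw [totalDegree_eq_zero_iff_eq_C.1 ((totalDegree_zero_iff_isHomogeneous _).2
      ((h.homog k).pderiv (i := l)))]
    simp [hM, constantCoeff_eq]
  have hJ : ∀ z μ, shiftedJac W z μ = M - μ • 1 := by
    intro z μ
    ext k l
    simp [shiftedJac, hconst]
  have heval : ∀ z k, eval z (W k) = (M *ᵥ z) k := by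
    intro z k
    have := congrArg (eval z) (h.homog k).sum_X_mul_pderiv
    simp only [map_sum, map_mul, eval_X, hconst, one_smul] at this
    rw [← this]
    simp [Matrix.mulVec, dotProduct, mul_comm]
  have heig : ∀ z μ, (∀ k, eval z (W k) = μ * z k) ↔ (M - μ • 1) *ᵥ z = 0 := by
    intro z μ
    rw [Matrix.sub_mulVec, Matrix.smul_mulVec, Matrix.one_mulVec, sub_eq_zero, funext_iff]
    simp [heval]
  have hroot : ∀ μ, μ ∈ M.charpoly.roots ↔ ∃ z, z ≠ 0 ∧ (M - μ • 1) *ᵥ z = 0 := by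
    intro μ
    rw [Matrix.exists_mulVec_eq_zero_iff, Polynomial.mem_roots M.charpoly_monic.ne_zero,
      Polynomial.IsRoot, Matrix.eval_charpoly, ← neg_sub, Matrix.det_neg,
      Matrix.smul_one_eq_diagonal]
    simp [Matrix.scalar_apply]
  choose! e he using h.exists_eigenvalue
  have hbb : ∀ v ∈ S, (Polynomial.derivative M.charpoly).eval (e v) ≠ 0 ∧
      BB v = 9 * (e v ^ 2 / (Polynomial.derivative M.charpoly).eval (e v)) := by
    intro v hv
    obtain ⟨h1, h2⟩ := h.index_eq v hv 1 one_ne_zero W h.homog rfl (e v) (e v) _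
      (by simpa using he v hv) (by simpa using he v hv) (by
        rw [hJ, Matrix.adjugate_mulVec_of_mulVec_eq_zero]
        rw [← heig]
        simpa using he v hv)
    rw [Matrix.eval_derivative_charpoly_fin_three]
    refine ⟨h1, h2.trans ?_⟩
    norm_num
    ring
  have hinj : Set.InjOn e S := by
    intro v hv w hw hvw
    have h1 := (heig v _).1 (he v hv)
    have h2 := (heig w _).1 (he w hw)
    rw [← hvw] at h2
    have h3 := Matrix.trace_adjugate_smul_cross_eq_zero h2 h1
    rw [← Matrix.eval_derivative_charpoly_fin_three] at h3
    obtain ⟨c, hc⟩ := exists_eq_mul_of_cross_eq_zero (h.ne_zero v hv)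
      ((smul_eq_zero_iff_right (hbb v hv).1).1 h3)
    refine h.eq_of_smul v hv w hw ⟨c, ?_, funext hc⟩
    rintro rfl
    exact h.ne_zero w hw (funext fun k => by simpa using hc k)
  have himage : M.charpoly.roots.toFinset = S.image e := by
    ext μ
    rw [Multiset.mem_toFinset, Finset.mem_image, hroot]
    constructor
    · rintro ⟨z, hz, hμ⟩
      obtain ⟨v, hv, c, hc, rfl⟩ := h.exists_rep z hz μ ((heig z μ).2 hμ)
      refine ⟨v, hv, ?_⟩
      obtain ⟨i, hi⟩ := Function.ne_iff.1 (h.ne_zero v hv)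
      have h1 := he v hv i
      rw [Matrix.mulVec_smul, smul_eq_zero_iff_right hc, ← heig] at hμ
      exact mul_right_cancel₀ hi (h1.symm.trans (hμ i))
    · rintro ⟨v, hv, rfl⟩
      exact ⟨v, h.ne_zero v hv, (heig v _).1 (he v hv)⟩
  have hsum := M.charpoly_monic.sum_roots_pow_div_derivative (IsAlgClosed.splits _)
    (by simp [Matrix.charpoly_natDegree_eq_dim]) (fun x hx => by
      rw [← Multiset.mem_toFinset, himage, Finset.mem_image] at hx
      obtain ⟨v, hv, rfl⟩ := hx
      exact (hbb v hv).1)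
  rw [himage, Finset.sum_image hinj, Matrix.charpoly_natDegree_eq_dim, Fintype.card_fin] at hsum
  rw [Finset.sum_congr rfl fun v hv => (hbb v hv).2, ← Finset.mul_sum, hsum, mul_one]

lemma MvPolynomial.exists_isHomogeneous_forall_add_eval_ne_zero {ι K : Type*} [Fintype ι]
    [Field K] [Infinite K] (n : ℕ) (S : Finset (ι → K)) (hS : ∀ v ∈ S, v ≠ 0)
    (a : (ι → K) → K) :
    ∃ P : MvPolynomial ι K, P.IsHomogeneous n ∧ ∀ v ∈ S, a v + eval v P ≠ 0 := by
  classical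
  obtain ⟨f, hf⟩ := Module.exists_dual_forall_apply_ne_zero (K := K) (fun v : S => (v : ι → K))
    (fun v => hS v v.2)
  set L : MvPolynomial ι K := ∑ k, C (f (Pi.single k 1)) * X k with hL
  have hLeval : ∀ v, eval v L = f v := by
    intro v
    conv_rhs => rw [pi_eq_sum_univ' v]
    simp [hL, map_sum, mul_comm]
  have hLhom : L.IsHomogeneous 1 :=
    IsHomogeneous.sum _ _ _ fun k _ => by
      simpa using (isHomogeneous_C ι _).mul (isHomogeneous_X K k)
  obtain ⟨c, hc⟩ := Infinite.exists_notMem_finset (S.image fun v => -a v / f v ^ n)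
  refine ⟨C c * L ^ n, by simpa using (isHomogeneous_C ι c).mul (hLhom.pow n), fun v hv h0 => ?_⟩
  refine hc (Finset.mem_image.2 ⟨v, hv, ?_⟩)
  have hfv : f v ^ n ≠ 0 := pow_ne_zero _ (hf ⟨v, hv⟩)
  rw [map_mul, eval_C, map_pow, hLeval] at h0
  rw [div_eq_iff hfv]
  linear_combination -h0

lemma card_nthRootsFinset_complex {n : ℕ} (hn : n ≠ 0) {a : ℂ} (ha : a ≠ 0) :
    (Polynomial.nthRootsFinset n a).card = n := by
  have hζ := Complex.isPrimitiveRoot_exp n hn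
  rw [Polynomial.nthRootsFinset_def, Multiset.toFinset_card_of_nodup (hζ.nthRoots_nodup ha),
    hζ.card_nthRoots, if_pos]
  exact IsAlgClosed.exists_pow_nat_eq a (Nat.pos_of_ne_zero hn)

lemma shiftedJac_mulVec {d : ℕ} {V : Fin 3 → MvPolynomial (Fin 3) ℂ}
    (hV : ∀ k, (V k).IsHomogeneous d) {z : Fin 3 → ℂ} {ν : ℂ} (hz : ∀ k, eval z (V k) = ν * z k) :
    shiftedJac V z ν *ᵥ z = ((d - 1) * ν) • z := by
  rw [shiftedJac, Matrix.sub_mulVec, Matrix.smul_mulVec, Matrix.one_mulVec]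
  ext k
  have := congrArg (eval z) (hV k).sum_X_mul_pderiv
  simp only [map_sum, map_mul, eval_X, map_natCast, nsmul_eq_mul, hz k] at this
  simp only [Pi.sub_apply, Pi.smul_apply, Matrix.mulVec, dotProduct, Matrix.of_apply, smul_eq_mul]
  simp only [mul_comm (eval z _)]
  rw [this]
  ring

lemma of_pderiv_sub_X (V : Fin 3 → MvPolynomial (Fin 3) ℂ) (z : Fin 3 → ℂ) :
    (Matrix.of fun k l => eval z (pderiv l (V k - X k))) = shiftedJac V z 1 := by
  ext k l
  by_cases hkl : k = l
  · subst hkl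
    simp [shiftedJac]
  · simp [shiftedJac, hkl, pderiv_X, Pi.single_apply]

/-- The index at a fixed point of `V = W + h X`, with residue denominator for the system
`V k - X k`. -/
lemma BaumBottData.det_ne_zero_and_index_eq {e : ℕ} {W : Fin 3 → MvPolynomial (Fin 3) ℂ}
    {S : Finset (Fin 3 → ℂ)} {BB : (Fin 3 → ℂ) → ℂ} (h : BaumBottData (e + 1) W S BB)
    (he : e ≠ 0) {P : MvPolynomial (Fin 3) ℂ} (hP : P.IsHomogeneous e) {v : Fin 3 → ℂ}
    (hv : v ∈ S) {c : ℂ} (hc : c ≠ 0)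
    (hfix : ∀ k, eval (c • v) (W k + P * X k) = (c • v) k) :
    (shiftedJac (fun k => W k + P * X k) (c • v) 1).det ≠ 0 ∧
    eval (c • v) ((1 - P) ^ 2) / (shiftedJac (fun k => W k + P * X k) (c • v) 1).det =
      BB v / (((e + 1 : ℕ) : ℂ) + 2) ^ 2 / e := by
  have hV : ∀ k, (W k + P * X k).IsHomogeneous (e + 1) :=
    fun k => (h.homog k).add (hP.mul (isHomogeneous_X ℂ k))
  have heC : (e : ℂ) ≠ 0 := Nat.cast_ne_zero.2 he
  have hd : ((e + 1 : ℕ) : ℂ) + 2 ≠ 0 := by exact_mod_cast (by lia : e + 1 + 2 ≠ 0)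
  set B := shiftedJac (fun k => W k + P * X k) (c • v) 1 with hB
  have hBv : B *ᵥ (c • v) = (e : ℂ) • (c • v) := by
    rw [hB, shiftedJac_mulVec hV (by simpa using hfix)]
    simp
  have hadj : B.adjugate *ᵥ (c • v) = (B.det / e) • (c • v) := by
    have h1 := congrArg (B.adjugate *ᵥ ·) hBv
    simp only [Matrix.mulVec_mulVec, Matrix.adjugate_mul, Matrix.smul_mulVec, Matrix.one_mulVec]
      at h1
    rw [Matrix.mulVec_smul B.adjugate (e : ℂ)] at h1
    rw [div_eq_inv_mul, mul_smul, h1, smul_smul, inv_mul_cancel₀ heC, one_smul]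
  have hcross : (fun k => W k + P * X k) ⨯₃ X = W ⨯₃ X := by
    ext1 i
    fin_cases i <;> simp [cross_apply] <;> ring
  obtain ⟨h1, h2⟩ := h.index_eq v hv c hc _ hV hcross (1 - eval (c • v) P) 1 (B.det / e)
    (fun k => by
      have := hfix k
      simp only [map_add, map_mul, eval_X] at this
      linear_combination this)
    (by simpa using hfix) hadj
  have hdet : B.det ≠ 0 := fun h0 => h1 (by rw [h0, zero_div])
  refine ⟨hdet, ?_⟩
  rw [h2]
  simp only [map_pow, map_sub, map_one]
  field_simp

lemma BaumBottData.sum_eq_of_degree_succ {e : ℕ} (he : e ≠ 0)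
    {W : Fin 3 → MvPolynomial (Fin 3) ℂ} {S : Finset (Fin 3 → ℂ)} {BB : (Fin 3 → ℂ) → ℂ}
    (h : BaumBottData (e + 1) W S BB) :
    ∑ v ∈ S, BB v = (((e + 1 : ℕ) : ℂ) + 2) ^ 2 := by
  choose! a ha using h.exists_eigenvalue
  obtain ⟨P, hP, hne⟩ := exists_isHomogeneous_forall_add_eval_ne_zero e S h.ne_zero a
  have heC : (e : ℂ) ≠ 0 := Nat.cast_ne_zero.2 he
  have hd : ((e + 1 : ℕ) : ℂ) + 2 ≠ 0 := by exact_mod_cast (by lia : e + 1 + 2 ≠ 0)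
  set V : Fin 3 → MvPolynomial (Fin 3) ℂ := fun k => W k + P * X k with hVdef
  have hV : ∀ k, (V k).IsHomogeneous (e + 1) :=
    fun k => (h.homog k).add (hP.mul (isHomogeneous_X ℂ k))
  set b : (Fin 3 → ℂ) → ℂ := fun v => a v + eval v P with hb
  have hVv : ∀ v ∈ S, ∀ (c : ℂ) k, eval (c • v) (V k) = c ^ e * b v * (c • v) k := by
    intro v hv c k
    rw [(hV k).eval_smul_eq]
    simp only [hVdef, map_add, map_mul, eval_X, ha v hv, hb, Pi.smul_apply, smul_eq_mul]
    ring
  have hrep : ∀ z : Fin 3 → ℂ, z ≠ 0 → ∀ ν : ℂ, (∀ k, eval z (V k) = ν * z k) →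
      ∃ v ∈ S, ∃ c : ℂ, c ≠ 0 ∧ z = c • v ∧ ν = c ^ e * b v := by
    intro z hz ν hν
    obtain ⟨v, hv, c, hc, rfl⟩ := h.exists_rep z hz (ν - eval z P) fun k => by
      have := hν k
      simp only [hVdef, map_add, map_mul, eval_X] at this
      linear_combination this
    refine ⟨v, hv, c, hc, rfl, ?_⟩
    obtain ⟨i, hi⟩ := Function.ne_iff.1 hz
    exact mul_right_cancel₀ hi ((hν i).symm.trans (hVv v hv c i))
  set R : (Fin 3 → ℂ) → Finset ℂ := fun v => Polynomial.nthRootsFinset e (b v)⁻¹ with hR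
  have hmemR : ∀ v ∈ S, ∀ c, c ∈ R v ↔ c ^ e * b v = 1 := by
    intro v hv c
    rw [hR, Polynomial.mem_nthRootsFinset (Nat.pos_of_ne_zero he), ← one_div,
      eq_div_iff (hne v hv)]
  have hR0 : ∀ v ∈ S, ∀ c ∈ R v, c ≠ 0 := by
    rintro v hv c hc rfl
    simpa [he] using (hmemR v hv 0).1 hc
  set Z₁ : Finset (Fin 3 → ℂ) := S.biUnion fun v => (R v).image (· • v) with hZ₁
  have hfix : ∀ v ∈ S, ∀ c ∈ R v, ∀ k, eval (c • v) (V k) = (c • v) k := by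
    intro v hv c hc k
    rw [hVv v hv, (hmemR v hv c).1 hc, one_mul]
  have hmemZ₁ : ∀ p, p ∈ Z₁ ↔ ∃ v ∈ S, ∃ c ∈ R v, c • v = p := by
    intro p
    simp [hZ₁]
  have h0Z₁ : (0 : Fin 3 → ℂ) ∉ Z₁ := by
    rw [hmemZ₁]
    rintro ⟨v, hv, c, hc, h0⟩
    exact smul_ne_zero (hR0 v hv c hc) (h.ne_zero v hv) h0
  have hV0 : ∀ k, eval (0 : Fin 3 → ℂ) (V k) = 0 := fun k => (hV k).eval_zero_eq e.succ_ne_zero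
  have hP0 : eval (0 : Fin 3 → ℂ) P = 0 := hP.eval_zero_eq he
  have hJ0 : (shiftedJac V 0 1).det = -1 := by
    have : shiftedJac V 0 1 = -1 := by
      ext k l
      have := ((hV k).pderiv (i := l)).eval_zero_eq (by simpa using he)
      simpa [shiftedJac] using this
    rw [this, Matrix.det_neg]
    norm_num
  have hEJ := sum_eval_div_jacobian_eq_zero (d := e + 1) (F := fun k => V k - X k) (T := V) hV
    (fun k => by
      rw [sub_sub_cancel_left, totalDegree_neg, totalDegree_X]
      lia)
    (fun z hz => by
      by_contra hz0
      obtain ⟨v, hv, c, hc, -, h0⟩ := hrep z hz0 0 (by simpa using hz)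
      exact mul_ne_zero (pow_ne_zero _ hc) (hne v hv) h0.symm)
    (Z := insert 0 Z₁)
    (fun p => by
      rw [Finset.mem_insert, hmemZ₁]
      simp only [map_sub, eval_X, sub_eq_zero]
      constructor
      · rintro (rfl | ⟨v, hv, c, hc, rfl⟩)
        · exact hV0
        · exact hfix v hv c hc
      · intro hp
        by_cases hp0 : p = 0
        · exact Or.inl hp0
        · obtain ⟨v, hv, c, hc, rfl, h1⟩ := hrep p hp0 1 (by simpa using hp)
          exact Or.inr ⟨v, hv, c, (hmemR v hv c).2 h1.symm, rfl⟩)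
    (fun p hp => by
      rw [of_pderiv_sub_X]
      rw [Finset.mem_insert, hmemZ₁] at hp
      obtain rfl | ⟨v, hv, c, hc, rfl⟩ := hp
      · rw [hJ0]
        norm_num
      · exact (h.det_ne_zero_and_index_eq he hP hv (hR0 v hv c hc) (hfix v hv c hc)).1)
    ((1 - P) ^ 2) (by
      have h1 : (1 - P).totalDegree ≤ e :=
        (totalDegree_sub _ _).trans (max_le (by simp) hP.totalDegree_le)
      have h2 := totalDegree_pow (1 - P) 2
      rw [Fintype.card_fin]
      lia)
  simp only [of_pderiv_sub_X] at hEJ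
  have hdisj : (S : Set (Fin 3 → ℂ)).PairwiseDisjoint fun v => (R v).image (· • v) := by
    intro v hv w hw hvw
    refine Finset.disjoint_left.2 fun p hpv hpw => hvw ?_
    obtain ⟨c, hc, rfl⟩ := Finset.mem_image.1 hpv
    obtain ⟨c', hc', heq⟩ := Finset.mem_image.1 hpw
    have hc0 := hR0 v hv c hc
    have hc0' := hR0 w hw c' hc'
    refine h.eq_of_smul v hv w hw ⟨c'⁻¹ * c, mul_ne_zero (inv_ne_zero hc0') hc0, ?_⟩
    rw [mul_smul, ← heq, smul_smul, inv_mul_cancel₀ hc0', one_smul]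
  have hinner : ∀ v ∈ S, ∑ p ∈ (R v).image (· • v),
      eval p ((1 - P) ^ 2) / (shiftedJac V p 1).det = BB v / (((e + 1 : ℕ) : ℂ) + 2) ^ 2 := by
    intro v hv
    rw [Finset.sum_image (smul_left_injective ℂ (h.ne_zero v hv)).injOn,
      Finset.sum_congr rfl fun c hc =>
        (h.det_ne_zero_and_index_eq he hP hv (hR0 v hv c hc) (hfix v hv c hc)).2,
      Finset.sum_const, card_nthRootsFinset_complex he (inv_ne_zero (hne v hv)), nsmul_eq_mul,
      mul_div_cancel₀ _ heC]
  rw [Finset.sum_insert h0Z₁, hJ0, hZ₁, Finset.sum_biUnion hdisj, Finset.sum_congr rfl hinner,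
    ← Finset.sum_div] at hEJ
  simp only [map_pow, map_sub, map_one, hP0] at hEJ
  field_simp at hEJ
  linear_combination hEJ

/-- The Baum–Bott index formula on `ℂℙ²`:  if all singular points of `F` are
nondegenerate then the sum of the Baum–Bott indices over the singular points is
`(d+2)²`. -/
theorem baum_bott_index_formula (d : ℕ) (F : ProjFoliation 2 d)
    (S : Finset (Fin 3 → ℂ))
    (hS0 : ∀ v ∈ S, v ≠ 0)
    -- `S` consists of homogeneous representatives of the singular points of `F` …
    (hrep : F.singCone = ⋃ v ∈ S, {z | ∃ c : ℂ, c ≠ 0 ∧ z = c • v})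
    -- … exactly one for each singular point
    (hdist : ∀ v ∈ S, ∀ w ∈ S, (∃ c : ℂ, c ≠ 0 ∧ w = c • v) → v = w)
    (BB : (Fin 3 → ℂ) → ℂ)
    -- every singular point is nondegenerate, and `BB v` is its Baum–Bott index,
    -- computed from a local defining holomorphic vector field in any chart containing it
    (hBB : ∀ v ∈ S, ∀ i : Fin 3, v i ≠ 0 →
      chartVFdet F i (affineCoords i v) ≠ 0 ∧
      BB v = (chartVFtrace F i (affineCoords i v)) ^ 2 / chartVFdet F i (affineCoords i v)) :
    ∑ v ∈ S, BB v = ((d : ℂ) + 2) ^ 2 := by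
  obtain ⟨W, hW⟩ := exists_baumBottData d F S hS0 hrep hdist BB hBB
  rcases d with _ | _ | e
  · rw [hW.sum_eq_of_degree_zero]
    norm_num
  · rw [hW.sum_eq_of_degree_one]
    norm_num
  · exact hW.sum_eq_of_degree_succ e.succ_ne_zero
end

section
/- There does not exist a nonsingular holomorphic foliation of codimension one on the complex projective plane CP^2; that is, every singular holomorphic foliation on CP^2 has nonempty singular locus. -/
/- STATEMENT 1: There does not exist a nonsingular holomorphic foliation of codimension one
on the complex projective plane CP²; that is, every singular holomorphic foliation on CP²
has nonempty singular locus.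

Following the standard description (see context), a codimension-one singular holomorphic
foliation of degree `d` on `ℂℙⁿ` is given by an integrable holomorphic 1-form
`ω = ∑ aᵢ dzᵢ` on `ℂ^{n+1}` whose coefficients are homogeneous polynomials of degree `d+1`
satisfying the Euler condition `∑ zᵢ aᵢ ≡ 0`, with zero set of codimension ≥ 2
(no common nonconstant factor).  The singular locus is the common zero set of the `aᵢ`,
viewed as a cone in `ℂ^{n+1} ∖ {0}`. -/

open MvPolynomial

namespace MvPolynomial

/-- The space of ternary forms of degree `n` has dimension `(n + 2).choose 2`. -/
lemma finrank_homogeneousSubmodule_fin_three (n : ℕ) :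
    Module.finrank ℂ (homogeneousSubmodule (Fin 3) ℂ n) = (n + 2).choose 2 := by
  classical
  have hset : {s : Fin 3 →₀ ℕ | s.degree = n} =
      ((Finset.univ : Finset (Fin 3)).finsuppAntidiag n : Set (Fin 3 →₀ ℕ)) := by
    ext s
    simp [Finset.mem_finsuppAntidiag, Finsupp.degree_eq_sum]
  rw [homogeneousSubmodule_eq_finsupp_supported, hset]
  refine (Module.finrank_eq_card_basis (basisRestrictSupport ℂ
    ((Finset.univ : Finset (Fin 3)).finsuppAntidiag n : Set (Fin 3 →₀ ℕ)))).trans ?_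
  rw [← Nat.card_eq_fintype_card, Nat.card_coe_set_eq, Set.ncard_coe_finset,
    Finset.card_finsuppAntidiag_nat_eq_choose,
    Finset.card_univ, Fintype.card_fin, show 3 + n - 1 = n + 2 by omega,
    Nat.choose_symm_add]

instance finite_homogeneousSubmodule_fin_three (n : ℕ) :
    Module.Finite ℂ (homogeneousSubmodule (Fin 3) ℂ n) :=
  Module.finite_of_finrank_pos <| by
    rw [finrank_homogeneousSubmodule_fin_three]
    exact Nat.choose_pos (by omega)

/-- The space of ternary forms of degree `n`. -/
abbrev ternaryForms (n : ℕ) : Submodule ℂ (MvPolynomial (Fin 3) ℂ) :=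
  homogeneousSubmodule (Fin 3) ℂ n

/-- Multiplication by a form of degree `e`, as a map from forms of degree `p` to forms of
degree `q = e + p`. -/
noncomputable def mulForm {σ : Type*} {a : MvPolynomial σ ℂ} {e : ℕ} (ha : a.IsHomogeneous e)
    {p q : ℕ} (hq : e + p = q) :
    homogeneousSubmodule σ ℂ p →ₗ[ℂ] homogeneousSubmodule σ ℂ q :=
  (LinearMap.mulLeft ℂ a).restrict fun _ hx => hq ▸ ha.mul hx

@[simp]
lemma coe_mulForm {σ : Type*} {a : MvPolynomial σ ℂ} {e : ℕ} (ha : a.IsHomogeneous e)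
    {p q : ℕ} (hq : e + p = q) (x : homogeneousSubmodule σ ℂ p) :
    (mulForm ha hq x : MvPolynomial σ ℂ) = a * x := rfl

lemma homogeneousComponent_mul_of_isHomogeneous_s1 {σ : Type*} {a : MvPolynomial σ ℂ} {e : ℕ}
    (ha : a.IsHomogeneous e) (b : MvPolynomial σ ℂ) (p : ℕ) :
    homogeneousComponent (e + p) (a * b) = a * homogeneousComponent p b := by
  let _ := gradedAlgebra (σ := σ) (R := ℂ)
  have h := DirectSum.coe_decompose_mul_add_of_left_mem (homogeneousSubmodule σ ℂ)
    (i := e) (j := p) (b := b) ha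
  rw [← decomposition.decompose'_apply, ← decomposition.decompose'_apply]
  exact h

/-- A form of degree `e + p` in the ideal generated by two forms of degree `e` is a combination
of them with coefficients of degree `p`. -/
lemma exists_isHomogeneous_of_mem_span_pair {σ : Type*} {a b f : MvPolynomial σ ℂ} {e p : ℕ}
    (ha : a.IsHomogeneous e) (hb : b.IsHomogeneous e) (hf : f.IsHomogeneous (e + p))
    (h : f ∈ Ideal.span {a, b}) :
    ∃ u v : MvPolynomial σ ℂ, u.IsHomogeneous p ∧ v.IsHomogeneous p ∧ a * u + b * v = f := by
  obtain ⟨u, v, rfl⟩ := Ideal.mem_span_pair.1 h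
  refine ⟨_, _, homogeneousComponent_isHomogeneous p u,
    homogeneousComponent_isHomogeneous p v, ?_⟩
  rw [← homogeneousComponent_mul_of_isHomogeneous_s1 ha,
    ← homogeneousComponent_mul_of_isHomogeneous_s1 hb,
    ← map_add, mul_comm a, mul_comm b]
  exact homogeneousComponent_eq_self hf

/-- An ideal with no zero besides the origin contains all forms of large degree. -/
lemma exists_forall_isHomogeneous_mem {σ : Type*} [Finite σ] {I : Ideal (MvPolynomial σ ℂ)}
    (h : zeroLocus ℂ I ⊆ {0}) :
    ∃ N, ∀ n ≥ N, ∀ r : MvPolynomial σ ℂ, r.IsHomogeneous n → r ∈ I := by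
  have hX : Ideal.span (Set.range (X : σ → MvPolynomial σ ℂ)) ≤ I.radical := by
    rw [← vanishingIdeal_zeroLocus_eq_radical (K := ℂ), Ideal.span_le]
    rintro _ ⟨i, rfl⟩ x hx
    have : x = 0 := h hx
    simp [this]
  obtain ⟨N, hN⟩ := Ideal.exists_pow_le_of_le_radical_of_fg hX
    (IsNoetherian.noetherian _)
  refine ⟨N, fun n hn r hr => hN (Ideal.pow_le_pow_right hn ?_)⟩
  rw [Ideal.mem_span_pow_iff_exists_isHomogeneous]
  refine ⟨map C r, hr.map _, ?_⟩
  rw [eval_map]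
  exact eval₂_eta r

/-- Two plane curves of the same degree at least two have too large an intersection for the
ideal of a line to be contained in theirs in all large degrees. -/
lemma not_forall_X_mul_mem_span_pair {a b : MvPolynomial (Fin 3) ℂ} {d : ℕ} (hd : d ≠ 0)
    (ha : a.IsHomogeneous (d + 1)) (hb : b.IsHomogeneous (d + 1)) {i : Fin 3} (hi : ¬ X i ∣ a)
    (N : ℕ) :
    ¬ ∀ n ≥ N, ∀ r : MvPolynomial (Fin 3) ℂ, r.IsHomogeneous n →
      X i * r ∈ Ideal.span {a, b} := by
  intro h
  have ha0 : a ≠ 0 := fun h0 => hi (h0 ▸ dvd_zero _)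
  have hX : (X i : MvPolynomial (Fin 3) ℂ).IsHomogeneous 1 := isHomogeneous_X ℂ i
  have hnb := hb.neg
  have hnX := hX.neg
  let f : ternaryForms (N + 2 * d + 1) × ternaryForms (N + d + 1) →ₗ[ℂ]
      ternaryForms (N + 2 * d + 2) :=
    (mulForm hX (by omega)).coprod (mulForm ha (by omega))
  let g : ternaryForms (N + d + 1) × ternaryForms (N + d + 1) →ₗ[ℂ]
      ternaryForms (N + 2 * d + 2) :=
    (mulForm ha (by omega)).coprod (mulForm hb (by omega))
  let k : ternaryForms (N + d) →ₗ[ℂ]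
      ternaryForms (N + 2 * d + 1) × ternaryForms (N + d + 1) :=
    (mulForm ha (by omega)).prod (mulForm hnX (by omega))
  let l : ternaryForms N →ₗ[ℂ] ternaryForms (N + d + 1) × ternaryForms (N + d + 1) :=
    (mulForm hnb (by omega)).prod (mulForm ha (by omega))
  have hfg : LinearMap.range f ≤ LinearMap.range g := by
    rintro _ ⟨⟨r, s⟩, rfl⟩
    obtain ⟨u, v, hu, hv, huv⟩ := exists_isHomogeneous_of_mem_span_pair (p := N + d + 1) ha hb
      (f := X i * (r : MvPolynomial (Fin 3) ℂ)) (by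
        rw [show d + 1 + (N + d + 1) = 1 + (N + 2 * d + 1) by omega]
        exact hX.mul r.2) (h _ (by omega) _ r.2)
    refine ⟨(⟨u, hu⟩ + s, ⟨v, hv⟩), Subtype.ext ?_⟩
    simp only [f, g, LinearMap.coprod_apply, Submodule.coe_add, coe_mulForm, ← huv]
    ring
  have hfk : LinearMap.ker f ≤ LinearMap.range k := by
    rintro ⟨⟨r, hr⟩, ⟨s, hs⟩⟩ hrs
    have hrs : X i * r + a * s = 0 := congrArg Subtype.val hrs
    have hXs : X i ∣ a * s := ⟨-r, by linear_combination hrs⟩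
    obtain ⟨t, rfl⟩ := ((X_prime (R := ℂ) (i := i)).dvd_or_dvd hXs).resolve_left hi
    have hX0 : (X i : MvPolynomial (Fin 3) ℂ) ≠ 0 := X_ne_zero i
    obtain rfl : r = -(a * t) := mul_left_cancel₀ hX0 (by linear_combination hrs)
    have ht : t.IsHomogeneous (N + d) := by
      have := homogeneousComponent_mul_of_isHomogeneous_s1 hX t (N + d)
      rw [homogeneousComponent_eq_self (by rwa [add_comm 1])] at this
      rw [mul_left_cancel₀ hX0 this]
      exact homogeneousComponent_isHomogeneous _ _
    refine ⟨-⟨t, ht⟩, Prod.ext (Subtype.ext ?_) (Subtype.ext ?_)⟩ <;> simp [k]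
  have hlg : LinearMap.range l ≤ LinearMap.ker g := by
    rintro _ ⟨t, rfl⟩
    refine Subtype.ext ?_
    simp only [g, l, LinearMap.coprod_apply, LinearMap.prod_apply, Function.prod, Submodule.coe_add,
      coe_mulForm, Submodule.coe_zero]
    ring
  have hl : Function.Injective l := fun s t hst => Subtype.ext <|
    mul_left_cancel₀ ha0 (congrArg (fun p => (p.2 : MvPolynomial (Fin 3) ℂ)) hst)
  have h1 := Submodule.finrank_mono hfg
  have h2 := (Submodule.finrank_mono hfk).trans (LinearMap.finrank_range_le k)
  have h3 := Submodule.finrank_mono hlg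
  rw [LinearMap.finrank_range_of_inj hl] at h3
  have h4 := f.finrank_range_add_finrank_ker
  have h5 := g.finrank_range_add_finrank_ker
  simp only [Module.finrank_prod, finrank_homogeneousSubmodule_fin_three] at h2 h3 h4 h5
  have key : (N + 2 * d + 1 + 2).choose 2 + (N + 2).choose 2 ≤
      (N + d + 1 + 2).choose 2 + (N + d + 2).choose 2 := by omega
  have hc (n : ℕ) : ((n + 2).choose 2 : ℚ) = (n + 2) * (n + 1) / 2 := by
    rw [Nat.cast_choose_two]; push_cast; ring
  have hkey := (Nat.cast_le (α := ℚ)).2 key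
  push_cast [hc] at hkey
  have hd' : (1 : ℚ) ≤ d := by exact_mod_cast Nat.one_le_iff_ne_zero.2 hd
  nlinarith

end MvPolynomial

/-- A foliation of degree zero is given by a constant vector field, which is radial at the
corresponding point. -/
lemma ProjFoliation.singCone_nonempty_of_degree_zero (F : ProjFoliation 2 0) :
    F.singCone.Nonempty := by
  have hlin (i : Fin 3) : ∃ c : Fin 3 → ℂ, ∑ j, c j • X j = F.a i := by
    have h : F.a i ∈ homogeneousSubmodule (Fin 3) ℂ 1 := F.homog i
    rwa [homogeneousSubmodule_one_eq_span_X, Submodule.mem_span_range_iff_exists_fun] at h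
  choose M hM using hlin
  have heval (i : Fin 3) (z : Fin 3 → ℂ) :
      eval z (F.a i) = M i 0 * z 0 + M i 1 * z 1 + M i 2 * z 2 := by
    simp [← hM, Fin.sum_univ_three, smul_eval]
  have heuler (z : Fin 3 → ℂ) :
      z 0 * (M 0 0 * z 0 + M 0 1 * z 1 + M 0 2 * z 2) +
      z 1 * (M 1 0 * z 0 + M 1 1 * z 1 + M 1 2 * z 2) +
      z 2 * (M 2 0 * z 0 + M 2 1 * z 1 + M 2 2 * z 2) = 0 := by
    have h := congrArg (eval z) F.euler
    simpa only [Nat.reduceAdd, Fin.sum_univ_three, map_add, map_mul, eval_X, heval, map_zero]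
      using h
  have h00 : M 0 0 = 0 := by simpa using heuler ![1, 0, 0]
  have h11 : M 1 1 = 0 := by simpa using heuler ![0, 1, 0]
  have h22 : M 2 2 = 0 := by simpa using heuler ![0, 0, 1]
  have h01 : M 0 1 + M 1 0 = 0 := by simpa [h00, h11, h22] using heuler ![1, 1, 0]
  have h02 : M 0 2 + M 2 0 = 0 := by simpa [h00, h11, h22] using heuler ![1, 0, 1]
  have h12 : M 1 2 + M 2 1 = 0 := by simpa [h00, h11, h22] using heuler ![0, 1, 1]
  have h10 := eq_neg_of_add_eq_zero_right h01
  have h20 := eq_neg_of_add_eq_zero_right h02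
  have h21 := eq_neg_of_add_eq_zero_right h12
  refine ⟨![M 1 2, - M 0 2, M 0 1], fun h0 => ?_, fun i => ?_⟩
  · have e0 : M 1 2 = 0 := by simpa using congrFun h0 0
    have e1 : M 0 2 = 0 := by simpa using congrFun h0 1
    have e2 : M 0 1 = 0 := by simpa using congrFun h0 2
    obtain ⟨i, hi⟩ := F.nonzero
    apply hi
    rw [← hM, Fin.sum_univ_three]
    fin_cases i <;> simp [*]
  · rw [heval]
    fin_cases i <;> simp [h00, h11, h22, h10, h20, h21] <;> ring

/-- Every singular holomorphic foliation of codimension one on `ℂℙ²` has nonempty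
singular locus; equivalently, there is no nonsingular holomorphic foliation on `ℂℙ²`. -/
theorem no_nonsingular_holomorphic_foliation_on_CP2 (d : ℕ) (F : ProjFoliation 2 d) :
    F.singCone.Nonempty := by
  rcases eq_or_ne d 0 with rfl | hd
  · exact F.singCone_nonempty_of_degree_zero
  by_contra hempty
  have hsing (z : Fin 3 → ℂ) (h0 : eval z (F.a 0) = 0) (h1 : eval z (F.a 1) = 0)
      (h2 : eval z (F.a 2) = 0) : z = 0 := by
    by_contra hz
    exact hempty ⟨z, hz, fun i => by fin_cases i <;> assumption⟩
  have heuler : X 0 * F.a 0 + X 1 * F.a 1 + X 2 * F.a 2 = 0 := by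
    rw [← F.euler, Fin.sum_univ_three]
  obtain ⟨N, hN⟩ := exists_forall_isHomogeneous_mem (I := Ideal.span {F.a 0, F.a 1, F.a 2})
    fun z hz => hsing z (hz _ (Ideal.subset_span (by simp)))
      (hz _ (Ideal.subset_span (by simp))) (hz _ (Ideal.subset_span (by simp)))
  have hmem (n : ℕ) (hn : n ≥ N) (r : MvPolynomial (Fin 3) ℂ) (hr : r.IsHomogeneous n) :
      ∃ u v w, u * F.a 0 + v * F.a 1 + w * F.a 2 = r := by
    obtain ⟨u, v, w, h⟩ := Submodule.mem_span_triple.1 (hN n hn r hr)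
    exact ⟨u, v, w, h⟩
  have hX2 : X 2 ∣ F.a 0 := by
    by_contra h
    refine not_forall_X_mul_mem_span_pair hd (F.homog 0) (F.homog 1) h N fun n hn r hr => ?_
    obtain ⟨u, v, w, rfl⟩ := hmem n hn r hr
    exact Ideal.mem_span_pair.2 ⟨X 2 * u - w * X 0, X 2 * v - w * X 1, by
      linear_combination -w * heuler⟩
  have hX2' : X 2 ∣ F.a 1 := by
    by_contra h
    refine not_forall_X_mul_mem_span_pair hd (F.homog 1) (F.homog 0) h N fun n hn r hr => ?_
    obtain ⟨u, v, w, rfl⟩ := hmem n hn r hr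
    exact Ideal.mem_span_pair.2 ⟨X 2 * v - w * X 1, X 2 * u - w * X 0, by
      linear_combination -w * heuler⟩
  have hX1 : X 1 ∣ F.a 2 := by
    by_contra h
    refine not_forall_X_mul_mem_span_pair hd (F.homog 2) (F.homog 0) h N fun n hn r hr => ?_
    obtain ⟨u, v, w, rfl⟩ := hmem n hn r hr
    exact Ideal.mem_span_pair.2 ⟨X 1 * w - v * X 2, X 1 * u - v * X 0, by
      linear_combination -v * heuler⟩
  obtain ⟨p, hp⟩ := hX2
  obtain ⟨q, hq⟩ := hX2'
  obtain ⟨r, hr⟩ := hX1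
  have := hsing ![1, 0, 0] (by simp [hp]) (by simp [hq]) (by simp [hr])
  simpa using congrFun this 0
end

section
/- For any singular holomorphic foliation F of codimension one on the complex projective space CP^n with n > 1, the singular locus Sing F contains an irreducible component of complex codimension 2. -/
/- STATEMENT 3: For any singular holomorphic foliation F of codimension one on CPⁿ (n > 1),
the singular locus Sing F contains an irreducible component of complex codimension 2.

Irreducible components of the singular locus (an algebraic cone in ℂ^{n+1}) correspond to
the minimal primes over the ideal generated by the coefficients a₀, …, aₙ of the defining
homogeneous 1-form.  A component of codimension 2 in ℂℙⁿ is a component whose affine cone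
has complex dimension n - 1, i.e. whose corresponding minimal prime P satisfies
`ringKrullDim (ℂ[z₀,…,zₙ] ⧸ P) = n - 1`. -/

open MvPolynomial

section MonicInOneVariable

/-- The substitution fixing `X 0` and sending `X i` to `X i + c • X 0 ^ N ^ i` for `i ≠ 0`. -/
noncomputable def powerShear {k : Type*} [Field k] {n : ℕ} (N : ℕ) (c : k) :
    MvPolynomial (Fin (n + 1)) k →ₐ[k] MvPolynomial (Fin (n + 1)) k :=
  aeval fun i ↦ if i = 0 then MvPolynomial.X 0
    else MvPolynomial.X i + c • MvPolynomial.X 0 ^ N ^ (i : ℕ)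

lemma powerShear_comp_neg {k : Type*} [Field k] {n : ℕ} (N : ℕ) (c : k) :
    (powerShear (n := n) N c).comp (powerShear N (-c)) = AlgHom.id _ _ := by
  rw [powerShear, powerShear, comp_aeval, ← MvPolynomial.aeval_X_left]
  ext i v
  cases i using Fin.cases <;> simp

/-- The automorphism underlying `powerShear N 1`. -/
noncomputable def powerShearEquiv (k : Type*) [Field k] (n N : ℕ) :
    MvPolynomial (Fin (n + 1)) k ≃ₐ[k] MvPolynomial (Fin (n + 1)) k :=
  AlgEquiv.ofAlgHom (powerShear N 1) (powerShear N (-1)) (powerShear_comp_neg N 1)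
    (by simpa using powerShear_comp_neg N (-1 : k))

/-- The image of the monomial with exponent `v` under `powerShear N 1`, as a polynomial
in `X 0`. -/
noncomputable def shearProduct (k : Type*) [Field k] {n : ℕ} (N : ℕ) (v : Fin (n + 1) →₀ ℕ) :
    Polynomial (MvPolynomial (Fin n) k) :=
  Polynomial.X ^ v 0 * ∏ i : Fin n, (Polynomial.X ^ N ^ (i.succ : ℕ) +
    Polynomial.C (X i)) ^ v i.succ

lemma finSuccEquiv_powerShearEquiv_monomial {k : Type*} [Field k] {n : ℕ} (N : ℕ)
    (v : Fin (n + 1) →₀ ℕ) (a : k) :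
    finSuccEquiv k n (powerShearEquiv k n N (monomial v a)) =
      Polynomial.C (C a) * shearProduct k N v := by
  rw [monomial_eq, Finsupp.prod_pow]
  simp [powerShearEquiv, powerShear, shearProduct, Fin.prod_univ_succ, add_comm,
    finSuccEquiv_apply]

lemma monic_shearProduct {k : Type*} [Field k] {n : ℕ} {N : ℕ} (hN : 0 < N)
    (v : Fin (n + 1) →₀ ℕ) :
    (shearProduct k N v).Monic := by
  refine (Polynomial.monic_X_pow _).mul (Polynomial.monic_prod_of_monic _ _ fun i _ ↦ ?_)
  exact (Polynomial.monic_X_pow_add_C _ (pow_pos hN _).ne').pow _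

lemma natDegree_shearProduct {k : Type*} [Field k] {n : ℕ} {N : ℕ} (hN : 0 < N)
    (v : Fin (n + 1) →₀ ℕ) :
    (shearProduct k N v).natDegree =
      ∑ i, v i * N ^ (i : ℕ) := by
  have hm (i : Fin n) : (Polynomial.X ^ N ^ (i.succ : ℕ) +
      Polynomial.C (X i : MvPolynomial (Fin n) k)).Monic :=
    Polynomial.monic_X_pow_add_C _ (pow_pos hN _).ne'
  rw [shearProduct, (Polynomial.monic_X_pow _).natDegree_mul
    (Polynomial.monic_prod_of_monic _ _ fun i _ ↦ (hm i).pow _),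
    Polynomial.natDegree_prod_of_monic _ _ fun i _ ↦ (hm i).pow _, Fin.sum_univ_succ]
  simp only [(hm _).natDegree_pow, Polynomial.natDegree_X_pow_add_C, Polynomial.natDegree_X_pow]
  simp

lemma sum_mul_pow_injective {n N : ℕ} {v w : Fin n →₀ ℕ} (hv : ∀ i, v i < N)
    (hw : ∀ i, w i < N) (h : ∑ i, v i * N ^ (i : ℕ) = ∑ i, w i * N ^ (i : ℕ)) : v = w := by
  rcases n with _ | n
  · exact Subsingleton.elim _ _
  · have : (fun i ↦ (⟨v i, hv i⟩ : Fin N)) = fun i ↦ ⟨w i, hw i⟩ :=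
      finFunctionFinEquiv.injective (Fin.ext (by simpa [finFunctionFinEquiv] using h))
    ext i
    simpa using congrFun this i

lemma degree_C_mul_le {A : Type*} [CommRing A] (c : A) (p : Polynomial A) :
    (Polynomial.C c * p).degree ≤ p.degree :=
  (Polynomial.degree_mul_le _ _).trans (add_le_of_nonpos_left Polynomial.degree_C_le)

/-- A linear combination, with unit coefficients, of monic polynomials of distinct degrees is
associated to a monic polynomial. -/
lemma exists_monic_associated_sum {A ι : Type*} [CommRing A] [Nontrivial A] {s : Finset ι}
    (hs : s.Nonempty) {c : ι → A} (hc : ∀ i ∈ s, IsUnit (c i)) {m : ι → Polynomial A}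
    (hm : ∀ i, (m i).Monic) (hinj : ∀ i ∈ s, ∀ j ∈ s, (m i).natDegree = (m j).natDegree → i = j) :
    ∃ q : Polynomial A, q.Monic ∧ Associated q (∑ i ∈ s, Polynomial.C (c i) * m i) := by
  classical
  obtain ⟨v, hv, hmax⟩ := Finset.exists_max_image s (fun i ↦ (m i).natDegree) hs
  obtain ⟨d, hd⟩ := (hc v hv).exists_left_inv
  have hdeg : (∑ w ∈ s.erase v, Polynomial.C (c w) * m w).degree < (m v).degree := by
    refine lt_of_le_of_lt (Polynomial.degree_sum_le _ _)
      ((Finset.sup_lt_iff (Ne.bot_lt ?_)).mpr fun w hw ↦ ?_)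
    · exact fun h ↦ (hm v).ne_zero (Polynomial.degree_eq_bot.mp h)
    · obtain ⟨hne, hw⟩ := Finset.mem_erase.mp hw
      exact lt_of_le_of_lt (degree_C_mul_le _ _)
        (Polynomial.degree_lt_degree (lt_of_le_of_ne (hmax w hw) fun h ↦ hne (hinj w hw v hv h)))
  have hinv : Polynomial.C d * Polynomial.C (c v) = 1 := by rw [← map_mul, hd, map_one]
  refine ⟨Polynomial.C d * ∑ i ∈ s, Polynomial.C (c i) * m i, ?_,
    (associated_isUnit_mul_left_iff (IsUnit.of_mul_eq_one _ hinv)).mpr (.refl _)⟩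
  rw [← Finset.add_sum_erase _ _ hv, mul_add, ← mul_assoc, hinv, one_mul]
  exact (hm v).add_of_left (lt_of_le_of_lt (degree_C_mul_le _ _) hdeg)

/-- After a change of variables, a nonzero polynomial over a field is, up to a unit, monic in
one of the variables. -/
lemma exists_algEquiv_associated_monic {k : Type*} [Field k] {n : ℕ}
    {f : MvPolynomial (Fin (n + 1)) k} (hf : f ≠ 0) :
    ∃ e : MvPolynomial (Fin (n + 1)) k ≃ₐ[k] Polynomial (MvPolynomial (Fin n) k),
      ∃ q : Polynomial (MvPolynomial (Fin n) k), q.Monic ∧ Associated q (e f) := by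
  obtain ⟨N, hN, hlt⟩ : ∃ N, 0 < N ∧ ∀ v ∈ f.support, ∀ i, v i < N :=
    ⟨f.totalDegree + 1, f.totalDegree.succ_pos, fun v hv i ↦
      Nat.lt_succ_of_le ((monomial_le_degreeOf i hv).trans (degreeOf_le_totalDegree f i))⟩
  refine ⟨(powerShearEquiv k n N).trans (finSuccEquiv k n), ?_⟩
  have hef : (powerShearEquiv k n N).trans (finSuccEquiv k n) f =
      ∑ v ∈ f.support, Polynomial.C (C (coeff v f)) * shearProduct k N v := by
    conv_lhs => rw [← f.support_sum_monomial_coeff, map_sum]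
    simp only [AlgEquiv.trans_apply, finSuccEquiv_powerShearEquiv_monomial]
  rw [hef]
  refine exists_monic_associated_sum (support_nonempty.mpr hf)
    (fun v hv ↦ (mem_support_iff.mp hv).isUnit.map C) (monic_shearProduct hN)
    fun v hv w hw h ↦ sum_mul_pow_injective (hlt v hv) (hlt w hw) ?_
  rwa [natDegree_shearProduct hN, natDegree_shearProduct hN] at h

end MonicInOneVariable

section DimensionFormula

lemma coheight_comap_le_of_hasGoingUp {R S : Type*} [CommRing R] [CommRing S] [Algebra R S]
    [Algebra.HasGoingUp R S] (p : PrimeSpectrum S) :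
    Order.coheight (PrimeSpectrum.comap (algebraMap R S) p) ≤ Order.coheight p := by
  refine Order.coheight_le fun l hl ↦ ?_
  have : p.asIdeal.LiesOver l.head.asIdeal := ⟨by rw [hl]; rfl⟩
  obtain ⟨L, hlen, hhead, -⟩ := Ideal.exists_ltSeries_of_hasGoingUp l p.asIdeal
  rw [← hlen]
  exact Order.length_le_coheight hhead.ge

/-- A prime of `A[X]` containing a monic polynomial is integral over its contraction. -/
lemma isIntegral_quotient_of_monic_mem {A : Type*} [CommRing A] {q : Polynomial A} (hq : q.Monic)
    {I : Ideal (Polynomial A)} (h : q ∈ I) : Algebra.IsIntegral A (Polynomial A ⧸ I) :=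
  ⟨hq.quotient_isIntegral h⟩

lemma coheight_comap_C_le_of_monic_mem {A : Type*} [CommRing A] {q : Polynomial A} (hq : q.Monic)
    (p : PrimeSpectrum (Polynomial A)) (h : q ∈ p.asIdeal) :
    Order.coheight (PrimeSpectrum.comap Polynomial.C p) ≤ Order.coheight p := by
  have := isIntegral_quotient_of_monic_mem hq h
  let z : PrimeSpectrum (Polynomial A ⧸ p.asIdeal) := ⟨⊥, Ideal.isPrime_bot⟩
  have hz : PrimeSpectrum.comap (Ideal.Quotient.mk p.asIdeal) z = p :=
    PrimeSpectrum.ext (Ideal.mk_ker (I := p.asIdeal))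
  have hmono : StrictMono (PrimeSpectrum.comap (Ideal.Quotient.mk p.asIdeal)) :=
    Monotone.strictMono_of_injective (fun _ _ h ↦ Ideal.comap_mono h)
      (PrimeSpectrum.comap_injective_of_surjective _ Ideal.Quotient.mk_surjective)
  have h1 := coheight_comap_le_of_hasGoingUp (R := A) z
  have h2 := Order.coheight_le_coheight_apply_of_strictMono _ hmono z
  rw [hz] at h2
  refine le_trans (le_of_eq (congrArg Order.coheight ?_)) (h1.trans h2)
  conv_lhs => rw [← hz]
  rfl

lemma height_comap_C_add_one_le_of_monic_mem {A : Type*} [CommRing A] [IsNoetherianRing A]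
    {q : Polynomial A} (hq : q.Monic) (P : Ideal (Polynomial A)) [hP : P.IsPrime] (h : q ∈ P) :
    (P.comap Polynomial.C).height + 1 ≤ P.height := by
  have hle : (P.comap Polynomial.C).map Polynomial.C ≤ P := Ideal.map_comap_le
  have hne : (P.comap Polynomial.C).map Polynomial.C ≠ P := by
    intro hEq
    have hmem := (Ideal.mem_map_C_iff.mp (hEq ▸ h)) q.natDegree
    rw [hq.coeff_natDegree] at hmem
    exact (hP.comap Polynomial.C).ne_top ((Ideal.eq_top_iff_one _).mpr hmem)
  refine le_trans ?_ (Ideal.height_add_one_le_of_lt_of_isPrime (lt_of_le_of_ne hle hne))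
  gcongr
  have : ((P.comap Polynomial.C).map Polynomial.C).LiesOver (P.comap Polynomial.C) := ⟨by
    refine le_antisymm Ideal.le_comap_map (fun x hx ↦ ?_)
    simpa using Ideal.mem_map_C_iff.mp hx 0⟩
  rw [Ideal.height_eq_height_add_of_liesOver_of_hasGoingDown (P.comap Polynomial.C)
    ((P.comap Polynomial.C).map Polynomial.C)]
  exact le_self_add

lemma ringKrullDim_mvPolynomial_fin (k : Type*) [Field k] (n : ℕ) :
    ringKrullDim (MvPolynomial (Fin n) k) = n := by
  simp [MvPolynomial.ringKrullDim_of_isNoetherianRing]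

lemma le_height_add_coheight (k : Type*) [Field k] (n : ℕ)
    (p : PrimeSpectrum (MvPolynomial (Fin n) k)) :
    (n : ℕ∞) ≤ Order.height p + Order.coheight p := by
  induction n with
  | zero => simp
  | succ n ih =>
    by_cases hp : p.asIdeal = ⊥
    · have : p = ⊥ := PrimeSpectrum.ext hp
      have h := Order.coheight_bot_eq_krullDim (α := PrimeSpectrum (MvPolynomial (Fin (n + 1)) k))
      have h' := ringKrullDim_mvPolynomial_fin k (n + 1)
      rw [ringKrullDim, ← h] at h'
      have h'' : Order.coheight (⊥ : PrimeSpectrum (MvPolynomial (Fin (n + 1)) k)) =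
        ((n + 1 : ℕ) : ℕ∞) := by exact_mod_cast h'
      rw [this, h'']
      exact le_add_self
    · obtain ⟨f, hfp, hf⟩ := Submodule.exists_mem_ne_zero_of_ne_bot hp
      obtain ⟨e, q, hq, hqe⟩ := exists_algEquiv_associated_monic hf
      let E := PrimeSpectrum.comapEquiv e.toRingEquiv
      let P := E p
      have hqP : q ∈ P.asIdeal := by
        refine P.asIdeal.mem_of_dvd hqe.dvd' ?_
        change e.symm (e f) ∈ p.asIdeal
        simpa using hfp
      have h1 := height_comap_C_add_one_le_of_monic_mem hq P.asIdeal hqP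
      have h2 := coheight_comap_C_le_of_monic_mem hq P hqP
      have h3 := ih (PrimeSpectrum.comap Polynomial.C P)
      rw [← Order.height_orderIso E, ← Order.coheight_orderIso E]
      change (PrimeSpectrum.comap Polynomial.C P).asIdeal.height + 1 ≤ _ at h1
      rw [PrimeSpectrum.height_eq_orderHeight, PrimeSpectrum.height_eq_orderHeight] at h1
      calc ((n + 1 : ℕ) : ℕ∞) ≤ Order.height (PrimeSpectrum.comap Polynomial.C P) + 
            Order.coheight (PrimeSpectrum.comap Polynomial.C P) + 1 := by push_cast; gcongr
        _ = (Order.height (PrimeSpectrum.comap Polynomial.C P) + 1) + 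
            Order.coheight (PrimeSpectrum.comap Polynomial.C P) := by ring
        _ ≤ _ := add_le_add h1 h2

lemma height_add_coheight_eq (k : Type*) [Field k] (n : ℕ)
    (p : PrimeSpectrum (MvPolynomial (Fin n) k)) :
    Order.height p + Order.coheight p = n := by
  refine le_antisymm ?_ (le_height_add_coheight k n p)
  have h := ringKrullDim_mvPolynomial_fin k n
  rw [ringKrullDim, Order.krullDim_eq_iSup_height_add_coheight_of_nonempty] at h
  have h' : (⨆ p : PrimeSpectrum (MvPolynomial (Fin n) k), Order.height p + Order.coheight p) =
    (n : ℕ∞) := by exact_mod_cast h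
  exact h' ▸ le_iSup (fun p ↦ Order.height p + Order.coheight p) p

lemma ringKrullDim_quotient_eq_coheight {R : Type*} [CommRing R] (p : PrimeSpectrum R) :
    ringKrullDim (R ⧸ p.asIdeal) = Order.coheight p := by
  rw [ringKrullDim_quotient, Order.coheight_eq_krullDim_Ici]
  rfl

end DimensionFormula

section RegularSequence

/-- In a Noetherian UFD, an ideal contained in no prime of height at most one contains two
relatively prime elements. -/
lemma exists_isRelPrime_of_two_le_height {A : Type*} [CommRing A] [IsDomain A]
    [IsNoetherianRing A] [UniqueFactorizationMonoid A] {K : Ideal A}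
    (hK : ∀ P : Ideal A, P.IsPrime → K ≤ P → 2 ≤ P.height) :
    ∃ g ∈ K, ∃ h ∈ K, g ≠ 0 ∧ IsRelPrime g h := by
  classical
  obtain ⟨g, hgK, hg⟩ : ∃ g ∈ K, g ≠ 0 := by
    refine Submodule.exists_mem_ne_zero_of_ne_bot fun h ↦ ?_
    have := hK ⊥ Ideal.isPrime_bot h.le
    simp at this
  let s := (UniqueFactorizationMonoid.factors g).toFinset
  have hs {p : A} (hp : p ∈ s) : Prime p :=
    UniqueFactorizationMonoid.prime_of_factor p (Multiset.mem_toFinset.mp hp)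
  have hprime {p : A} (hp : Prime p) : (Ideal.span {p}).IsPrime :=
    (Ideal.span_singleton_prime hp.ne_zero).mpr hp
  obtain ⟨h, hhK, hh⟩ : ∃ h ∈ K, ∀ p ∈ s, ¬ p ∣ h := by
    by_contra! H
    obtain ⟨p, hp, hle⟩ := (Ideal.subset_union_prime (s := s) (f := fun p ↦ Ideal.span {p}) 0 0
      fun p hp _ _ ↦ hprime (hs hp)).mp fun x hx ↦ by
        simpa [Ideal.mem_span_singleton] using H x hx
    have := hprime (hs hp)
    have h2 := hK _ this hle
    have h1 := Ideal.height_le_one_of_isPrincipal_of_mem_minimalPrimes (Ideal.span {p})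
      (Ideal.span {p}) (by rw [Ideal.minimalPrimes_eq_subsingleton_self]; rfl)
    exact absurd (h2.trans h1) (by decide)
  refine ⟨g, hgK, h, hhK, hg, UniqueFactorizationMonoid.isRelPrime_iff_no_prime_factors hg |>.mpr
    fun d hdg hdh hd ↦ ?_⟩
  obtain ⟨p, hp, hdp⟩ :=
    UniqueFactorizationMonoid.exists_mem_factors_of_dvd hg hd.irreducible hdg
  exact hh p (Multiset.mem_toFinset.mpr hp) (hdp.dvd'.trans hdh)

lemma C_mul_modByMonic {A : Type*} [CommRing A] (q u : Polynomial A) (c : A) :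
    (Polynomial.C c * u) %ₘ q = Polynomial.C c * (u %ₘ q) := by
  rw [← Polynomial.smul_eq_C_mul, Polynomial.smul_modByMonic, Polynomial.smul_eq_C_mul]

lemma dvd_of_monic_dvd_C_mul {A : Type*} [CommRing A] [IsDomain A] {q u : Polynomial A}
    (hq : q.Monic) {g : A} (hg : g ≠ 0) (h : q ∣ Polynomial.C g * u) : q ∣ u := by
  rw [← Polynomial.modByMonic_eq_zero_iff_dvd hq, C_mul_modByMonic] at h
  rw [← Polynomial.modByMonic_eq_zero_iff_dvd hq]
  exact (mul_eq_zero.mp h).resolve_left (Polynomial.C_ne_zero.mpr hg)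

lemma mem_span_pair_of_C_mul_mem {A : Type*} [CommRing A] [DecompositionMonoid A]
    {q u : Polynomial A} (hq : q.Monic) {g h : A} (hgh : IsRelPrime g h)
    (H : Polynomial.C h * u ∈ Ideal.span {q, Polynomial.C g}) :
    u ∈ Ideal.span {q, Polynomial.C g} := by
  obtain ⟨x, y, hxy⟩ := Ideal.mem_span_pair.mp H
  have hmod : Polynomial.C h * (u %ₘ q) = Polynomial.C g * (y %ₘ q) := by
    rw [← C_mul_modByMonic, ← C_mul_modByMonic, ← hxy, Polynomial.add_modByMonic,
      (Polynomial.modByMonic_eq_zero_iff_dvd hq).mpr (dvd_mul_left q x), zero_add, mul_comm]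
  have hdvd : Polynomial.C g ∣ u %ₘ q := Polynomial.C_dvd_iff_dvd_coeff _ _ |>.mpr fun i ↦
    hgh.dvd_of_dvd_mul_left ⟨(y %ₘ q).coeff i, by
      simpa using congrArg (Polynomial.coeff · i) hmod⟩
  obtain ⟨z, hz⟩ := hdvd
  refine Ideal.mem_span_pair.mpr ⟨u /ₘ q, z, ?_⟩
  linear_combination Polynomial.modByMonic_add_div u q - hz

lemma two_le_height_of_comap_C_le {k : Type*} [Field k] {n : ℕ}
    {q : Polynomial (MvPolynomial (Fin n) k)} (hq : q.Monic)
    {I : Ideal (Polynomial (MvPolynomial (Fin n) k))} (hqI : q ∈ I)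
    (hI : ∀ P : Ideal (Polynomial (MvPolynomial (Fin n) k)), P.IsPrime → I ≤ P → 3 ≤ P.height)
    (Q : Ideal (MvPolynomial (Fin n) k)) (hQ : Q.IsPrime) (hIQ : I.comap Polynomial.C ≤ Q) :
    2 ≤ Q.height := by
  have := isIntegral_quotient_of_monic_mem hq hqI
  obtain ⟨P', -, hP', hP'Q⟩ := Ideal.exists_ideal_over_prime_of_isIntegral
    (S := Polynomial (MvPolynomial (Fin n) k) ⧸ I) Q ⊥ fun x hx ↦
      hIQ (Ideal.mem_comap.mpr (Ideal.Quotient.eq_zero_iff_mem.mp (Ideal.mem_bot.mp hx)))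
  let P : PrimeSpectrum (Polynomial (MvPolynomial (Fin n) k)) :=
    PrimeSpectrum.comap (Ideal.Quotient.mk I) ⟨P', hP'⟩
  have hIP : I ≤ P.asIdeal := fun x hx ↦ by
    change Ideal.Quotient.mk I x ∈ P'
    rw [Ideal.Quotient.eq_zero_iff_mem.mpr hx]
    exact P'.zero_mem
  have hPQ : PrimeSpectrum.comap Polynomial.C P = ⟨Q, hQ⟩ := PrimeSpectrum.ext hP'Q
  have h3 := hI _ P.isPrime hIP
  have hle := coheight_comap_C_le_of_monic_mem hq P (hIP hqI)
  rw [hPQ] at hle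
  let E := PrimeSpectrum.comapEquiv (finSuccEquiv k n).symm.toRingEquiv
  have hP := height_add_coheight_eq k (n + 1) (E P)
  rw [Order.height_orderIso, Order.coheight_orderIso] at hP
  have hQ' := height_add_coheight_eq k n ⟨Q, hQ⟩
  rw [← PrimeSpectrum.height_eq_orderHeight] at hP hQ'
  change Q.height + _ = _ at hQ'
  generalize P.asIdeal.height = a at *
  generalize Order.coheight P = b at *
  generalize Q.height = c at *
  generalize Order.coheight (⟨Q, hQ⟩ : PrimeSpectrum (MvPolynomial (Fin n) k)) = d at *
  obtain ⟨ha, hb⟩ := WithTop.add_ne_top.mp (hP.trans_ne (ENat.natCast_ne_top _))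
  obtain ⟨hc, hd⟩ := WithTop.add_ne_top.mp (hQ'.trans_ne (ENat.natCast_ne_top _))
  lift a to ℕ using ha
  lift b to ℕ using hb
  lift c to ℕ using hc
  lift d to ℕ using hd
  norm_cast at *
  omega

/-- An ideal of a polynomial ring over a field all of whose primes have height at least three
contains a regular sequence of length three. -/
lemma exists_regular_sequence_of_three_le_height {k : Type*} [Field k] {n : ℕ}
    {I : Ideal (MvPolynomial (Fin (n + 1)) k)}
    (hI : ∀ P : Ideal (MvPolynomial (Fin (n + 1)) k), P.IsPrime → I ≤ P → 3 ≤ P.height) :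
    ∃ f ∈ I, ∃ g ∈ I, ∃ h ∈ I, f ≠ 0 ∧ (∀ u, f ∣ g * u → f ∣ u) ∧
      ∀ u, h * u ∈ Ideal.span {f, g} → u ∈ Ideal.span {f, g} := by
  obtain ⟨f, hfI, hf⟩ : ∃ f ∈ I, f ≠ 0 := by
    refine Submodule.exists_mem_ne_zero_of_ne_bot fun h ↦ ?_
    have := hI ⊥ Ideal.isPrime_bot h.le
    simp at this
  obtain ⟨e, q, hq, hqe⟩ := exists_algEquiv_associated_monic hf
  let J := I.comap e.symm.toRingEquiv.toRingHom
  have hqJ : q ∈ J := J.mem_of_dvd hqe.dvd' (by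
    change e.symm (e f) ∈ I
    simpa using hfI)
  have hJ (P : Ideal (Polynomial (MvPolynomial (Fin n) k))) (hP : P.IsPrime) (hJP : J ≤ P) :
      3 ≤ P.height := by
    let E := PrimeSpectrum.comapEquiv e.symm.toRingEquiv
    have h := hI (E ⟨P, hP⟩).asIdeal (E ⟨P, hP⟩).isPrime fun x hx ↦ hJP (by
      change e.symm (e x) ∈ I
      simpa using hx)
    rw [PrimeSpectrum.height_eq_orderHeight, Order.height_orderIso,
      ← PrimeSpectrum.height_eq_orderHeight] at h
    exact h
  obtain ⟨g, hg, h, hh, hg0, hgh⟩ :=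
    exists_isRelPrime_of_two_le_height (two_le_height_of_comap_C_le hq hqJ hJ)
  have hspan (u) : u ∈ Ideal.span {e.symm q, e.symm (Polynomial.C g)} ↔
      e u ∈ Ideal.span {q, Polynomial.C g} := by
    simp only [Ideal.mem_span_pair]
    constructor
    · rintro ⟨x, y, rfl⟩
      exact ⟨e x, e y, by simp⟩
    · rintro ⟨x, y, hxy⟩
      exact ⟨e.symm x, e.symm y, e.injective (by simpa using hxy)⟩
  refine ⟨e.symm q, hqJ, e.symm (Polynomial.C g), hg, e.symm (Polynomial.C h), hh, ?_, ?_, ?_⟩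
  · simpa using hq.ne_zero
  · intro u hu
    rw [← map_dvd_iff e] at hu ⊢
    simp only [map_mul, AlgEquiv.apply_symm_apply] at hu ⊢
    exact dvd_of_monic_dvd_C_mul hq hg0 hu
  · intro u hu
    rw [hspan] at hu ⊢
    simp only [map_mul, AlgEquiv.apply_symm_apply] at hu
    exact mem_span_pair_of_C_mul_mem hq hgh hu

end RegularSequence

section Division

variable {R ι : Type*} [CommRing R] [IsDomain R]

/-- Division of 1-forms by a 1-form whose coefficient ideal has grade at least two. -/
lemma exists_eq_mul_of_wedge_eq_zero {a c : ι → R} [Fintype ι] (hc : ∀ i j, a i * c j = a j * c i)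
    {f g : R} (hf0 : f ≠ 0) (hf : f ∈ Ideal.span (Set.range a))
    (hg : g ∈ Ideal.span (Set.range a)) (hfg : ∀ u, f ∣ g * u → f ∣ u) :
    ∃ s, ∀ j, c j = s * a j := by
  obtain ⟨x, rfl⟩ := Ideal.mem_span_range_iff_exists_fun.mp hf
  obtain ⟨y, rfl⟩ := Ideal.mem_span_range_iff_exists_fun.mp hg
  have key (z : ι → R) (j) : (∑ i, z i * a i) * c j = a j * ∑ i, z i * c i := by
    rw [Finset.sum_mul, Finset.mul_sum]
    exact Finset.sum_congr rfl fun i _ ↦ by linear_combination z i * hc i j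
  obtain ⟨j₀, hj₀⟩ : ∃ j, a j ≠ 0 := by
    by_contra! h
    exact hf0 (by simp [h])
  obtain ⟨s, hs⟩ := hfg (∑ i, x i * c i) ⟨∑ i, y i * c i, mul_left_cancel₀ hj₀ (by
    linear_combination (∑ i, x i * a i) * key y j₀ - (∑ i, y i * a i) * key x j₀)⟩
  exact ⟨s, fun j ↦ mul_left_cancel₀ hf0 (by rw [key, hs]; ring)⟩

/-- Division of 2-forms: if `a ∧ b = 0` and the coefficient ideal of the 1-form `a` contains a
regular sequence of length three, then the coefficients of `b` lie in that ideal. -/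
lemma mem_span_range_of_wedge_eq_zero [Fintype ι] {a : ι → R} {b : ι → ι → R}
    (hb : ∀ i j, b i j = - b j i)
    (hab : ∀ i j k, a i * b j k + a j * b k i + a k * b i j = 0)
    {f g h : R} (hf0 : f ≠ 0) (hf : f ∈ Ideal.span (Set.range a))
    (hg : g ∈ Ideal.span (Set.range a)) (hh : h ∈ Ideal.span (Set.range a))
    (hfg : ∀ u, f ∣ g * u → f ∣ u)
    (hfgh : ∀ u, h * u ∈ Ideal.span {f, g} → u ∈ Ideal.span {f, g}) (j k : ι) :
    b j k ∈ Ideal.span (Set.range a) := by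
  have contract {z : R} (hz : z ∈ Ideal.span (Set.range a)) :
      ∃ β : ι → R, ∀ j k, z * b j k = a j * β k - a k * β j := by
    obtain ⟨x, rfl⟩ := Ideal.mem_span_range_iff_exists_fun.mp hz
    refine ⟨fun k ↦ ∑ i, x i * b i k, fun j k ↦ ?_⟩
    simp only [Finset.sum_mul, Finset.mul_sum, ← Finset.sum_sub_distrib]
    exact Finset.sum_congr rfl fun i _ ↦ by
      linear_combination x i * hab i j k - x i * a j * hb k i
  obtain ⟨β, hβ⟩ := contract hf
  obtain ⟨γ, hγ⟩ := contract hg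
  obtain ⟨δ, hδ⟩ := contract hh
  obtain ⟨s, hs⟩ := exists_eq_mul_of_wedge_eq_zero (a := a) (c := fun j ↦ g * β j - f * γ j)
    (fun j k ↦ by linear_combination f * hγ j k - g * hβ j k) hf0 hf hg hfg
  obtain ⟨t, ht⟩ := exists_eq_mul_of_wedge_eq_zero (a := a) (c := fun j ↦ h * β j - f * δ j)
    (fun j k ↦ by linear_combination f * hδ j k - h * hβ j k) hf0 hf hg hfg
  obtain ⟨r, hr⟩ := exists_eq_mul_of_wedge_eq_zero (a := a) (c := fun j ↦ h * γ j - g * δ j)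
    (fun j k ↦ by linear_combination g * hδ j k - h * hγ j k) hf0 hf hg hfg
  obtain ⟨j₀, hj₀⟩ : ∃ j, a j ≠ 0 := by
    obtain ⟨x, rfl⟩ := Ideal.mem_span_range_iff_exists_fun.mp hf
    by_contra! h
    exact hf0 (by simp [h])
  obtain ⟨s₁, s₂, hs'⟩ := Ideal.mem_span_pair.mp (hfgh s (Ideal.mem_span_pair.mpr
    ⟨-r, t, mul_left_cancel₀ hj₀ (by
      linear_combination f * hr j₀ - g * ht j₀ + h * hs j₀)⟩))
  have hdvd (l) : f ∣ β l - s₂ * a l :=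
    hfg _ ⟨γ l + s₁ * a l, by linear_combination hs l - a l * hs'⟩
  choose ε hε using hdvd
  have : b j k = a j * ε k - a k * ε j := mul_left_cancel₀ hf0 (by
    linear_combination hβ j k + a j * hε k - a k * hε j)
  rw [this]
  exact sub_mem (Ideal.mul_mem_right _ _ (Ideal.subset_span ⟨j, rfl⟩))
    (Ideal.mul_mem_right _ _ (Ideal.subset_span ⟨k, rfl⟩))

end Division

section Foliation

lemma coeff_eq_zero_of_mem_span_homogeneous {σ ι R : Type*} [CommRing R] [Fintype ι]
    {a : ι → MvPolynomial σ R} {N : ℕ} (ha : ∀ i, (a i).IsHomogeneous N) {p : MvPolynomial σ R}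
    (hp : p ∈ Ideal.span (Set.range a)) {v : σ →₀ ℕ} (hv : v.degree < N) : coeff v p = 0 := by
  classical
  obtain ⟨c, rfl⟩ := Ideal.mem_span_range_iff_exists_fun.mp hp
  rw [coeff_sum]
  refine Finset.sum_eq_zero fun i _ ↦ ?_
  rw [coeff_mul]
  refine Finset.sum_eq_zero fun x hx ↦ ?_
  have hdeg := congrArg Finsupp.degree (Finset.HasAntidiagonal.mem_antidiagonal.mp hx)
  rw [map_add] at hdeg
  rw [(ha i).coeff_eq_zero (by omega), mul_zero]

lemma eq_zero_of_mem_span_homogeneous {σ ι R : Type*} [CommRing R] [Fintype ι]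
    {a : ι → MvPolynomial σ R} {m N : ℕ} (ha : ∀ i, (a i).IsHomogeneous N)
    {p : MvPolynomial σ R} (hpm : p.IsHomogeneous m) (hm : m < N)
    (hp : p ∈ Ideal.span (Set.range a)) : p = 0 := by
  ext v
  rw [coeff_zero]
  by_cases hv : v.degree = m
  · exact coeff_eq_zero_of_mem_span_homogeneous ha hp (hv ▸ hm)
  · exact hpm.coeff_eq_zero hv

namespace ProjFoliation

variable {n d : ℕ} (F : ProjFoliation n d)

lemma exists_pderiv_sub_ne_zero : ∃ j k, pderiv j (F.a k) - pderiv k (F.a j) ≠ 0 := by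
  by_contra! H
  obtain ⟨j, hj⟩ := F.nonzero
  refine hj ?_
  have h := congrArg (pderiv j) F.euler
  simp only [map_sum, map_zero, Derivation.leibniz, smul_eq_mul, Finset.sum_add_distrib,
    pderiv_X] at h
  have h1 : ∑ i, X i * pderiv j (F.a i) = (d + 1) • F.a j := by
    rw [← (F.homog j).sum_X_mul_pderiv]
    exact Finset.sum_congr rfl fun i _ ↦ by rw [sub_eq_zero.mp (H j i)]
  have h2 : ∑ i, F.a i * Pi.single (M := fun _ ↦ MvPolynomial (Fin (n + 1)) ℂ) j 1 i = F.a j := by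
    simp [Pi.single_apply]
  rw [h1, h2, ← succ_nsmul] at h
  exact (smul_eq_zero.mp h).resolve_left (by simp)

lemma two_le_height (P : Ideal (MvPolynomial (Fin (n + 1)) ℂ)) (hP : P.IsPrime)
    (hle : Ideal.span (Set.range F.a) ≤ P) : 2 ≤ P.height := by
  obtain ⟨i, hi⟩ := F.nonzero
  have hbot : P ≠ ⊥ := by
    rintro rfl
    exact hi (hle (Ideal.subset_span ⟨i, rfl⟩))
  have h0 : P.height ≠ 0 := Ideal.height_eq_zero_iff_eq_bot.not.mpr hbot
  have h1 : P.height ≠ 1 := by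
    intro h1
    obtain ⟨q, hq⟩ := (UniqueFactorizationMonoid.isPrincipal_of_height_eq_one h1).principal
    have hdvd (j) : q ∣ F.a j := Ideal.mem_span_singleton.mp
      (hq.le (hle (Ideal.subset_span ⟨j, rfl⟩)))
    refine F.codim2 ⟨q, fun hdeg ↦ ?_, hdvd⟩
    have hqC := totalDegree_eq_zero_iff_eq_C.mp hdeg
    have hc : coeff 0 q ≠ 0 := by
      intro hc
      rw [hc, map_zero] at hqC
      exact hbot (by rw [hq, hqC]; simp)
    exact hP.ne_top (Ideal.eq_top_of_isUnit_mem P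
      (hq.ge (Submodule.mem_span_singleton_self q))
      (hqC ▸ (isUnit_iff_ne_zero.mpr hc).map C))
  generalize P.height = a at *
  induction a with
  | top => exact le_top
  | coe a => norm_cast at *; omega

lemma exists_height_eq_two : ∃ P : Ideal (MvPolynomial (Fin (n + 1)) ℂ), P.IsPrime ∧
    Ideal.span (Set.range F.a) ≤ P ∧ P.height = 2 := by
  by_contra! H
  have h3 (P : Ideal (MvPolynomial (Fin (n + 1)) ℂ)) (hP : P.IsPrime)
      (hle : Ideal.span (Set.range F.a) ≤ P) : 3 ≤ P.height := by
    have h2 := (F.two_le_height P hP hle).lt_of_ne (H P hP hle).symm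
    simpa [one_add_one_eq_two, two_add_one_eq_three] using Order.add_one_le_of_lt h2
  obtain ⟨f, hf, g, hg, h, hh, hf0, hfg, hfgh⟩ := exists_regular_sequence_of_three_le_height h3
  obtain ⟨j, k, hjk⟩ := F.exists_pderiv_sub_ne_zero
  exact hjk (eq_zero_of_mem_span_homogeneous F.homog
    ((F.homog k).pderiv.sub (F.homog j).pderiv) (by simp)
    (mem_span_range_of_wedge_eq_zero (b := fun j k ↦ pderiv j (F.a k) - pderiv k (F.a j))
      (fun i j ↦ by ring) F.integrable hf0 hf hg hh hfg hfgh j k))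

end ProjFoliation

end Foliation

/-- The singular locus of a holomorphic foliation on `ℂℙⁿ`, `n > 1`, contains an
irreducible component of codimension 2. -/
theorem sing_contains_codim_two_component (n d : ℕ) (hn : 1 < n)
    (F : ProjFoliation n d) :
    ∃ P ∈ (Ideal.span (Set.range F.a)).minimalPrimes,
      ringKrullDim (MvPolynomial (Fin (n + 1)) ℂ ⧸ P) = ((n - 1 : ℕ) : WithBot ℕ∞) := by
  obtain ⟨P, hP, hle, hP2⟩ := F.exists_height_eq_two
  obtain ⟨Q, hQ, hQP⟩ := Ideal.exists_minimalPrimes_le hle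
  have hQprime : Q.IsPrime := hQ.1.1
  refine ⟨Q, hQ, ?_⟩
  have hQ2 : Q.height = 2 :=
    le_antisymm (hP2 ▸ Ideal.height_mono hQP) (F.two_le_height Q hQprime hQ.1.2)
  have hsum := height_add_coheight_eq ℂ (n + 1) ⟨Q, hQprime⟩
  rw [← PrimeSpectrum.height_eq_orderHeight, hQ2] at hsum
  rw [ringKrullDim_quotient_eq_coheight ⟨Q, hQprime⟩]
  have hc := (WithTop.add_ne_top.mp (hsum.trans_ne (ENat.natCast_ne_top _))).2
  generalize Order.coheight (⟨Q, hQprime⟩ : PrimeSpectrum (MvPolynomial (Fin (n + 1)) ℂ)) = c at *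
  lift c to ℕ using hc
  norm_cast at hsum
  rw [show c = n - 1 by omega]
  rfl
end

section
/- Let M be a real analytic Levi-flat hypersurface in C^n (n > 1) and p ∈ M. Then there exists a neighbourhood U of p in C^n and a biholomorphic map f from U onto an open set U' ⊂ C^n such that f(M ∩ U) = {x_n = 0} ∩ U', where z = (z_1, ..., z_n), z_n = x_n + i y_n, are the holomorphic coordinates on U'. -/
/- STATEMENT 5 (H. Cartan): Let M be a real analytic Levi-flat hypersurface in ℂⁿ (n > 1)
and p ∈ M.  Then there is a neighbourhood U of p and a biholomorphic map f of U onto an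
open set U' ⊂ ℂⁿ with f(M ∩ U) = {xₙ = 0} ∩ U', where zₙ = xₙ + iyₙ.

ℂⁿ is `Fin n → ℂ`.  The Levi form of a defining function ρ at p evaluated on w is encoded
(up to an irrelevant positive factor) as D²ρ(p)(w,w) + D²ρ(p)(iw,iw), which equals
4·Re⟨complex Hessian⟩ = 4·𝓛ρ(p,w); a holomorphic and injective map on an open subset of
ℂⁿ is automatically biholomorphic onto its (open) image. -/

open Complex Set

noncomputable section

/-- The Levi form (up to a positive factor) of the defining function `ρ` at `p`,
evaluated at `w`: `D²ρ(p)(w,w) + D²ρ(p)(Jw,Jw) = 4 ∑ ∂²ρ/∂zⱼ∂z̄ₖ wⱼ w̄ₖ`. -/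
def leviForm {m : ℕ} (ρ : (Fin m → ℂ) → ℝ) (p w : Fin m → ℂ) : ℝ :=
  iteratedFDeriv ℝ 2 ρ p ![w, w] + iteratedFDeriv ℝ 2 ρ p ![Complex.I • w, Complex.I • w]

/-- `w` belongs to the complex tangent space at `p` of the hypersurface `{ρ = 0}`. -/
def IsComplexTangent {m : ℕ} (ρ : (Fin m → ℂ) → ℝ) (p w : Fin m → ℂ) : Prop :=
  fderiv ℝ ρ p w = 0 ∧ fderiv ℝ ρ p (Complex.I • w) = 0

/-- `M` is a real analytic Levi-flat hypersurface (in the open set where it lives):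
near each of its points it is the zero set of a real analytic defining function with
nonvanishing gradient whose Levi form vanishes on complex tangent vectors. -/
def IsAnalyticLeviFlatHypersurface {m : ℕ} (M : Set (Fin m → ℂ)) : Prop :=
  ∀ p ∈ M, ∃ V : Set (Fin m → ℂ), IsOpen V ∧ p ∈ V ∧ ∃ ρ : (Fin m → ℂ) → ℝ,
    AnalyticOnNhd ℝ ρ V ∧ (∀ q ∈ V, fderiv ℝ ρ q ≠ 0) ∧
    (∀ q ∈ V, q ∈ M ↔ ρ q = 0) ∧
    (∀ q ∈ V, ρ q = 0 → ∀ w, IsComplexTangent ρ q w → leviForm ρ q w = 0)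

section

open Filter Topology
open scoped ComplexConjugate NNReal ENNReal

/-- The complex power series obtained from a real one by extending the scalars, where the
coordinates with respect to `b` are extended by the linear forms `ℓ`. -/
def FormalMultilinearSeries.complexify {ι V W : Type*} [Fintype ι]
    [NormedAddCommGroup V] [NormedSpace ℝ V] [NormedAddCommGroup W] [NormedSpace ℂ W]
    (P : FormalMultilinearSeries ℝ V ℝ) (b : ι → V) (ℓ : ι → W →L[ℂ] ℂ) :
    FormalMultilinearSeries ℂ W ℂ := fun k =>
  ∑ f : Fin k → ι, ((P k (fun j => b (f j)) : ℝ) : ℂ) •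
    (ContinuousMultilinearMap.mkPiAlgebra ℂ (Fin k) ℂ).compContinuousLinearMap fun j => ℓ (f j)

section Complexify

variable {ι V W : Type*} [Fintype ι]
  [NormedAddCommGroup V] [NormedSpace ℝ V] [NormedAddCommGroup W] [NormedSpace ℂ W]

theorem FormalMultilinearSeries.complexify_apply (P : FormalMultilinearSeries ℝ V ℝ)
    (b : ι → V) (ℓ : ι → W →L[ℂ] ℂ) (k : ℕ) (y : W) :
    P.complexify b ℓ k (fun _ => y) =
      ∑ f : Fin k → ι, ((P k (fun j => b (f j)) : ℝ) : ℂ) * ∏ j, ℓ (f j) y := by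
  simp [FormalMultilinearSeries.complexify]

theorem FormalMultilinearSeries.norm_complexify_le (P : FormalMultilinearSeries ℝ V ℝ)
    (b : ι → V) (ℓ : ι → W →L[ℂ] ℂ) (k : ℕ) :
    ‖P.complexify b ℓ k‖ ≤
      ‖P k‖ * (Fintype.card ι * ((∑ i, ‖b i‖) * ∑ i, ‖ℓ i‖)) ^ k := by
  set B := ∑ i, ‖b i‖
  set L := ∑ i, ‖ℓ i‖
  have hB : ∀ i, ‖b i‖ ≤ B := fun i =>
    Finset.single_le_sum (f := fun i => ‖b i‖) (fun _ _ => norm_nonneg _) (Finset.mem_univ i)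
  have hL : ∀ i, ‖ℓ i‖ ≤ L := fun i =>
    Finset.single_le_sum (f := fun i => ‖ℓ i‖) (fun _ _ => norm_nonneg _) (Finset.mem_univ i)
  have hB0 : 0 ≤ B := Finset.sum_nonneg fun _ _ => norm_nonneg _
  have hterm : ∀ f : Fin k → ι, ‖((P k (fun j => b (f j)) : ℝ) : ℂ) •
      (ContinuousMultilinearMap.mkPiAlgebra ℂ (Fin k) ℂ).compContinuousLinearMap
        fun j => ℓ (f j)‖ ≤ ‖P k‖ * (B * L) ^ k := by
    intro f
    have h1 : ‖P k (fun j => b (f j))‖ ≤ ‖P k‖ * B ^ k := by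
      refine ((P k).le_opNorm _).trans ?_
      gcongr
      calc ∏ j, ‖b (f j)‖ ≤ ∏ _j : Fin k, B :=
            Finset.prod_le_prod (fun _ _ => norm_nonneg _) fun j _ => hB (f j)
        _ = B ^ k := by simp
    have h2 : ‖(ContinuousMultilinearMap.mkPiAlgebra ℂ (Fin k) ℂ).compContinuousLinearMap
        fun j => ℓ (f j)‖ ≤ L ^ k := by
      refine (ContinuousMultilinearMap.norm_compContinuousLinearMap_le _ _).trans ?_
      rw [ContinuousMultilinearMap.norm_mkPiAlgebra, one_mul]
      calc ∏ j, ‖ℓ (f j)‖ ≤ ∏ _j : Fin k, L :=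
            Finset.prod_le_prod (fun _ _ => norm_nonneg _) fun j _ => hL (f j)
        _ = L ^ k := by simp
    rw [norm_smul, Complex.norm_real, mul_pow, ← mul_assoc]
    exact mul_le_mul h1 h2 (norm_nonneg _) (by positivity)
  calc ‖P.complexify b ℓ k‖ ≤ ∑ _f : Fin k → ι, ‖P k‖ * (B * L) ^ k :=
        (norm_sum_le _ _).trans (Finset.sum_le_sum fun f _ => hterm f)
    _ = ‖P k‖ * (Fintype.card ι * (B * L)) ^ k := by
        simp [Finset.card_univ, mul_pow]; ring

theorem FormalMultilinearSeries.radius_complexify_pos {P : FormalMultilinearSeries ℝ V ℝ}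
    (hP : 0 < P.radius) (b : ι → V) (ℓ : ι → W →L[ℂ] ℂ) : 0 < (P.complexify b ℓ).radius := by
  obtain ⟨r, hr0, hr⟩ := ENNReal.lt_iff_exists_nnreal_btwn.1 hP
  have hr0' : 0 < r := by exact_mod_cast hr0
  obtain ⟨C, hC, hPC⟩ := P.norm_mul_pow_le_of_lt_radius hr
  set A : ℝ := Fintype.card ι * ((∑ i, ‖b i‖) * ∑ i, ‖ℓ i‖) with hA
  have hA0 : 0 ≤ A := by positivity
  let s : ℝ≥0 := r / (⟨A, hA0⟩ + 1)
  have hs : 0 < s := by positivity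
  have hsr : A * s ≤ r := by
    have : (s : ℝ) = r / (A + 1) := rfl
    rw [this, mul_div_assoc', div_le_iff₀ (by positivity)]
    nlinarith [r.2]
  refine lt_of_lt_of_le (by exact_mod_cast hs)
    ((P.complexify b ℓ).le_radius_of_bound C (r := s) fun k => ?_)
  calc ‖P.complexify b ℓ k‖ * (s : ℝ) ^ k ≤ ‖P k‖ * A ^ k * (s : ℝ) ^ k := by
        gcongr
        exact P.norm_complexify_le b ℓ k
    _ = ‖P k‖ * (A * s) ^ k := by rw [mul_pow A, mul_assoc]
    _ ≤ ‖P k‖ * (r : ℝ) ^ k := by gcongr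
    _ ≤ C := hPC k

/-- A real analytic function extends holomorphically to a complexification, and the extension is
compatible with complex conjugation. -/
theorem AnalyticAt.exists_complexification {ρ : V → ℝ} {p : V} (hρ : AnalyticAt ℝ ρ p)
    (b : ι → V) (c : ι → V → ℝ) (hb : ∀ v, v = ∑ i, c i v • b i) (ℓ : ι → W →L[ℂ] ℂ)
    (δ : V → W) (hδsub : ∀ v w, δ (v - w) = δ v - δ w)
    (hℓδ : ∀ i v, ℓ i (δ v) = c i v) (σ : W → W) (hσ : ∀ i Z, ℓ i (σ Z) = conj (ℓ i Z)) :
    ∃ R : W → ℂ, AnalyticAt ℂ R (δ p) ∧ (∀ᶠ q in 𝓝 p, R (δ q) = ρ q) ∧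
      ∀ Y, R (δ p + σ Y) = conj (R (δ p + Y)) := by
  obtain ⟨P, r, hP⟩ := hρ
  set Q := P.complexify b ℓ with hQdef
  have hQ0 : 0 < Q.radius := P.radius_complexify_pos (hP.r_pos.trans_le hP.r_le) b ℓ
  have hQ := Q.hasFPowerSeriesOnBall hQ0
  have hreal : ∀ (k : ℕ) (v : V), Q k (fun _ => δ v) = ((P k (fun _ => v) : ℝ) : ℂ) := by
    classical
    intro k v
    rw [hQdef, P.complexify_apply]
    conv_rhs => rw [hb v]
    rw [ContinuousMultilinearMap.map_sum]
    simp_rw [ContinuousMultilinearMap.map_smul_univ, hℓδ]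
    push_cast
    refine Finset.sum_congr rfl fun f _ => ?_
    rw [mul_comm, smul_eq_mul]
    push_cast
    rfl
  refine ⟨fun Z => Q.sum (Z - δ p), ?_, ?_, ?_⟩
  · have h0 : AnalyticAt ℂ Q.sum (δ p - δ p) := by simpa using hQ.analyticAt
    exact h0.comp_of_eq (analyticAt_id.sub analyticAt_const) rfl
  · have h1 : ∀ᶠ q in 𝓝 p, q - p ∈ Metric.eball (0 : V) r := by
      have : Tendsto (fun q => q - p) (𝓝 p) (𝓝 0) :=
        Continuous.tendsto' (by fun_prop) _ _ (by simp)
      exact this (Metric.eball_mem_nhds _ hP.r_pos)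
    filter_upwards [h1] with q hq
    have h3 := hP.hasSum hq
    rw [add_sub_cancel] at h3
    have h4 : HasSum (fun k => Q k fun _ => δ (q - p)) ((ρ q : ℝ) : ℂ) := by
      simp_rw [hreal]
      exact_mod_cast h3
    rw [← hδsub]
    exact h4.tsum_eq
  · intro Y
    simp only [add_sub_cancel_left, FormalMultilinearSeries.sum]
    rw [Complex.conj_tsum]
    refine tsum_congr fun k => ?_
    rw [hQdef, P.complexify_apply, P.complexify_apply]
    simp [hσ]

end Complexify

/-- A real analytic function of `z` near `p` can be written as a holomorphic function of `(z, w)`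
restricted to `w = conj z`. -/
theorem AnalyticAt.exists_polarization {n : ℕ} {ρ : (Fin n → ℂ) → ℝ} {p : Fin n → ℂ}
    (hρ : AnalyticAt ℝ ρ p) :
    ∃ R : (Fin n → ℂ) × (Fin n → ℂ) → ℂ, AnalyticAt ℂ R (p, star p) ∧
      (∀ᶠ q in 𝓝 p, R (q, star q) = ρ q) ∧
      ∀ z w, R (star w, star z) = conj (R (z, w)) := by
  let ℓ : Fin n ⊕ Fin n → (Fin n → ℂ) × (Fin n → ℂ) →L[ℂ] ℂ := Sum.elim
    (fun j => (2⁻¹ : ℂ) • ((ContinuousLinearMap.proj j).comp (ContinuousLinearMap.fst ℂ _ _) +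
      (ContinuousLinearMap.proj j).comp (ContinuousLinearMap.snd ℂ _ _)))
    (fun j => (2 * I)⁻¹ • ((ContinuousLinearMap.proj j).comp (ContinuousLinearMap.fst ℂ _ _) -
      (ContinuousLinearMap.proj j).comp (ContinuousLinearMap.snd ℂ _ _)))
  obtain ⟨R, hR, hRρ, hRσ⟩ := hρ.exists_complexification
    (b := Sum.elim (fun j => Pi.single j 1) (fun j => Pi.single j I))
    (c := Sum.elim (fun j v => (v j).re) (fun j v => (v j).im))
    (fun v => by
      ext k
      simp [Finset.sum_apply, Pi.single_apply, Complex.re_add_im])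
    ℓ (fun q => (q, star q)) (fun v w => by simp)
    (fun i v => by
      rcases i with j | j
      · have := Complex.add_conj (v j)
        simp only [ℓ, Sum.elim_inl, smul_apply, add_apply,
          ContinuousLinearMap.comp_apply, ContinuousLinearMap.proj_apply, Pi.star_apply,
          ContinuousLinearMap.coe_fst', ContinuousLinearMap.coe_snd', smul_eq_mul,
          RCLike.star_def, this]
        push_cast
        ring
      · have := Complex.sub_conj (v j)
        simp only [ℓ, Sum.elim_inr, smul_apply, sub_apply,
          ContinuousLinearMap.comp_apply, ContinuousLinearMap.proj_apply, Pi.star_apply,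
          ContinuousLinearMap.coe_fst', ContinuousLinearMap.coe_snd', smul_eq_mul,
          RCLike.star_def, this]
        push_cast
        field_simp [Complex.I_ne_zero])
    (fun Z => (star Z.2, star Z.1))
    (fun i Z => by
      rcases i with j | j
      · simp [ℓ, add_comm, Complex.conj_ofNat]
      · simp [ℓ, Complex.conj_ofNat]
        ring)
  refine ⟨R, hR, hRρ, fun z w => ?_⟩
  have h := hRσ (z - p, w - star p)
  simpa using h

/-- Moving a point `x` near a zero of `R` onto the zero set of `R` in a transverse direction. -/
theorem AnalyticAt.exists_implicit_along {X : Type*} [NormedAddCommGroup X] [NormedSpace ℂ X]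
    [CompleteSpace X] {R : X → ℂ} {x₀ D : X} (hR : AnalyticAt ℂ R x₀) (h0 : R x₀ = 0)
    (hD : fderiv ℂ R x₀ D = 1) :
    ∃ τ : X → ℂ, τ x₀ = 0 ∧ ContDiffAt ℂ 1 τ x₀ ∧ fderiv ℂ τ x₀ = -fderiv ℂ R x₀ ∧
      (∀ᶠ x in 𝓝 x₀, R (x + τ x • D) = 0) ∧
      ∀ᶠ v in 𝓝 (x₀, (0 : ℂ)), R (v.1 + v.2 • D) = 0 → v.2 = τ v.1 := by
  set F : X × ℂ → ℂ := fun v => R (v.1 + v.2 • D) with hF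
  have hRd : HasFDerivAt R (fderiv ℂ R x₀) (x₀ + (0 : ℂ) • D) := by
    simpa using hR.differentiableAt.hasFDerivAt
  have hFc : ContDiffAt ℂ 1 F (x₀, (0 : ℂ)) := by
    have h1 : ContDiffAt ℂ 1 R (x₀ + (0 : ℂ) • D) := by simpa using hR.contDiffAt
    exact ContDiffAt.comp (x₀, (0 : ℂ)) (g := R) (f := fun v : X × ℂ => v.1 + v.2 • D) h1
      (by fun_prop)
  have hFd : HasFDerivAt F ((fderiv ℂ R x₀).comp
      (ContinuousLinearMap.fst ℂ X ℂ + (ContinuousLinearMap.snd ℂ X ℂ).smulRight D))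
      (x₀, (0 : ℂ)) := by
    refine HasFDerivAt.comp (x₀, (0 : ℂ)) (g := R) (f := fun v : X × ℂ => v.1 + v.2 • D) hRd ?_
    exact hasFDerivAt_fst.add (hasFDerivAt_snd.smul_const D)
  have hinr : fderiv ℂ F (x₀, (0 : ℂ)) ∘L .inr ℂ X ℂ = .id ℂ ℂ := by
    rw [hFd.fderiv]
    ext
    simp [hD]
  have hinv : (fderiv ℂ F (x₀, (0 : ℂ)) ∘L .inr ℂ X ℂ).IsInvertible := by
    rw [hinr]
    exact ⟨ContinuousLinearEquiv.refl ℂ ℂ, rfl⟩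
  have hn : (1 : WithTop ℕ∞) ≠ 0 := one_ne_zero
  have hF0 : F (x₀, 0) = 0 := by simpa [hF] using h0
  refine ⟨hFc.implicitFunction hn hinv, hFc.implicitFunction_apply_self hn hinv,
    hFc.contDiffAt_implicitFunction hn hinv, ?_, ?_, ?_⟩
  · have h := (hFc.hasStrictFDerivAt_implicitFunction hn hinv).hasFDerivAt.fderiv
    rw [h, hinr, hFd.fderiv]
    ext
    simp
  · filter_upwards [hFc.eventually_apply_implicitFunction hn hinv] with x hx
    rw [hF0] at hx
    exact hx
  · filter_upwards [hFc.eventually_apply_eq_iff_implicitFunction hn hinv] with v hv hv0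
    rw [hF0] at hv
    exact (hv.1 hv0).symm

/-- Implicit differentiation of `R (x + τ x • D) = 0`. -/
theorem fderiv_add_fderiv_smul_eq_zero {X : Type*} [NormedAddCommGroup X] [NormedSpace ℂ X]
    {R τ : X → ℂ} {D x : X} (hτ : DifferentiableAt ℂ τ x)
    (hR : DifferentiableAt ℂ R (x + τ x • D)) (h0 : ∀ᶠ y in 𝓝 x, R (y + τ y • D) = 0) (u : X) :
    fderiv ℂ R (x + τ x • D) (u + fderiv ℂ τ x u • D) = 0 := by
  have hm : HasFDerivAt (fun x => x + τ x • D)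
      (ContinuousLinearMap.id ℂ X + (fderiv ℂ τ x).smulRight D) x :=
    (hasFDerivAt_id x).add (hτ.hasFDerivAt.smul_const D)
  have h1 := (hR.hasFDerivAt.comp x hm).fderiv
  have h2 : (R ∘ fun x => x + τ x • D) =ᶠ[𝓝 x] fun _ => (0 : ℂ) := h0
  rw [h2.fderiv_eq] at h1
  simpa using (DFunLike.congr_fun h1 u).symm

/-- A function whose derivative vanishes on the tangent spaces of `{R = 0}` is constant along the
part of `{R = 0}` swept out by moving the points of a connected open set in a direction `D`. -/
theorem eq_of_fderiv_eq_zero_along {X : Type*} [NormedAddCommGroup X] [NormedSpace ℂ X]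
    {S : Set X} (hS : IsOpen S) (hS' : IsPreconnected S) {R g τ : X → ℂ} {D : X}
    (hτ : ∀ x ∈ S, DifferentiableAt ℂ τ x) (hR0 : ∀ x ∈ S, R (x + τ x • D) = 0)
    (hR : ∀ x ∈ S, DifferentiableAt ℂ R (x + τ x • D))
    (hg : ∀ x ∈ S, DifferentiableAt ℂ g (x + τ x • D))
    (hgR : ∀ x ∈ S, ∀ u, fderiv ℂ R (x + τ x • D) u = 0 → fderiv ℂ g (x + τ x • D) u = 0)
    {x y : X} (hx : x ∈ S) (hy : y ∈ S) : g (x + τ x • D) = g (y + τ y • D) := by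
  have hgm : ∀ x ∈ S, HasFDerivAt (fun x => g (x + τ x • D)) _ x := fun x hx =>
    (hg x hx).hasFDerivAt.comp x
      ((hasFDerivAt_id x).add ((hτ x hx).hasFDerivAt.smul_const D))
  refine hS.is_const_of_fderiv_eq_zero (𝕜 := ℂ) hS' (f := fun x => g (x + τ x • D))
    (fun x hx => (hgm x hx).differentiableAt.differentiableWithinAt) (fun x hx => ?_) hx hy
  rw [(hgm x hx).fderiv]
  ext u
  exact hgR x hx _ (fderiv_add_fderiv_smul_eq_zero (hτ x hx) (hR x hx)
    (Filter.mem_of_superset (hS.mem_nhds hx) hR0) u)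

/-- The points `(z, conj z)` form a set of uniqueness for holomorphic functions. -/
theorem eqOn_zero_of_eq_zero_on_conj_diagonal {n : ℕ} {p : Fin n → ℂ} {r : ℝ}
    {f : (Fin n → ℂ) × (Fin n → ℂ) → ℂ} (hf : DifferentiableOn ℂ f (Metric.ball (p, star p) r))
    (h0 : ∀ z ∈ Metric.ball p r, f (z, star z) = 0) :
    ∀ Z ∈ Metric.ball (p, star p) r, f Z = 0 := by
  rintro ⟨z, w⟩ hZ
  set a : Fin n → ℂ := (2⁻¹ : ℂ) • (z + star w) with ha
  set b : Fin n → ℂ := (2 * I)⁻¹ • (z - star w) with hb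
  let γ : ℂ → (Fin n → ℂ) × (Fin n → ℂ) := fun ζ => (a + ζ • b, star a + ζ • star b)
  have hγd : Differentiable ℂ γ := by
    intro ζ
    simp only [γ]
    fun_prop
  have hγI : γ I = (z, w) := by
    ext k
    · simp [γ, ha, hb]
      field_simp
      linear_combination (conj (w k) - z k) * Complex.I_sq
    · simp [γ, ha, hb]
      field_simp
      linear_combination (conj (z k) - w k) * Complex.I_sq
  rw [← ball_prod_same] at hZ
  obtain ⟨hz, hw⟩ := hZ
  simp only [Metric.mem_ball, dist_eq_norm] at hz hw
  have hw' : ‖star w - p‖ < r := by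
    rw [← norm_star]; simpa using hw
  have hap : a ∈ Metric.ball p r := by
    have h1 : a - p = (2⁻¹ : ℂ) • ((z - p) + (star w - p)) := by
      ext k; simp [ha]; ring
    rw [Metric.mem_ball, dist_eq_norm, h1, norm_smul]
    have := norm_add_le (z - p) (star w - p)
    norm_num
    linarith
  set S : Set ℂ := γ ⁻¹' Metric.ball (p, star p) r with hSdef
  have hSo : IsOpen S := Metric.isOpen_ball.preimage hγd.continuous
  have hSc : Convex ℝ S := by
    intro s hs t ht α β hα hβ hαβ
    have : γ (α • s + β • t) = α • γ s + β • γ t := by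
      have h1 : (α : ℂ) + β = 1 := by exact_mod_cast hαβ
      ext k
      · simp [γ]
        linear_combination -(a k) * h1
      · simp [γ]
        linear_combination -(conj (a k)) * h1
    simp only [hSdef, mem_preimage, this]
    exact convex_ball _ _ hs ht hα hβ hαβ
  have hstar : ∀ q : Fin n → ℂ, q ∈ Metric.ball p r →
      (q, star q) ∈ Metric.ball (p, star p) r := by
    intro q hq
    rw [← ball_prod_same]
    refine ⟨hq, ?_⟩
    rw [Metric.mem_ball, dist_eq_norm] at hq ⊢
    rwa [← star_sub, norm_star]
  have h0S : (0 : ℂ) ∈ S := by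
    simpa [hSdef, γ] using hstar a hap
  have hIS : I ∈ S := by
    simp only [hSdef, mem_preimage, hγI, ← ball_prod_same]
    exact ⟨by simpa [dist_eq_norm] using hz, by simpa [dist_eq_norm] using hw⟩
  have hfγ : AnalyticOnNhd ℂ (f ∘ γ) S :=
    (hf.comp hγd.differentiableOn fun ζ hζ => hζ).analyticOnNhd hSo
  have hfreq : ∃ᶠ ζ in 𝓝[≠] (0 : ℂ), (f ∘ γ) ζ = 0 := by
    have hreal : ∀ᶠ t : ℝ in 𝓝[≠] 0, (f ∘ γ) (t : ℂ) = 0 := by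
      have h1 : ∀ᶠ t : ℝ in 𝓝 0, a + (t : ℂ) • b ∈ Metric.ball p r := by
        have hc : Continuous fun t : ℝ => a + (t : ℂ) • b := by fun_prop
        exact hc.continuousAt.eventually_mem (Metric.isOpen_ball.mem_nhds (by simpa using hap))
      filter_upwards [nhdsWithin_le_nhds h1] with t ht
      have := h0 _ ht
      simpa [γ, Complex.conj_ofReal] using this
    have ht : Tendsto (fun t : ℝ => (t : ℂ)) (𝓝[≠] 0) (𝓝[≠] 0) := by
      refine tendsto_nhdsWithin_iff.2 ⟨?_, ?_⟩
      · exact (Complex.continuous_ofReal.tendsto' 0 0 (by simp)).mono_left nhdsWithin_le_nhds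
      · filter_upwards [self_mem_nhdsWithin] with t ht
        simpa using ht
    exact ht.frequently hreal.frequently
  have := hfγ.eqOn_zero_of_preconnected_of_frequently_eq_zero hSc.isPreconnected h0S hfreq hIS
  simpa [hγI] using this

section Levi

variable {n : ℕ} {ρ : (Fin n → ℂ) → ℝ} {R : (Fin n → ℂ) × (Fin n → ℂ) → ℂ} {q : Fin n → ℂ}

/-- The real linear embedding `z ↦ (z, conj z)`. -/
def conjDiagonal (n : ℕ) : (Fin n → ℂ) →L[ℝ] (Fin n → ℂ) × (Fin n → ℂ) :=
  (ContinuousLinearMap.id ℝ _).prod ((starL' ℝ : (Fin n → ℂ) ≃L[ℝ] _) : _ →L[ℝ] _)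

theorem conjDiagonal_apply (u : Fin n → ℂ) : conjDiagonal n u = (u, star u) := rfl

theorem ofReal_fderiv_eq_of_polarization (hR : DifferentiableAt ℂ R (q, star q))
    (hρ : DifferentiableAt ℝ ρ q) (h : ∀ᶠ x in 𝓝 q, R (x, star x) = ρ x) (u : Fin n → ℂ) :
    ((fderiv ℝ ρ q u : ℝ) : ℂ) = fderiv ℂ R (q, star q) (u, star u) := by
  have h1 : HasFDerivAt (fun x => ((ρ x : ℝ) : ℂ)) (ofRealCLM.comp (fderiv ℝ ρ q)) q :=
    ofRealCLM.hasFDerivAt.comp q hρ.hasFDerivAt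
  have h2 : HasFDerivAt (fun x => R (conjDiagonal n x))
      (((fderiv ℂ R (q, star q)).restrictScalars ℝ).comp (conjDiagonal n)) q :=
    (hR.hasFDerivAt.restrictScalars ℝ).comp q (conjDiagonal n).hasFDerivAt
  have h3 := h1.unique (h2.congr_of_eventuallyEq (h.mono fun x hx => hx.symm))
  simpa [conjDiagonal_apply] using DFunLike.congr_fun h3 u

theorem ofReal_fderiv_fderiv_eq_of_polarization (hR : AnalyticAt ℂ R (q, star q))
    (hρ : AnalyticAt ℝ ρ q) (h : ∀ᶠ x in 𝓝 q, R (x, star x) = ρ x) (u v : Fin n → ℂ) :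
    ((fderiv ℝ (fderiv ℝ ρ) q u v : ℝ) : ℂ) =
      fderiv ℂ (fderiv ℂ R) (q, star q) (u, star u) (v, star v) := by
  have hδ : Tendsto (fun x : Fin n → ℂ => (x, star x)) (𝓝 q) (𝓝 (q, star q)) :=
    (conjDiagonal n).continuous.tendsto q
  have h0 : ∀ᶠ x in 𝓝 q, ((fderiv ℝ ρ x v : ℝ) : ℂ) =
      fderiv ℂ R (conjDiagonal n x) (v, star v) := by
    filter_upwards [hδ.eventually hR.eventually_analyticAt, hρ.eventually_analyticAt,
      h.eventually_nhds] with x hx1 hx2 hx3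
    exact ofReal_fderiv_eq_of_polarization hx1.differentiableAt hx2.differentiableAt hx3 v
  have h1 : HasFDerivAt (fun x => ((fderiv ℝ ρ x v : ℝ) : ℂ))
      (ofRealCLM.comp ((ContinuousLinearMap.apply ℝ ℝ v).comp (fderiv ℝ (fderiv ℝ ρ) q))) q :=
    ofRealCLM.hasFDerivAt.comp q
      ((ContinuousLinearMap.apply ℝ ℝ v).hasFDerivAt.comp q
        hρ.fderiv.differentiableAt.hasFDerivAt)
  have h2' : HasFDerivAt (fun Z => fderiv ℂ R Z (v, star v))
      ((ContinuousLinearMap.apply ℂ ℂ (v, star v)).comp (fderiv ℂ (fderiv ℂ R) (q, star q)))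
      (q, star q) :=
    (ContinuousLinearMap.apply ℂ ℂ (v, star v)).hasFDerivAt.comp (q, star q)
        hR.fderiv.differentiableAt.hasFDerivAt
  have h2 := (h2'.restrictScalars ℝ).comp q (f := conjDiagonal n) (conjDiagonal n).hasFDerivAt
  have h3 := h1.unique (h2.congr_of_eventuallyEq h0)
  simpa [conjDiagonal_apply] using DFunLike.congr_fun h3 u

theorem fderiv_snd_eq_conj_fderiv_fst (hR : DifferentiableAt ℂ R (q, star q))
    (hρ : DifferentiableAt ℝ ρ q) (h : ∀ᶠ x in 𝓝 q, R (x, star x) = ρ x) (u : Fin n → ℂ) :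
    fderiv ℂ R (q, star q) (0, star u) = conj (fderiv ℂ R (q, star q) (u, 0)) := by
  set A := fderiv ℂ R (q, star q)
  have hsum : ∀ a b : Fin n → ℂ, A (a, b) = A (a, 0) + A (0, b) := fun a b => by
    rw [← map_add]; simp
  have h1 := ofReal_fderiv_eq_of_polarization hR hρ h u
  have h2 := ofReal_fderiv_eq_of_polarization hR hρ h (I • u)
  have e1 : A (I • u, 0) = I * A (u, 0) := by
    rw [← smul_eq_mul, ← map_smul]; simp
  have e2 : A (0, star (I • u)) = -I * A (0, star u) := by
    rw [← smul_eq_mul, ← map_smul]; simp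
  change _ = A _ at h1 h2
  rw [hsum] at h1
  rw [hsum, e1, e2] at h2
  have i1 := congrArg Complex.im h1
  have i2 := congrArg Complex.im h2
  simp at i1 i2
  apply Complex.ext
  · simp; linarith
  · simp; linarith

/-- The Levi condition at a point of a hypersurface, in polarized form. -/
theorem mixed_fderiv_eq_zero_of_leviForm_eq_zero (hR : AnalyticAt ℂ R (q, star q))
    (hρ : AnalyticAt ℝ ρ q) (h : ∀ᶠ x in 𝓝 q, R (x, star x) = ρ x)
    (hL : ∀ w, IsComplexTangent ρ q w → leviForm ρ q w = 0) {u v : Fin n → ℂ}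
    (hu : fderiv ℂ R (q, star q) (u, 0) = 0) (hv : fderiv ℂ R (q, star q) (0, v) = 0) :
    fderiv ℂ (fderiv ℂ R) (q, star q) (u, 0) (0, v) = 0 := by
  set B := fderiv ℂ (fderiv ℂ R) (q, star q) with hB
  have hsymm : ∀ a b, B a b = B b a := by
    have : IsSymmSndFDerivAt ℂ R (q, star q) :=
      (hR.contDiffAt (n := 2)).isSymmSndFDerivAt (by simp)
    exact fun a b => this a b
  have hdiag : ∀ w, fderiv ℂ R (q, star q) (w, 0) = 0 → B (w, 0) (0, star w) = 0 := by
    intro w hw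
    have hw' := fderiv_snd_eq_conj_fderiv_fst hR.differentiableAt hρ.differentiableAt h w
    rw [hw, map_zero] at hw'
    have hT : IsComplexTangent ρ q w := by
      constructor
      · have := ofReal_fderiv_eq_of_polarization hR.differentiableAt hρ.differentiableAt h w
        rw [show (w, star w) = (w, 0) + ((0, star w) : (Fin n → ℂ) × (Fin n → ℂ)) by simp,
          map_add, hw, hw', add_zero] at this
        exact_mod_cast this
      · have := ofReal_fderiv_eq_of_polarization hR.differentiableAt hρ.differentiableAt h
          (I • w)
        rw [show (I • w, star (I • w)) =
            I • (w, 0) - I • ((0, star w) : (Fin n → ℂ) × (Fin n → ℂ)) by simp,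
          map_sub, map_smul (fderiv ℂ R (q, star q)), map_smul (fderiv ℂ R (q, star q)), hw,
          hw'] at this
        exact_mod_cast (by simpa using this)
    have hl := hL w hT
    have hl' : ((leviForm ρ q w : ℝ) : ℂ) = 4 * B (w, 0) (0, star w) := by
      rw [leviForm, iteratedFDeriv_two_apply, iteratedFDeriv_two_apply]
      push_cast
      rw [ofReal_fderiv_fderiv_eq_of_polarization hR hρ h,
        ofReal_fderiv_fderiv_eq_of_polarization hR hρ h, ← hB,
        show (w, star w) = (w, 0) + ((0, star w) : (Fin n → ℂ) × (Fin n → ℂ)) by simp,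
        show (I • w, star (I • w)) =
            I • (w, 0) - I • ((0, star w) : (Fin n → ℂ) × (Fin n → ℂ)) by simp]
      simp only [map_add, map_sub, map_smul, add_apply, sub_apply, smul_apply, smul_eq_mul]
      rw [hsymm (0, star w) (w, 0)]
      linear_combination (B (w, 0) (w, 0) + B (0, star w) (0, star w) -
        2 * B (w, 0) (0, star w)) * Complex.I_sq
    rw [hl] at hl'
    simpa using hl'.symm
  set v' := star v with hv'def
  have hvv : v = star v' := by simp [hv'def]
  have hv' : fderiv ℂ R (q, star q) (v', 0) = 0 := by
    have := fderiv_snd_eq_conj_fderiv_fst hR.differentiableAt hρ.differentiableAt h v'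
    rw [← hvv, hv] at this
    simpa using this.symm
  have h0 := hdiag u hu
  have h1 := hdiag v' hv'
  have h2 := hdiag (u + v') (by
    rw [show (u + v', 0) = (u, 0) + ((v', 0) : (Fin n → ℂ) × (Fin n → ℂ)) by simp, map_add, hu,
      hv', add_zero])
  have h3 := hdiag (u + I • v') (by
    rw [show (u + I • v', 0) = (u, 0) + I • ((v', 0) : (Fin n → ℂ) × (Fin n → ℂ)) by simp,
      map_add, map_smul, hu, hv', smul_zero, add_zero])
  rw [show (u + v', 0) = (u, 0) + ((v', 0) : (Fin n → ℂ) × (Fin n → ℂ)) by simp,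
    show (0, star (u + v')) = (0, star u) + ((0, star v') : (Fin n → ℂ) × (Fin n → ℂ))
      by simp] at h2
  rw [show (u + I • v', 0) = (u, 0) + I • ((v', 0) : (Fin n → ℂ) × (Fin n → ℂ)) by simp,
    show (0, star (u + I • v')) =
      (0, star u) - I • ((0, star v') : (Fin n → ℂ) × (Fin n → ℂ))
      by simp [sub_eq_add_neg]] at h3
  simp only [map_add, map_sub, map_smul, add_apply, smul_apply, smul_eq_mul, h0, h1] at h2 h3
  rw [hvv]
  have h4 : (2 * I) * B (u, 0) (0, star v') = 0 := by
    linear_combination I * h2 - h3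
  simpa using h4

end Levi

section Segre

variable {n : ℕ} {ρ : (Fin n → ℂ) → ℝ} {R : (Fin n → ℂ) × (Fin n → ℂ) → ℂ} {p e : Fin n → ℂ}

theorem tendsto_add_smul_nhds {X : Type*} [NormedAddCommGroup X] [NormedSpace ℂ X] {τ : X → ℂ}
    {x₀ : X} (D : X) (hτ : ContinuousAt τ x₀) (h0 : τ x₀ = 0) :
    Tendsto (fun x => x + τ x • D) (𝓝 x₀) (𝓝 x₀) := by
  have h : ContinuousAt (fun x => x + τ x • D) x₀ := by fun_prop
  simpa [ContinuousAt, h0] using h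

theorem ContDiffAt.eventually_differentiableAt_one {X : Type*} [NormedAddCommGroup X]
    [NormedSpace ℂ X] {τ : X → ℂ} {x₀ : X} (hτ : ContDiffAt ℂ 1 τ x₀) :
    ∀ᶠ x in 𝓝 x₀, DifferentiableAt ℂ τ x :=
  (hτ.eventually (by simp)).mono fun _ hx => hx.differentiableAt one_ne_zero

theorem tendsto_conjDiagonal (p : Fin n → ℂ) :
    Tendsto (fun x : Fin n → ℂ => (x, star x)) (𝓝 p) (𝓝 (p, star p)) :=
  (conjDiagonal n).continuous.tendsto p

/-- Points near a real hypersurface can be moved onto it along a real transverse direction, in a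
way that extends holomorphically. -/
theorem exists_real_implicit_along (hR : AnalyticAt ℂ R (p, star p)) (h0 : R (p, star p) = 0)
    (hσ : ∀ z w, R (star w, star z) = conj (R (z, w)))
    (he : fderiv ℂ R (p, star p) (e, star e) = 1) :
    ∃ τ : (Fin n → ℂ) × (Fin n → ℂ) → ℂ, τ (p, star p) = 0 ∧ ContDiffAt ℂ 1 τ (p, star p) ∧
      (∀ᶠ Z in 𝓝 (p, star p), R (Z + τ Z • (e, star e)) = 0) ∧
      (∀ᶠ Z in 𝓝 (p, star p), R Z = 0 → τ Z = 0) ∧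
      ∀ᶠ z in 𝓝 p, ∃ t : ℝ, τ (z, star z) = t := by
  obtain ⟨τ, hτ0, hτc, -, hτR, hτu⟩ := hR.exists_implicit_along h0 he
  have hδ := tendsto_conjDiagonal p
  refine ⟨τ, hτ0, hτc, hτR, ?_, ?_⟩
  · have ht : Tendsto (fun Z => (Z, (0 : ℂ))) (𝓝 (p, star p)) (𝓝 ((p, star p), (0 : ℂ))) :=
      Continuous.tendsto' (by fun_prop) _ _ rfl
    filter_upwards [ht.eventually hτu] with Z hZ hZ0
    exact (hZ (by simpa using hZ0)).symm
  · have ht : Tendsto (fun z : Fin n → ℂ => ((z, star z), conj (τ (z, star z)))) (𝓝 p)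
        (𝓝 ((p, star p), (0 : ℂ))) := by
      refine hδ.prodMk_nhds ?_
      have := (Complex.continuous_conj.tendsto _).comp (hτc.continuousAt.tendsto.comp hδ)
      rw [hτ0, map_zero] at this
      exact this
    filter_upwards [ht.eventually hτu, hδ.eventually hτR] with z hz1 hz2
    have h1 := hσ (z + τ (z, star z) • e) (star z + τ (z, star z) • star e)
    have h2 : R (z + τ (z, star z) • e, star z + τ (z, star z) • star e) = 0 := by
      simpa using hz2
    rw [h2, map_zero] at h1
    have h3 := hz1 (by simpa using h1)
    exact (Complex.conj_eq_iff_real.1 h3)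

/-- The Levi condition propagates from a hypersurface to its complexification. -/
theorem eventually_mixed_fderiv_eq_zero (hR : AnalyticAt ℂ R (p, star p))
    (hρ : AnalyticAt ℝ ρ p) (hRρ : ∀ᶠ x in 𝓝 p, R (x, star x) = ρ x)
    (hσ : ∀ z w, R (star w, star z) = conj (R (z, w))) (hp : R (p, star p) = 0)
    (he : fderiv ℂ R (p, star p) (e, 0) = 1) (he' : fderiv ℂ R (p, star p) (0, star e) = 1)
    (hL : ∀ᶠ q in 𝓝 p, ρ q = 0 → ∀ w, IsComplexTangent ρ q w → leviForm ρ q w = 0) :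
    ∀ᶠ Z in 𝓝 (p, star p), R Z = 0 → ∀ u v, fderiv ℂ R Z (u, 0) = 0 →
      fderiv ℂ R Z (0, v) = 0 → fderiv ℂ (fderiv ℂ R) Z (u, 0) (0, v) = 0 := by
  set d : Fin n → ℂ := (2⁻¹ : ℂ) • e with hd
  have hdd : fderiv ℂ R (p, star p) (d, star d) = 1 := by
    rw [show (d, star d) = (2⁻¹ : ℂ) • ((e, 0) + ((0, star e) : (Fin n → ℂ) × (Fin n → ℂ))) by
      simp [hd], map_smul, map_add, he, he']
    norm_num
  obtain ⟨τ, hτ0, hτc, hτR, hτu, hτr⟩ := exists_real_implicit_along hR hp hσ hdd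
  have hδ := tendsto_conjDiagonal p
  have hm := tendsto_add_smul_nhds (d, star d) hτc.continuousAt hτ0
  have hR'c : ContinuousAt (fderiv ℂ R) (p, star p) := hR.fderiv.continuousAt
  have hne : ∀ᶠ Z in 𝓝 (p, star p), fderiv ℂ R Z (e, 0) ≠ 0 := by
    have : ContinuousAt (fun Z => fderiv ℂ R Z (e, 0)) (p, star p) := by fun_prop
    exact this.eventually_ne (by simp [he])
  have hne' : ∀ᶠ Z in 𝓝 (p, star p), fderiv ℂ R Z (0, star e) ≠ 0 := by
    have : ContinuousAt (fun Z => fderiv ℂ R Z (0, star e)) (p, star p) := by fun_prop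
    exact this.eventually_ne (by simp [he'])
  have hgood : ∀ᶠ q in 𝓝 p, AnalyticAt ℝ ρ q ∧ (∀ᶠ x in 𝓝 q, R (x, star x) = ρ x) ∧
      (ρ q = 0 → ∀ w, IsComplexTangent ρ q w → leviForm ρ q w = 0) :=
    hρ.eventually_analyticAt.and (hRρ.eventually_nhds.and hL)
  have hmv : Tendsto (fun z : Fin n → ℂ => z + τ (z, star z) • d) (𝓝 p) (𝓝 p) :=
    (continuous_fst.tendsto _).comp (hm.comp hδ)
  obtain ⟨r₁, hr₁, H₁⟩ := Metric.eventually_nhds_iff_ball.1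
    ((hm.eventually hR.eventually_analyticAt).and
      (hτc.eventually_differentiableAt_one.and (hτR.and (hτu.and (hne.and hne')))))
  obtain ⟨r₂, hr₂, H₂⟩ := Metric.eventually_nhds_iff_ball.1
    ((hmv.eventually hgood).and (hτr.and (hδ.eventually (Metric.ball_mem_nhds _ hr₁))))
  set r := min r₁ r₂ with hr
  refine Metric.eventually_nhds_iff_ball.2 ⟨r, lt_min hr₁ hr₂, fun Z hZ hZ0 u v hu hv => ?_⟩
  let K : (Fin n → ℂ) × (Fin n → ℂ) → ℂ := fun W =>
    fderiv ℂ (fderiv ℂ R) W (fderiv ℂ R W (e, 0) • (u, 0) - fderiv ℂ R W (u, 0) • (e, 0))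
      (fderiv ℂ R W (0, star e) • (0, v) - fderiv ℂ R W (0, v) • (0, star e))
  have hK : ∀ W, AnalyticAt ℂ R W → DifferentiableAt ℂ K W := by
    intro W hW
    have h1 := hW.fderiv.differentiableAt
    have h2 := hW.fderiv.fderiv.differentiableAt
    simp only [K]
    fun_prop
  have hKm : DifferentiableOn ℂ (fun Z => K (Z + τ Z • (d, star d)))
      (Metric.ball (p, star p) r) := by
    intro W hW
    have hW1 := H₁ W (Metric.ball_subset_ball (min_le_left _ _) hW)
    have hτd := hW1.2.1
    exact ((hK _ hW1.1).comp W (f := fun Z => Z + τ Z • (d, star d))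
      (by fun_prop)).differentiableWithinAt
  have hzero := eqOn_zero_of_eq_zero_on_conj_diagonal hKm (fun z hz => by
    obtain ⟨⟨hz1, hz2, hz3⟩, ⟨t, ht⟩, hz4⟩ :=
      H₂ z (Metric.ball_subset_ball (min_le_right _ _) hz)
    obtain ⟨hW1, -, hW2, -⟩ := H₁ _ hz4
    rw [ht] at hz1 hz2 hz3
    rw [ht] at hW1 hW2
    rw [ht]
    set q := z + (t : ℂ) • d with hq
    have hqs : (z, star z) + (t : ℂ) • (d, star d) = (q, star q) := by
      simp [hq]
    rw [hqs] at hW1 hW2 ⊢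
    have hρq : ρ q = 0 := by
      have := hz2.self_of_nhds
      rw [hW2] at this
      exact_mod_cast this.symm
    have hmix := fun a b => mixed_fderiv_eq_zero_of_leviForm_eq_zero hW1 hz1 hz2 (hz3 hρq)
      (u := a) (v := b)
    set A := fderiv ℂ R (q, star q) with hA
    have e1 : A (e, 0) • ((u, 0) : (Fin n → ℂ) × (Fin n → ℂ)) - A (u, 0) • (e, 0) =
      (A (e, 0) • u - A (u, 0) • e, 0) := by simp
    have e2 : A (0, star e) • ((0, v) : (Fin n → ℂ) × (Fin n → ℂ)) - A (0, v) • (0, star e) =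
      (0, A (0, star e) • v - A (0, v) • star e) := by simp
    simp only [K, ← hA, e1, e2]
    apply hmix
    · rw [← e1, map_sub, map_smul, map_smul, smul_eq_mul, smul_eq_mul, mul_comm, sub_self]
    · rw [← e2, map_sub, map_smul, map_smul, smul_eq_mul, smul_eq_mul, mul_comm, sub_self])
  have hZ1 := H₁ Z (Metric.ball_subset_ball (min_le_left _ _) hZ)
  have hZK := hzero Z hZ
  rw [hZ1.2.2.2.1 hZ0, zero_smul, add_zero] at hZK
  simp only [K, hu, hv, zero_smul, sub_zero, map_smul, smul_apply, smul_eq_mul] at hZK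
  simpa [hZ1.2.2.2.2.1, hZ1.2.2.2.2.2] using hZK

end Segre

section Proportional

variable {n : ℕ} {R : (Fin n → ℂ) × (Fin n → ℂ) → ℂ} {p q e e' : Fin n → ℂ}

/-- When the mixed second derivatives of `R` vanish on the kernels of its partial derivatives, the
partial derivative in the second variable is constant up to proportionality along the
complex hypersurfaces `{z | R (z, w) = 0}`. -/
theorem exists_ball_fderiv_snd_proportional (hR : AnalyticAt ℂ R (p, q)) (hp : R (p, q) = 0)
    (he : fderiv ℂ R (p, q) (e, 0) = 1) (he' : fderiv ℂ R (p, q) (0, e') = 1)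
    (hmix : ∀ᶠ Z in 𝓝 (p, q), R Z = 0 → ∀ u v, fderiv ℂ R Z (u, 0) = 0 →
      fderiv ℂ R Z (0, v) = 0 → fderiv ℂ (fderiv ℂ R) Z (u, 0) (0, v) = 0) :
    ∃ r > 0, ∀ z₁ ∈ Metric.ball p r, ∀ z₂ ∈ Metric.ball p r, ∀ w ∈ Metric.ball q r,
      R (z₁, w) = 0 → R (z₂, w) = 0 → ∀ v,
        fderiv ℂ R (z₁, w) (0, v) * fderiv ℂ R (z₂, w) (0, e') =
          fderiv ℂ R (z₂, w) (0, v) * fderiv ℂ R (z₁, w) (0, e') := by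
  obtain ⟨τ, hτ0, hτc, -, hτR, hτu⟩ := hR.exists_implicit_along hp he
  have hm := tendsto_add_smul_nhds (e, (0 : Fin n → ℂ)) hτc.continuousAt hτ0
  have hR'c : ContinuousAt (fderiv ℂ R) (p, q) := hR.fderiv.continuousAt
  have hne' : ∀ᶠ Z in 𝓝 (p, q), fderiv ℂ R Z (0, e') ≠ 0 := by
    have : ContinuousAt (fun Z => fderiv ℂ R Z (0, e')) (p, q) := by fun_prop
    exact this.eventually_ne (by simp [he'])
  have ht : Tendsto (fun Z => (Z, (0 : ℂ))) (𝓝 (p, q)) (𝓝 ((p, q), (0 : ℂ))) :=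
    Continuous.tendsto' (by fun_prop) _ _ rfl
  obtain ⟨r, hr, H⟩ := Metric.eventually_nhds_iff_ball.1
    ((hm.eventually (hR.eventually_analyticAt.and (hne'.and hmix))).and
      (hτc.eventually_differentiableAt_one.and (hτR.and (ht.eventually hτu))))
  refine ⟨r, hr, fun z₁ hz₁ z₂ hz₂ w hw h₁ h₂ v => ?_⟩
  have hmem : ∀ z ∈ Metric.ball p r, (z, w) ∈ Metric.ball (p, q) r := fun z hz => by
    rw [← ball_prod_same]; exact ⟨hz, hw⟩
  have hpt : ∀ z, (z, w) + τ (z, w) • (e, (0 : Fin n → ℂ)) = (z + τ (z, w) • e, w) := by simp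
  have hτz : ∀ z ∈ Metric.ball p r, R (z, w) = 0 → τ (z, w) = 0 := fun z hz h =>
    ((H _ (hmem z hz)).2.2.2 (by simpa using h)).symm
  have hleft : ∀ z, HasFDerivAt (fun z : Fin n → ℂ => (z, w)) (ContinuousLinearMap.inl ℂ _ _) z :=
    fun z => hasFDerivAt_prodMk_left z w
  have hF : ∀ z, AnalyticAt ℂ R (z, w) → ∀ b, HasFDerivAt (fun z => fderiv ℂ R (z, w) b)
      (((fderiv ℂ (fderiv ℂ R) (z, w)).flip b).comp (ContinuousLinearMap.inl ℂ _ _)) z := by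
    intro z hz b
    have h := (hz.fderiv.differentiableAt.hasFDerivAt.comp z (hleft z)).clm_apply
      (hasFDerivAt_const b z)
    refine h.congr_fderiv ?_
    ext u
    simp
  have hg : ∀ z, AnalyticAt ℂ R (z, w) → fderiv ℂ R (z, w) (0, e') ≠ 0 →
      HasFDerivAt (fun z => fderiv ℂ R (z, w) (0, v) * (fderiv ℂ R (z, w) (0, e'))⁻¹) _ z :=
    fun z hz hz' => (hF z hz (0, v)).fun_mul
      ((hasDerivAt_inv hz').comp_hasFDerivAt z (hF z hz (0, e')))
  have key := eq_of_fderiv_eq_zero_along (S := Metric.ball p r) Metric.isOpen_ball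
    (convex_ball p r).isPreconnected (R := fun z => R (z, w))
    (g := fun z => fderiv ℂ R (z, w) (0, v) * (fderiv ℂ R (z, w) (0, e'))⁻¹)
    (τ := fun z => τ (z, w)) (D := e)
    (fun z hz => (H _ (hmem z hz)).2.1.comp z (hleft z).differentiableAt)
    (fun z hz => by simpa [hpt] using (H _ (hmem z hz)).2.2.1)
    (fun z hz => by
      have := (H _ (hmem z hz)).1.1
      rw [hpt] at this
      exact this.differentiableAt.comp (z + τ (z, w) • e) (hleft _).differentiableAt)
    (fun z hz => by
      have := (H _ (hmem z hz)).1
      rw [hpt] at this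
      exact (hg _ this.1 this.2.1).differentiableAt)
    (fun z hz u hu => by
      obtain ⟨⟨h1, h2, h3⟩, -, h4, -⟩ := H _ (hmem z hz)
      rw [hpt] at h1 h2 h3 h4
      set x := z + τ (z, w) • e with hx
      have hu' : fderiv ℂ R (x, w) (u, 0) = 0 := by
        rw [← hu, HasFDerivAt.fderiv (f := fun z => R (z, w))
          (h1.differentiableAt.hasFDerivAt.comp x (hleft x))]
        simp
      have hsplit : ((0 : Fin n → ℂ),
          fderiv ℂ R (x, w) (0, e') • v - fderiv ℂ R (x, w) (0, v) • e') =
          fderiv ℂ R (x, w) (0, e') • ((0 : Fin n → ℂ), v) -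
            fderiv ℂ R (x, w) (0, v) • ((0 : Fin n → ℂ), e') := by simp
      have h5 := h3 h4 u (fderiv ℂ R (x, w) (0, e') • v - fderiv ℂ R (x, w) (0, v) • e') hu' (by
        rw [hsplit, map_sub, map_smul, map_smul, smul_eq_mul, smul_eq_mul, mul_comm, sub_self])
      rw [(hg x h1 h2).fderiv]
      rw [hsplit, map_sub, map_smul, map_smul, smul_eq_mul, smul_eq_mul] at h5
      simp
      field_simp
      linear_combination h5)
    hz₁ hz₂
  have hne : ∀ z ∈ Metric.ball p r, R (z, w) = 0 → fderiv ℂ R (z, w) (0, e') ≠ 0 := by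
    intro z hz h
    have := (H _ (hmem z hz)).1.2.1
    rwa [hτz z hz h, zero_smul, add_zero] at this
  simp only [hτz z₁ hz₁ h₁, hτz z₂ hz₂ h₂, zero_smul, add_zero] at key
  rwa [← div_eq_mul_inv, ← div_eq_mul_inv, div_eq_div_iff (hne _ hz₁ h₁) (hne _ hz₂ h₂)] at key

end Proportional

section FirstIntegral

variable {n : ℕ} {R : (Fin n → ℂ) × (Fin n → ℂ) → ℂ} {p q e e' : Fin n → ℂ}

/-- When the mixed second derivatives of `R` vanish on the kernels of its partial derivatives, the
parameter at which `{z | R (z, w) = 0}` meets the complex line `p + ℂ e` only depends on the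
hypersurface, not on `w`. -/
theorem exists_ball_implicit_eq (hR : AnalyticAt ℂ R (p, q)) (hp : R (p, q) = 0)
    (he : fderiv ℂ R (p, q) (e, 0) = 1) (he' : fderiv ℂ R (p, q) (0, e') = 1)
    (hmix : ∀ᶠ Z in 𝓝 (p, q), R Z = 0 → ∀ u v, fderiv ℂ R Z (u, 0) = 0 →
      fderiv ℂ R Z (0, v) = 0 → fderiv ℂ (fderiv ℂ R) Z (u, 0) (0, v) = 0)
    {τ : (Fin n → ℂ) × (Fin n → ℂ) → ℂ} (hτ0 : τ (p, q) = 0) (hτc : ContDiffAt ℂ 1 τ (p, q))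
    (hτR : ∀ᶠ Z in 𝓝 (p, q), R (Z + τ Z • (e, 0)) = 0) :
    ∃ r > 0, ∀ z ∈ Metric.ball p r, ∀ w₁ ∈ Metric.ball q r, ∀ w₂ ∈ Metric.ball q r,
      R (z, w₁) = 0 → R (z, w₂) = 0 → τ (p, w₁) = τ (p, w₂) := by
  obtain ⟨r₀, hr₀, hprop⟩ := exists_ball_fderiv_snd_proportional hR hp he he' hmix
  obtain ⟨σ, hσ0, hσc, -, hσR, hσu⟩ := hR.exists_implicit_along hp he'
  have hm₁ := tendsto_add_smul_nhds (e, (0 : Fin n → ℂ)) hτc.continuousAt hτ0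
  have hm₂ := tendsto_add_smul_nhds ((0 : Fin n → ℂ), e') hσc.continuousAt hσ0
  have hR'c : ContinuousAt (fderiv ℂ R) (p, q) := hR.fderiv.continuousAt
  have hne : ∀ᶠ Z in 𝓝 (p, q), fderiv ℂ R Z (e, 0) ≠ 0 := by
    have : ContinuousAt (fun Z => fderiv ℂ R Z (e, 0)) (p, q) := by fun_prop
    exact this.eventually_ne (by simp [he])
  have hne' : ∀ᶠ Z in 𝓝 (p, q), fderiv ℂ R Z (0, e') ≠ 0 := by
    have : ContinuousAt (fun Z => fderiv ℂ R Z (0, e')) (p, q) := by fun_prop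
    exact this.eventually_ne (by simp [he'])
  have ht : Tendsto (fun Z => (Z, (0 : ℂ))) (𝓝 (p, q)) (𝓝 ((p, q), (0 : ℂ))) :=
    Continuous.tendsto' (by fun_prop) _ _ rfl
  have hps : Tendsto (fun Z : (Fin n → ℂ) × (Fin n → ℂ) => (p, Z.2)) (𝓝 (p, q)) (𝓝 (p, q)) :=
    Continuous.tendsto' (by fun_prop) _ _ rfl
  have hball := Metric.ball_mem_nhds (p, q) hr₀
  have hτgood := hτc.eventually_differentiableAt_one.and
    (hτR.eventually_nhds.and (hm₁.eventually (hR.eventually_analyticAt.and (hne.and hball))))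
  obtain ⟨r, hr, H⟩ := Metric.eventually_nhds_iff_ball.1
    ((hm₂.eventually ((hps.eventually hτgood).and
      (hR.eventually_analyticAt.and (hne'.and hball)))).and
      (hσc.eventually_differentiableAt_one.and (hσR.and (ht.eventually hσu))))
  refine ⟨r, hr, fun z hz w₁ hw₁ w₂ hw₂ h₁ h₂ => ?_⟩
  have hmem : ∀ w ∈ Metric.ball q r, (z, w) ∈ Metric.ball (p, q) r := fun w hw => by
    rw [← ball_prod_same]; exact ⟨hz, hw⟩
  have hpt : ∀ w, (z, w) + σ (z, w) • ((0 : Fin n → ℂ), e') = (z, w + σ (z, w) • e') := by simp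
  have hσz : ∀ w ∈ Metric.ball q r, R (z, w) = 0 → σ (z, w) = 0 := fun w hw h =>
    ((H _ (hmem w hw)).2.2.2 (by simpa using h)).symm
  have hright : ∀ x w, HasFDerivAt (fun w : Fin n → ℂ => ((x : Fin n → ℂ), w))
      (ContinuousLinearMap.inr ℂ _ _) w := fun x w => hasFDerivAt_prodMk_right x w
  have key := eq_of_fderiv_eq_zero_along (S := Metric.ball q r) Metric.isOpen_ball
    (convex_ball q r).isPreconnected (R := fun w => R (z, w))
    (g := fun w => τ (p, w)) (τ := fun w => σ (z, w)) (D := e')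
    (fun w hw => (H _ (hmem w hw)).2.1.comp w (hright z w).differentiableAt)
    (fun w hw => by simpa [hpt] using (H _ (hmem w hw)).2.2.1)
    (fun w hw => by
      have := (H _ (hmem w hw)).1.2.1
      rw [hpt] at this
      exact this.differentiableAt.comp (w + σ (z, w) • e') (hright z _).differentiableAt)
    (fun w hw => by
      have := (H _ (hmem w hw)).1.1.1
      rw [hpt] at this
      exact this.comp (w + σ (z, w) • e') (hright p _).differentiableAt)
    (fun w hw v hv => by
      obtain ⟨⟨⟨hτd, hτ0', hA, hAe, hAb⟩, hB, hBe, hBb⟩, -, hB0, -⟩ := H _ (hmem w hw)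
      rw [hpt] at hτd hτ0' hA hAe hAb hB hBe hBb hB0
      simp only at hτd hτ0' hA hAe hAb
      set y := w + σ (z, w) • e' with hy
      have hA0 := hτ0'.self_of_nhds
      have hv' : fderiv ℂ R (z, y) (0, v) = 0 := by
        rw [← hv, HasFDerivAt.fderiv (f := fun w => R (z, w))
          (hB.differentiableAt.hasFDerivAt.comp y (hright z y))]
        simp
      have hchain := fderiv_add_fderiv_smul_eq_zero hτd hA.differentiableAt hτ0' (0, v)
      have hpt' : (p, y) + τ (p, y) • (e, (0 : Fin n → ℂ)) = (p + τ (p, y) • e, y) := by simp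
      rw [hpt'] at hchain hA0 hAe hAb
      rw [← Metric.mem_ball, ← ball_prod_same] at hAb hBb
      have hpr := hprop _ hBb.1 _ hAb.1 y hBb.2 hB0 hA0 v
      rw [hv', zero_mul, eq_comm, mul_eq_zero, or_iff_left hBe] at hpr
      rw [map_add, hpr, zero_add, map_smul, smul_eq_mul, mul_eq_zero, or_iff_left hAe] at hchain
      rw [HasFDerivAt.fderiv (f := fun w => τ (p, w)) (hτd.hasFDerivAt.comp y (hright p y))]
      simpa using hchain)
    hw₁ hw₂
  simpa [hσz w₁ hw₁ h₁, hσz w₂ hw₂ h₂] using key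

end FirstIntegral

section DefiningFunction

variable {n : ℕ} {ρ : (Fin n → ℂ) → ℝ} {R : (Fin n → ℂ) × (Fin n → ℂ) → ℂ} {p e : Fin n → ℂ}

/-- If the real part of a holomorphic function vanishes on a hypersurface to which its
differential is transverse, then the hypersurface is locally the zero set of this real part. -/
theorem eventually_re_eq_zero_iff (hR : AnalyticAt ℂ R (p, star p))
    (hRρ : ∀ᶠ x in 𝓝 p, R (x, star x) = ρ x) (hσ : ∀ z w, R (star w, star z) = conj (R (z, w)))
    (hp : R (p, star p) = 0) (he : fderiv ℂ R (p, star p) (e, star e) = 1)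
    {G : (Fin n → ℂ) → ℂ} (hG : ContDiffAt ℂ 1 G p) (hGe : fderiv ℂ G p e = 1)
    (h0 : ∀ᶠ z in 𝓝 p, ρ z = 0 → (G z).re = 0) :
    ∀ᶠ z in 𝓝 p, ((G z).re = 0 ↔ ρ z = 0) := by
  obtain ⟨τ, hτ0, hτc, hτR, -, hτr⟩ := exists_real_implicit_along hR hp hσ he
  have hδ := tendsto_conjDiagonal p
  have hm := tendsto_add_smul_nhds (e, star e) hτc.continuousAt hτ0
  have hmv : Tendsto (fun z : Fin n → ℂ => z + τ (z, star z) • e) (𝓝 p) (𝓝 p) :=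
    (continuous_fst.tendsto _).comp (hm.comp hδ)
  have hc : (0 : ℝ) < (2 * (‖e‖ + 1))⁻¹ := by positivity
  have hstrict := ((hG.hasStrictFDerivAt one_ne_zero).isLittleO.bound hc)
  have hpair : Tendsto (fun z : Fin n → ℂ => (z + τ (z, star z) • e, z)) (𝓝 p) (𝓝 (p, p)) :=
    hmv.prodMk_nhds tendsto_id
  filter_upwards [h0, hRρ, hmv.eventually (h0.and hRρ), hδ.eventually hτR, hτr,
    hpair.eventually hstrict] with z hz0 hzR hz' hzτ hzr hzs
  refine ⟨fun hG0 => ?_, hz0⟩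
  obtain ⟨t, ht⟩ := hzr
  rw [ht] at hz' hzτ hzs
  have hzt : ρ (z + (t : ℂ) • e) = 0 := by
    have h1 := hz'.2
    have h2 : (z + (t : ℂ) • e, star (z + (t : ℂ) • e)) =
      (z, star z) + (t : ℂ) • (e, star e) := by simp
    rw [h2, hzτ] at h1
    exact_mod_cast h1.symm
  have hre := hz'.1 hzt
  have ht0 : t = 0 := by
    by_contra hne
    simp only [add_sub_cancel_left, map_smul, hGe, norm_smul, Complex.norm_real,
      smul_eq_mul, mul_one] at hzs
    have h1 := (Complex.abs_re_le_norm _).trans hzs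
    simp only [Complex.sub_re, hre, hG0, Complex.ofReal_re, sub_zero, zero_sub, abs_neg,
      Real.norm_eq_abs] at h1
    have h2 : 0 < |t| := abs_pos.2 hne
    have h3 : (2 * (‖e‖ + 1))⁻¹ * ‖e‖ < 1 := by
      rw [inv_mul_lt_one₀ (by positivity)]
      linarith [norm_nonneg e]
    nlinarith
  simpa [ht0] using hzt

/-- A real analytic Levi-flat hypersurface is locally the zero set of the real part of a
holomorphic function without critical points. -/
theorem exists_re_eq_zero_iff_of_polarization (hR : AnalyticAt ℂ R (p, star p))
    (hρ : AnalyticAt ℝ ρ p) (hRρ : ∀ᶠ x in 𝓝 p, R (x, star x) = ρ x)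
    (hσ : ∀ z w, R (star w, star z) = conj (R (z, w))) (hp : R (p, star p) = 0)
    (he : fderiv ℂ R (p, star p) (e, 0) = 1) (he' : fderiv ℂ R (p, star p) (0, star e) = 1)
    (hL : ∀ᶠ q in 𝓝 p, ρ q = 0 → ∀ w, IsComplexTangent ρ q w → leviForm ρ q w = 0) :
    ∃ G : (Fin n → ℂ) → ℂ, ContDiffAt ℂ 1 G p ∧ fderiv ℂ G p ≠ 0 ∧
      ∀ᶠ z in 𝓝 p, ((G z).re = 0 ↔ ρ z = 0) := by
  have hmix := eventually_mixed_fderiv_eq_zero hR hρ hRρ hσ hp he he' hL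
  obtain ⟨τ, hτ0, hτc, hτ', hτR, -⟩ := hR.exists_implicit_along hp he
  obtain ⟨σ, hσ0, hσc, hσ', hσR, hσu⟩ := hR.exists_implicit_along hp he'
  obtain ⟨r, hr, hfirst⟩ := exists_ball_implicit_eq hR hp he he' hmix hτ0 hτc hτR
  set A := fderiv ℂ R (p, star p) with hA
  set l : (Fin n → ℂ) → ℂ := fun w => τ (p, w) with hl
  set l' : (Fin n → ℂ) → ℂ := fun z => σ (z, star p) with hl'
  have hlc : ContDiffAt ℂ 1 l (star p) := hτc.comp (star p) (by fun_prop)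
  have hlc' : ContDiffAt ℂ 1 l' p := hσc.comp p (by fun_prop)
  have hld : HasFDerivAt l (-A.comp (ContinuousLinearMap.inr ℂ _ _)) (star p) := by
    have h := (hτc.differentiableAt one_ne_zero).hasFDerivAt.comp (star p)
      (hasFDerivAt_prodMk_right p (star p))
    rwa [hτ', ContinuousLinearMap.neg_comp] at h
  have hld' : HasFDerivAt l' (-A.comp (ContinuousLinearMap.inl ℂ _ _)) p := by
    have h := HasFDerivAt.comp p (f := fun z => (z, star p))
      (hσc.differentiableAt one_ne_zero).hasFDerivAt (hasFDerivAt_prodMk_left p (star p))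
    rwa [hσ', ContinuousLinearMap.neg_comp] at h
  have hl0' : l' p = 0 := hσ0
  set s : (Fin n → ℂ) → (Fin n → ℂ) := fun z => star p + l' z • star e with hs
  have hsp : s p = star p := by simp [hs, hl0']
  have hsc : ContDiffAt ℂ 1 s p := by fun_prop
  have hsd := (hld'.smul_const (star e)).const_add (star p)
  have hGd := (HasFDerivAt.comp p (g := l) (f := s) (by rwa [hsp]) hsd).sub hld'
  have hGc : ContDiffAt ℂ 1 (l ∘ s - l') p := (ContDiffAt.comp p (by rwa [hsp]) hsc).sub hlc'
  have hGe : fderiv ℂ (l ∘ s - l') p e = 2 := by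
    have hneg : A (0, -star e) = -1 := by
      rw [← he', ← map_neg, Prod.neg_mk, neg_zero]
    rw [hGd.fderiv]
    simp [he, hneg]
    norm_num
  have hpz : Tendsto (fun z : Fin n → ℂ => (p, star z)) (𝓝 p) (𝓝 (p, star p)) :=
    Continuous.tendsto' (by fun_prop) _ _ rfl
  have hzp : Tendsto (fun z : Fin n → ℂ => (z, star p)) (𝓝 p) (𝓝 (p, star p)) :=
    Continuous.tendsto' (by fun_prop) _ _ rfl
  have hsz : Tendsto (fun z : Fin n → ℂ => star z) (𝓝 p) (𝓝 (star p)) :=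
    Continuous.tendsto' (by fun_prop) _ _ rfl
  have hconj : Tendsto (fun z : Fin n → ℂ => ((z, star p), conj (l (star z)))) (𝓝 p)
      (𝓝 ((p, star p), (0 : ℂ))) := by
    refine hzp.prodMk_nhds ?_
    have := (Complex.continuous_conj.tendsto _).comp (hlc.continuousAt.tendsto.comp hsz)
    rwa [show l (star p) = 0 from hτ0, map_zero] at this
  have hsb : Tendsto s (𝓝 p) (𝓝 (star p)) := by
    simpa only [ContinuousAt, hsp] using hsc.continuousAt
  have hforward : ∀ᶠ z in 𝓝 p, ρ z = 0 → ((l ∘ s - l') z).re = 0 := by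
    filter_upwards [hRρ, hzp.eventually hσR, hpz.eventually hτR, hconj.eventually hσu,
      Metric.ball_mem_nhds p hr, hsz.eventually (Metric.ball_mem_nhds (star p) hr),
      hsb.eventually (Metric.ball_mem_nhds (star p) hr)] with z hz1 hz2 hz3 hz4 hz5 hz6 hz7 hz0
    have h1 : l (star z) = l (s z) := by
      refine hfirst z hz5 _ hz6 _ hz7 (by rw [hz1, hz0, Complex.ofReal_zero]) ?_
      simpa [hs, hl'] using hz2
    have h2 : conj (l (star z)) = l' z := by
      refine hz4 ?_
      have h := hσ (p + l (star z) • e) (star z)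
      have h3 : R (p + l (star z) • e, star z) = 0 := by simpa [hl] using hz3
      rw [h3, map_zero] at h
      simpa using h
    simp [← h1, ← h2]
  refine ⟨l ∘ s - l', hGc, fun h => by simp [h] at hGe, ?_⟩
  refine eventually_re_eq_zero_iff (e := (2⁻¹ : ℂ) • e) hR hRρ hσ hp ?_ hGc ?_ hforward
  · rw [show ((2⁻¹ : ℂ) • e, star ((2⁻¹ : ℂ) • e)) =
        (2⁻¹ : ℂ) • ((e, 0) + ((0, star e) : (Fin n → ℂ) × (Fin n → ℂ))) by simp,
      map_smul, map_add, ← hA, he, he']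
    norm_num
  · rw [map_smul, hGe]
    norm_num

/-- A real analytic Levi-flat hypersurface is locally the zero set of the real part of a
holomorphic function without critical points. -/
theorem exists_re_eq_zero_iff (hρ : AnalyticAt ℝ ρ p) (hp : ρ p = 0) (hd : fderiv ℝ ρ p ≠ 0)
    (hL : ∀ᶠ q in 𝓝 p, ρ q = 0 → ∀ w, IsComplexTangent ρ q w → leviForm ρ q w = 0) :
    ∃ G : (Fin n → ℂ) → ℂ, ContDiffAt ℂ 1 G p ∧ fderiv ℂ G p ≠ 0 ∧
      ∀ᶠ z in 𝓝 p, ((G z).re = 0 ↔ ρ z = 0) := by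
  obtain ⟨R, hR, hRρ, hσ⟩ := hρ.exists_polarization
  have hsnd := fderiv_snd_eq_conj_fderiv_fst hR.differentiableAt hρ.differentiableAt hRρ
  obtain ⟨u, hu⟩ := DFunLike.exists_ne hd
  have hu' : fderiv ℂ R (p, star p) (u, 0) ≠ 0 := by
    intro h
    have h1 := ofReal_fderiv_eq_of_polarization hR.differentiableAt hρ.differentiableAt hRρ u
    rw [show (u, star u) = (u, 0) + ((0, star u) : (Fin n → ℂ) × (Fin n → ℂ)) by simp,
      map_add, hsnd, h, map_zero, add_zero] at h1
    exact hu (by exact_mod_cast h1)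
  have he : fderiv ℂ R (p, star p) ((fderiv ℂ R (p, star p) (u, 0))⁻¹ • u, 0) = 1 := by
    have : ((fderiv ℂ R (p, star p) (u, 0))⁻¹ • u, (0 : Fin n → ℂ)) =
      (fderiv ℂ R (p, star p) (u, 0))⁻¹ • (u, (0 : Fin n → ℂ)) := by simp
    rw [this, map_smul, smul_eq_mul, inv_mul_cancel₀ hu']
  refine exists_re_eq_zero_iff_of_polarization hR hρ hRρ hσ ?_ he ?_ hL
  · rw [hRρ.self_of_nhds, hp, Complex.ofReal_zero]
  · rw [hsnd, he, map_one]

end DefiningFunction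

/-- A holomorphic function without critical point at `p` is, up to a permutation of the
coordinates, a component of a local biholomorphism. -/
theorem exists_openPartialHomeomorph_of_fderiv_ne_zero {n : ℕ} {G : (Fin n → ℂ) → ℂ}
    {p : Fin n → ℂ} (hG : ContDiffAt ℂ 1 G p) (hG' : fderiv ℂ G p ≠ 0) (i : Fin n) :
    ∃ Φ : OpenPartialHomeomorph (Fin n → ℂ) (Fin n → ℂ), p ∈ Φ.source ∧ ContDiffAt ℂ 1 Φ p ∧
      ∀ z, Φ z i = G z := by
  obtain ⟨k, hk⟩ : ∃ k, fderiv ℂ G p (Pi.single k 1) ≠ 0 := by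
    by_contra! h
    refine hG' (ContinuousLinearMap.coe_injective ?_)
    refine LinearMap.pi_ext' fun k => LinearMap.ext_ring ?_
    simpa using h k
  let f : (Fin n → ℂ) → (Fin n → ℂ) := fun z j => if j = i then G z else z (Equiv.swap k i j)
  have hf : ContDiffAt ℂ 1 f p := by
    refine contDiffAt_pi.2 fun j => ?_
    by_cases hj : j = i
    · simpa [f, hj] using hG
    · simp only [f, hj, if_false]
      fun_prop
  have hcoord : ∀ j, HasFDerivAt (fun z => f z j)
      ((ContinuousLinearMap.proj j).comp (fderiv ℂ f p)) p := fun j =>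
    hasFDerivAt_pi'.1 (hf.differentiableAt one_ne_zero).hasFDerivAt j
  have hfi : ∀ u, fderiv ℂ f p u i = fderiv ℂ G p u := fun u => by
    have h1 : (fun z => f z i) = G := by simp [f]
    have h2 := hcoord i
    rw [h1] at h2
    rw [h2.fderiv]
    rfl
  have hfj : ∀ j, j ≠ i → ∀ u, fderiv ℂ f p u j = u (Equiv.swap k i j) := fun j hj u => by
    have h1 : (fun z => f z j) = ContinuousLinearMap.proj (R := ℂ) (φ := fun _ : Fin n => ℂ)
        (Equiv.swap k i j) := by
      ext z; simp [f, hj]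
    have h2 := hcoord j
    rw [h1] at h2
    exact DFunLike.congr_fun (h2.unique (ContinuousLinearMap.hasFDerivAt _)) u
  have hinj : Function.Injective (fderiv ℂ f p) := by
    refine (injective_iff_map_eq_zero _).2 fun u hu => ?_
    have h1 : ∀ j, j ≠ k → u j = 0 := fun j hj => by
      have h2 : Equiv.swap k i j ≠ i := fun h => hj (by
        rw [Equiv.swap_apply_eq_iff, Equiv.swap_apply_right] at h
        exact h)
      have h3 := hfj _ h2 u
      rw [hu, Equiv.swap_apply_self] at h3
      exact h3.symm
    have h2 : u = u k • Pi.single k (1 : ℂ) := by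
      ext j
      by_cases hj : j = k
      · subst hj; simp
      · simp [h1 j hj, hj]
    have h3 := hfi u
    rw [hu, h2, map_smul, smul_eq_mul, Pi.zero_apply, eq_comm, mul_eq_zero, or_iff_left hk] at h3
    rw [h2, h3, zero_smul]
  let L : (Fin n → ℂ) ≃L[ℂ] (Fin n → ℂ) :=
    (LinearEquiv.ofInjectiveEndo (fderiv ℂ f p : (Fin n → ℂ) →ₗ[ℂ] (Fin n → ℂ))
      hinj).toContinuousLinearEquiv
  have hL : HasFDerivAt f (L : (Fin n → ℂ) →L[ℂ] (Fin n → ℂ)) p := by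
    refine (hf.differentiableAt one_ne_zero).hasFDerivAt.congr_fderiv ?_
    ext u : 1
    rfl
  refine ⟨hf.toOpenPartialHomeomorph f hL one_ne_zero,
    hf.mem_toOpenPartialHomeomorph_source hL one_ne_zero, ?_, fun z => ?_⟩
  · rwa [hf.toOpenPartialHomeomorph_coe hL one_ne_zero]
  · rw [hf.toOpenPartialHomeomorph_coe hL one_ne_zero]
    simp [f]

end

/-- Cartan's theorem: a real analytic Levi-flat hypersurface in `ℂⁿ`, `n > 1`, can be
locally flattened to `{Re zₙ = 0}` by a biholomorphic map. -/
theorem analytic_leviFlat_locally_flattened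
    (n : ℕ) (hn : 1 < n) (M : Set (Fin n → ℂ))
    (hM : IsAnalyticLeviFlatHypersurface M) (p : Fin n → ℂ) (hp : p ∈ M) :
    ∃ U : Set (Fin n → ℂ), IsOpen U ∧ p ∈ U ∧
      ∃ f : (Fin n → ℂ) → (Fin n → ℂ),
        DifferentiableOn ℂ f U ∧ Set.InjOn f U ∧ IsOpen (f '' U) ∧
        f '' (M ∩ U) = {z ∈ f '' U | (z ⟨n - 1, by omega⟩).re = 0} := by
  obtain ⟨V, hV, hpV, ρ, hρ, hρ', hMρ, hL⟩ := hM p hp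
  obtain ⟨G, hG, hG', hGρ⟩ := exists_re_eq_zero_iff (hρ p hpV) ((hMρ p hpV).1 hp) (hρ' p hpV)
    (Filter.mem_of_superset (hV.mem_nhds hpV) hL)
  obtain ⟨Φ, hpΦ, hΦ, hΦG⟩ :=
    exists_openPartialHomeomorph_of_fderiv_ne_zero hG hG' ⟨n - 1, by omega⟩
  obtain ⟨U, hU, hUo, hpU⟩ := eventually_nhds_iff.1 ((hV.eventually_mem hpV).and
    (hGρ.and ((hΦ.eventually (by simp)).and (Φ.open_source.eventually_mem hpΦ))))
  have hUs : U ⊆ Φ.source := fun z hz => (hU z hz).2.2.2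
  have hUM : ∀ z ∈ U, z ∈ M ↔ (Φ z ⟨n - 1, by omega⟩).re = 0 := fun z hz => by
    rw [hΦG, (hU z hz).2.1, hMρ z (hU z hz).1]
  refine ⟨U, hUo, hpU, Φ,
    fun z hz => ((hU z hz).2.2.1.differentiableAt one_ne_zero).differentiableWithinAt,
    Φ.injOn.mono hUs,
    Φ.isOpen_image_of_subset_source hUo hUs, ?_⟩
  ext y
  constructor
  · rintro ⟨z, ⟨hzM, hzU⟩, rfl⟩
    exact ⟨⟨z, hzU, rfl⟩, (hUM z hzU).1 hzM⟩
  · rintro ⟨⟨z, hzU, rfl⟩, hz⟩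
    exact ⟨z, ⟨(hUM z hzU).2 hz, hzU⟩, rfl⟩
end
end
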